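/- Let Φ : ℝⁿ → ℝ be C⁵ and convex with everywhere positive definite Hessian, let V, W : ℝⁿ → ℝ be C³ with μ = e^{−V}dx and ν = e^{−W}dx probability measures, and assume the Monge–Ampère equation e^{−V(x)} = e^{−W(∇Φ(x))} · det D²Φ(x) holds on all of ℝⁿ. Suppose there are constants 0 < c ≤ C and B > 0 such that c·Id ≤ D²V(x) ≤ C·Id and c·Id ≤ D²W(x) ≤ C·Id for all x, and for every unit vector e and every x: Tr[(∂_e D²V(x))²] ≤ B and Tr[(∂_e D²W(x))²] ≤ B. Then there exists a constant D > 0 depending only on c and C such that for every x ∈ ℝⁿ and every unit vector e: Tr[(∂_e D²Φ(x))²] ≤ D·B. -/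

import Mathlib

noncomputable section
open scoped BigOperators
open Filter MeasureTheory

/-- Partial derivative `∂_i f`. -/
def pd {n : ℕ} (f : (Fin n → ℝ) → ℝ) (i : Fin n) : (Fin n → ℝ) → ℝ :=
  fun x => fderiv ℝ f x (Pi.single i 1)

/-- Second partial derivative `f_{ij}`. -/
def pd2 {n : ℕ} (f : (Fin n → ℝ) → ℝ) (i j : Fin n) : (Fin n → ℝ) → ℝ :=
  pd (pd f i) j

/-- Third partial derivative `f_{ijk}`. -/
def pd3 {n : ℕ} (f : (Fin n → ℝ) → ℝ) (i j k : Fin n) : (Fin n → ℝ) → ℝ :=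
  pd (pd2 f i j) k

/-- Fourth partial derivative `f_{ijkl}`. -/
def pd4 {n : ℕ} (f : (Fin n → ℝ) → ℝ) (i j k l : Fin n) : (Fin n → ℝ) → ℝ :=
  pd (pd3 f i j k) l

/-- Fifth partial derivative. -/
def pd5 {n : ℕ} (f : (Fin n → ℝ) → ℝ) (i j k l m : Fin n) : (Fin n → ℝ) → ℝ :=
  pd (pd4 f i j k l) m

/-- The Hessian matrix `D²Φ(x)`, with entries `Φ_{ij}(x)`. -/
def hess {n : ℕ} (Φ : (Fin n → ℝ) → ℝ) (x : Fin n → ℝ) : Matrix (Fin n) (Fin n) ℝ :=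
  Matrix.of fun i j => pd2 Φ i j x

/-- The inverse Hessian matrix, with entries `Φ^{ij}(x)`. -/
def ihess {n : ℕ} (Φ : (Fin n → ℝ) → ℝ) (x : Fin n → ℝ) : Matrix (Fin n) (Fin n) ℝ :=
  (hess Φ x)⁻¹

/-- The gradient `∇Φ(x)`. -/
def grad {n : ℕ} (Φ : (Fin n → ℝ) → ℝ) (x : Fin n → ℝ) : Fin n → ℝ :=
  fun i => pd Φ i x

/-- The Calabi tensor `g_{ij} = Σ Φ_{iab} Φ_{jcd} Φ^{ac} Φ^{bd}`. -/
def calabi {n : ℕ} (Φ : (Fin n → ℝ) → ℝ) (i j : Fin n) (x : Fin n → ℝ) : ℝ :=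
  ∑ a, ∑ b, ∑ c, ∑ d,
    pd3 Φ i a b x * pd3 Φ j c d x * ihess Φ x a c * ihess Φ x b d

/-- `W^i := (∂_i W)(∇Φ)`. -/
def Wop {n : ℕ} (Φ W : (Fin n → ℝ) → ℝ) (i : Fin n) (x : Fin n → ℝ) : ℝ :=
  pd W i (grad Φ x)

/-- `Ŵ_{ij} := Σ_{a,b} W^{ab} Φ_{ai} Φ_{bj}` where `W^{ab} = (∂²_{ab}W)(∇Φ)`. -/
def What2 {n : ℕ} (Φ W : (Fin n → ℝ) → ℝ) (i j : Fin n) (x : Fin n → ℝ) : ℝ :=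
  ∑ a, ∑ b, pd2 W a b (grad Φ x) * pd2 Φ a i x * pd2 Φ b j x

/-- `Ŵ_{ijk} := Σ_{a,b,c} W^{abc} Φ_{ai} Φ_{bj} Φ_{ck}` where `W^{abc} = (∂³_{abc}W)(∇Φ)`. -/
def What3 {n : ℕ} (Φ W : (Fin n → ℝ) → ℝ) (i j k : Fin n) (x : Fin n → ℝ) : ℝ :=
  ∑ a, ∑ b, ∑ c, pd3 W a b c (grad Φ x) * pd2 Φ a i x * pd2 Φ b j x * pd2 Φ c k x

/-- Christoffel symbols `Γ^k_{pq} = ½ Σ_m Φ^{km} Φ_{mpq}` of the Hessian metric. -/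
def Γh {n : ℕ} (Φ : (Fin n → ℝ) → ℝ) (k p q : Fin n) (x : Fin n → ℝ) : ℝ :=
  (1/2) * ∑ m, ihess Φ x k m * pd3 Φ m p q x

/-- Covariant derivative of a (0,1)-tensor: `(∇T)_{p i}`. -/
def covD1 {n : ℕ} (Φ : (Fin n → ℝ) → ℝ) (T : Fin n → (Fin n → ℝ) → ℝ)
    (p i : Fin n) (x : Fin n → ℝ) : ℝ :=
  pd (T i) p x - ∑ m, Γh Φ m p i x * T m x

/-- Covariant derivative of a (0,2)-tensor: `(∇T)_{p i j}`. -/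
def covD2 {n : ℕ} (Φ : (Fin n → ℝ) → ℝ) (T : Fin n → Fin n → (Fin n → ℝ) → ℝ)
    (p i j : Fin n) (x : Fin n → ℝ) : ℝ :=
  pd (T i j) p x - ∑ m, Γh Φ m p i x * T m j x - ∑ m, Γh Φ m p j x * T i m x

/-- Covariant derivative of a (0,3)-tensor: `(∇T)_{p i j k}`. -/
def covD3 {n : ℕ} (Φ : (Fin n → ℝ) → ℝ) (T : Fin n → Fin n → Fin n → (Fin n → ℝ) → ℝ)
    (p i j k : Fin n) (x : Fin n → ℝ) : ℝ :=
  pd (T i j k) p x - ∑ m, Γh Φ m p i x * T m j k x - ∑ m, Γh Φ m p j x * T i m k x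
    - ∑ m, Γh Φ m p k x * T i j m x

/-- Covariant derivative of a (0,4)-tensor: `(∇T)_{p i j k l}`. -/
def covD4 {n : ℕ} (Φ : (Fin n → ℝ) → ℝ)
    (T : Fin n → Fin n → Fin n → Fin n → (Fin n → ℝ) → ℝ)
    (p i j k l : Fin n) (x : Fin n → ℝ) : ℝ :=
  pd (T i j k l) p x - ∑ m, Γh Φ m p i x * T m j k l x - ∑ m, Γh Φ m p j x * T i m k l x
    - ∑ m, Γh Φ m p k x * T i j m l x - ∑ m, Γh Φ m p l x * T i j k m x

/-- Weighted tensor Laplacian of a (0,1)-tensor: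
`(LT)_i = Σ Φ^{pq}(∇∇T)_{pq i} − ½ Σ_p (Σ_m Φ^{pm} V_m + W^p)(∇T)_{p i}`. -/
def LT1 {n : ℕ} (Φ V W : (Fin n → ℝ) → ℝ) (T : Fin n → (Fin n → ℝ) → ℝ)
    (i : Fin n) (x : Fin n → ℝ) : ℝ :=
  (∑ p, ∑ q, ihess Φ x p q * covD2 Φ (covD1 Φ T) p q i x)
    - (1/2) * ∑ p, ((∑ m, ihess Φ x p m * pd V m x) + Wop Φ W p x) * covD1 Φ T p i x

/-- Weighted tensor Laplacian of a (0,2)-tensor. -/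
def LT2 {n : ℕ} (Φ V W : (Fin n → ℝ) → ℝ) (T : Fin n → Fin n → (Fin n → ℝ) → ℝ)
    (i j : Fin n) (x : Fin n → ℝ) : ℝ :=
  (∑ p, ∑ q, ihess Φ x p q * covD3 Φ (covD2 Φ T) p q i j x)
    - (1/2) * ∑ p, ((∑ m, ihess Φ x p m * pd V m x) + Wop Φ W p x) * covD2 Φ T p i j x

/-- Weighted tensor Laplacian of a (0,3)-tensor. -/
def LT3 {n : ℕ} (Φ V W : (Fin n → ℝ) → ℝ) (T : Fin n → Fin n → Fin n → (Fin n → ℝ) → ℝ)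
    (i j k : Fin n) (x : Fin n → ℝ) : ℝ :=
  (∑ p, ∑ q, ihess Φ x p q * covD4 Φ (covD3 Φ T) p q i j k x)
    - (1/2) * ∑ p, ((∑ m, ihess Φ x p m * pd V m x) + Wop Φ W p x) * covD3 Φ T p i j k x

/-- `N_{piab} := Φ_{piab} − ½ Σ_{k,m} Φ^{km}(Φ_{mpi}Φ_{kab} + Φ_{mpa}Φ_{kib} + Φ_{mpb}Φ_{kia})`. -/
def Ncal {n : ℕ} (Φ : (Fin n → ℝ) → ℝ) (p i a b : Fin n) (x : Fin n → ℝ) : ℝ :=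
  pd4 Φ p i a b x - (1/2) * ∑ k, ∑ m, ihess Φ x k m *
    (pd3 Φ m p i x * pd3 Φ k a b x + pd3 Φ m p a x * pd3 Φ k i b x
      + pd3 Φ m p b x * pd3 Φ k i a x)

/-- Riemann curvature `R_{ikjl} := ¼ Σ_{a,m} Φ^{am}(Φ_{ila}Φ_{mkj} − Φ_{ija}Φ_{mkl})`. -/
def Rcal {n : ℕ} (Φ : (Fin n → ℝ) → ℝ) (i k j l : Fin n) (x : Fin n → ℝ) : ℝ :=
  (1/4) * ∑ a, ∑ m, ihess Φ x a m *
    (pd3 Φ i l a x * pd3 Φ m k j x - pd3 Φ i j a x * pd3 Φ m k l x)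

/-- The `h`-norm of a quadratic form `Q` at `x`:
`‖Q‖_h(x) = sup { Σ Q_{ij} v_i v_j : Σ Φ_{ij}(x) v_i v_j = 1 }`. -/
def hnorm {n : ℕ} (Φ : (Fin n → ℝ) → ℝ) (Q : Fin n → Fin n → ℝ) (x : Fin n → ℝ) : ℝ :=
  sSup {r | ∃ v : Fin n → ℝ,
    (∑ i, ∑ j, pd2 Φ i j x * v i * v j) = 1 ∧ r = ∑ i, ∑ j, Q i j * v i * v j}

/-- The matrix `A(x)` with entries `V_{ab} + Ŵ_{ab}`. -/
def Amat {n : ℕ} (Φ V W : (Fin n → ℝ) → ℝ) (x : Fin n → ℝ) : Matrix (Fin n) (Fin n) ℝ :=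
  Matrix.of fun a b => pd2 V a b x + What2 Φ W a b x

/-- The matrix `S_i(x)` with entries `V_{iab} − Ŵ_{iab}`. -/
def Smat {n : ℕ} (Φ V W : (Fin n → ℝ) → ℝ) (i : Fin n) (x : Fin n → ℝ) :
    Matrix (Fin n) (Fin n) ℝ :=
  Matrix.of fun a b => pd3 V i a b x - What3 Φ W i a b x

/-- `H_{ij}(x) := Tr[A(x)⁻¹ · S_i(x) · (D²Φ(x))⁻¹ · S_j(x)]`. -/
def Hten {n : ℕ} (Φ V W : (Fin n → ℝ) → ℝ) (i j : Fin n) (x : Fin n → ℝ) : ℝ :=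
  ((Amat Φ V W x)⁻¹ * Smat Φ V W i x * (hess Φ x)⁻¹ * Smat Φ V W j x).trace

/-- Euclidean operator norm of a matrix. -/
def eOpNorm {n : ℕ} (M : Matrix (Fin n) (Fin n) ℝ) : ℝ :=
  ‖LinearMap.toContinuousLinearMap (Matrix.toEuclideanLin M)‖

/-- Directional derivative of the Hessian: the matrix `∂_e D²F(x)`. -/
def dirHess {n : ℕ} (F : (Fin n → ℝ) → ℝ) (e : Fin n → ℝ) (x : Fin n → ℝ) :
    Matrix (Fin n) (Fin n) ℝ :=
  Matrix.of fun i j => ∑ k, e k * pd3 F k i j x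

/-- The quadratic form `⟨Qy, y⟩`. -/
def qform {n : ℕ} (Q : Matrix (Fin n) (Fin n) ℝ) (y : Fin n → ℝ) : ℝ :=
  ∑ i, ∑ j, Q i j * y j * y i

namespace MongeAmpere

open Matrix

section LinearAlgebra

variable {n : ℕ}

/-- A positive semidefinite real matrix is of the form `Yᵀ * Y`. -/
lemma exists_transpose_mul_self {A : Matrix (Fin n) (Fin n) ℝ} (hA : A.PosSemidef) :
    ∃ Y : Matrix (Fin n) (Fin n) ℝ, A = Yᵀ * Y := by
  open scoped MatrixOrder in
  obtain ⟨Y, hY⟩ := CStarAlgebra.nonneg_iff_eq_star_mul_self.mp hA.nonneg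
  exact ⟨Y, by rw [hY, star_eq_conjTranspose, conjTranspose_eq_transpose_of_trivial]⟩

/-- A positive definite matrix is congruent to the identity. -/
lemma exists_congruence_one {A : Matrix (Fin n) (Fin n) ℝ} (hA : A.PosDef) :
    ∃ P : Matrix (Fin n) (Fin n) ℝ, IsUnit P.det ∧ Pᵀ * A * P = 1 := by
  obtain ⟨Y, hY⟩ := exists_transpose_mul_self hA.posSemidef
  have hdet : IsUnit Y.det := by
    have := hA.det_pos
    rw [hY, det_mul, det_transpose] at this
    exact isUnit_iff_ne_zero.mpr fun h => by simp [h] at this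
  refine ⟨Y⁻¹, isUnit_nonsing_inv_det Y hdet, ?_⟩
  have h1 : (Y⁻¹)ᵀ * Yᵀ = 1 := by rw [← transpose_mul, mul_nonsing_inv Y hdet, transpose_one]
  rw [hY, ← Matrix.mul_assoc, h1, Matrix.one_mul, mul_nonsing_inv Y hdet]

/-- Simultaneous diagonalisation of a positive definite and a symmetric matrix by a congruence. -/
lemma exists_congruence_one_diagonal {A S : Matrix (Fin n) (Fin n) ℝ} (hA : A.PosDef)
    (hS : Sᵀ = S) : ∃ (P : Matrix (Fin n) (Fin n) ℝ) (τ : Fin n → ℝ),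
      IsUnit P.det ∧ Pᵀ * A * P = 1 ∧ Pᵀ * S * P = diagonal τ := by
  obtain ⟨P, hP, hPA⟩ := exists_congruence_one hA
  have hM : (Pᵀ * S * P).IsHermitian := by
    rw [IsHermitian, conjTranspose_eq_transpose_of_trivial]
    simp [transpose_mul, hS, Matrix.mul_assoc]
  set U : Matrix (Fin n) (Fin n) ℝ := (hM.eigenvectorUnitary : Matrix (Fin n) (Fin n) ℝ) with hU
  have hUU : Uᵀ * U = 1 := by
    have := Unitary.coe_star_mul_self hM.eigenvectorUnitary
    rwa [star_eq_conjTranspose, conjTranspose_eq_transpose_of_trivial] at this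
  have hspec := hM.spectral_theorem
  rw [Unitary.conjStarAlgAut_apply, star_eq_conjTranspose,
    conjTranspose_eq_transpose_of_trivial, ← hU] at hspec
  refine ⟨P * U, hM.eigenvalues, ?_, ?_, ?_⟩
  · rw [det_mul]
    refine hP.mul ?_
    have h := congrArg det hUU
    rw [det_mul, det_one] at h
    exact IsUnit.of_mul_eq_one_right _ h
  · calc (P * U)ᵀ * A * (P * U) = Uᵀ * (Pᵀ * A * P) * U := by
          simp only [transpose_mul, Matrix.mul_assoc]
      _ = 1 := by rw [hPA, Matrix.mul_one, hUU]
  · calc (P * U)ᵀ * S * (P * U) = Uᵀ * (Pᵀ * S * P) * U := by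
          simp only [transpose_mul, Matrix.mul_assoc]
      _ = (Uᵀ * U) * diagonal (RCLike.ofReal ∘ hM.eigenvalues) * (Uᵀ * U) := by
          conv_lhs => rw [hspec]
          simp only [Matrix.mul_assoc]
      _ = diagonal hM.eigenvalues := by rw [hUU, Matrix.one_mul, Matrix.mul_one]; rfl

/-- If `Pᵀ A P = 1` then `P Pᵀ = A⁻¹`. -/
lemma mul_transpose_eq_inv {A P : Matrix (Fin n) (Fin n) ℝ} (h : Pᵀ * A * P = 1) :
    P * Pᵀ = A⁻¹ := by
  have h1 : P * (Pᵀ * A) = 1 := mul_eq_one_comm.mp h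
  rw [← Matrix.mul_assoc] at h1
  exact (inv_eq_left_inv h1).symm

/-- The trace of a product of positive semidefinite matrices is nonnegative. -/
lemma trace_mul_nonneg {A B : Matrix (Fin n) (Fin n) ℝ} (hA : A.PosSemidef) (hB : B.PosSemidef) :
    0 ≤ (A * B).trace := by
  obtain ⟨Y, hY⟩ := exists_transpose_mul_self hB
  have := hA.mul_mul_conjTranspose_same Y
  have h2 := this.trace_nonneg
  rw [conjTranspose_eq_transpose_of_trivial] at h2
  rwa [hY, ← Matrix.mul_assoc, trace_mul_comm, ← Matrix.mul_assoc]

/-- `Tr[N S N S] ≤ k² Tr[S²]` when `0 ≤ N ≤ k` and `S` is symmetric. -/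
lemma trace_conj_sq_le {N S : Matrix (Fin n) (Fin n) ℝ} {k : ℝ} (hk : 0 ≤ k)
    (hN : N.PosSemidef) (hNk : (k • (1 : Matrix (Fin n) (Fin n) ℝ) - N).PosSemidef) (hS : Sᵀ = S) :
    (N * S * N * S).trace ≤ k ^ 2 * (S * S).trace := by
  have h1 : (S * N * S).PosSemidef := by
    have := hN.mul_mul_conjTranspose_same S
    rwa [conjTranspose_eq_transpose_of_trivial, hS] at this
  have h2 : (S * S).PosSemidef := by
    have := posSemidef_self_mul_conjTranspose S
    rwa [conjTranspose_eq_transpose_of_trivial, hS] at this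
  have h3 := trace_mul_nonneg hNk h1
  have h4 := trace_mul_nonneg hNk h2
  rw [Matrix.sub_mul, smul_mul, Matrix.one_mul, trace_sub, trace_smul, smul_eq_mul] at h3 h4
  have e1 : (N * S * N * S).trace = (N * (S * N * S)).trace := by simp only [Matrix.mul_assoc]
  have e2 : (S * N * S).trace = (N * (S * S)).trace := by
    rw [trace_mul_comm, ← Matrix.mul_assoc, trace_mul_comm]
  rw [e1]
  rw [e2] at h3
  nlinarith

/-- Concavity of `log det`: `log det B - log det A ≤ Tr[A⁻¹ B] - n`. -/
lemma log_det_sub_le {A B : Matrix (Fin n) (Fin n) ℝ} (hA : A.PosDef) (hB : B.PosDef) :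
    Real.log B.det - Real.log A.det ≤ (A⁻¹ * B).trace - n := by
  obtain ⟨P, hP, hPA⟩ := exists_congruence_one hA
  have hM : (Pᵀ * B * P).PosDef := by
    have := hB.conjTranspose_mul_mul_same (B := P)
      (mulVec_injective_of_isUnit ((isUnit_iff_isUnit_det P).mpr hP))
    rwa [conjTranspose_eq_transpose_of_trivial] at this
  have htr : (Pᵀ * B * P).trace = (A⁻¹ * B).trace := by
    rw [trace_mul_comm, ← Matrix.mul_assoc, mul_transpose_eq_inv hPA]
  have hdet : (Pᵀ * B * P).det * A.det = B.det := by
    have := congrArg det hPA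
    rw [det_mul, det_mul, det_transpose, det_one] at this
    rw [det_mul, det_mul, det_transpose]
    linear_combination B.det * this
  have hlog : Real.log (Pᵀ * B * P).det = Real.log B.det - Real.log A.det := by
    rw [← hdet, Real.log_mul hM.det_pos.ne' hA.det_pos.ne']
    ring
  rw [← hlog, ← htr, hM.isHermitian.det_eq_prod_eigenvalues, hM.isHermitian.trace_eq_sum_eigenvalues]
  simp only [RCLike.ofReal_real_eq_id, id_eq]
  rw [Real.log_prod (fun i _ => (hM.eigenvalues_pos i).ne')]
  have : ∑ i, Real.log (hM.isHermitian.eigenvalues i) ≤ ∑ i, (hM.isHermitian.eigenvalues i - 1) :=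
    Finset.sum_le_sum fun i _ => Real.log_le_sub_one_of_pos (hM.eigenvalues_pos i)
  simpa using this

/-- `k⁻¹ ≤ A` implies `A⁻¹ ≤ k`. -/
lemma inv_le_of_le {A : Matrix (Fin n) (Fin n) ℝ} {k : ℝ} (hk : 0 < k) (hA : A.PosDef)
    (h : (A - k⁻¹ • (1 : Matrix (Fin n) (Fin n) ℝ)).PosSemidef) :
    (k • (1 : Matrix (Fin n) (Fin n) ℝ) - A⁻¹).PosSemidef := by
  refine PosSemidef.of_dotProduct_mulVec_nonneg ?_ fun x => ?_
  · exact (isHermitian_one.smul (by simp [IsSelfAdjoint])).sub hA.inv.isHermitian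
  · set z := A⁻¹ *ᵥ x with hz
    have hx : A *ᵥ z = x := by
      rw [hz, mulVec_mulVec, mul_nonsing_inv A ((isUnit_iff_isUnit_det A).mp hA.isUnit),
        one_mulVec]
    have h1 := h.dotProduct_mulVec_nonneg z
    have h2 : 0 ≤ (k • x - z) ⬝ᵥ (k • x - z) :=
      Finset.sum_nonneg fun i _ => mul_self_nonneg _
    simp only [star_trivial, sub_mulVec, smul_mulVec, one_mulVec, dotProduct_sub, sub_dotProduct,
      dotProduct_smul, smul_dotProduct, smul_eq_mul, hx, ← hz] at h1 h2 ⊢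
    rw [dotProduct_comm z x] at h1 h2
    have h3 := mul_le_mul_of_nonneg_left h1 hk.le
    have h4 : k * (x ⬝ᵥ z - k⁻¹ * (z ⬝ᵥ z)) = k * (x ⬝ᵥ z) - z ⬝ᵥ z := by field_simp
    rw [h4] at h3
    have : 0 ≤ k * (k * (x ⬝ᵥ x) - x ⬝ᵥ z) := by linarith
    exact nonneg_of_mul_nonneg_right this hk

/-- `A ≤ k` implies `k⁻¹ ≤ A⁻¹`. -/
lemma le_inv_of_le {A : Matrix (Fin n) (Fin n) ℝ} {k : ℝ} (hk : 0 < k) (hA : A.PosDef)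
    (h : (k • (1 : Matrix (Fin n) (Fin n) ℝ) - A).PosSemidef) :
    (A⁻¹ - k⁻¹ • (1 : Matrix (Fin n) (Fin n) ℝ)).PosSemidef := by
  refine PosSemidef.of_dotProduct_mulVec_nonneg ?_ fun x => ?_
  · exact hA.inv.isHermitian.sub (isHermitian_one.smul (by simp [IsSelfAdjoint]))
  · set z := A⁻¹ *ᵥ x with hz
    have hx : A *ᵥ z = x := by
      rw [hz, mulVec_mulVec, mul_nonsing_inv A ((isUnit_iff_isUnit_det A).mp hA.isUnit),
        one_mulVec]
    have h1 := h.dotProduct_mulVec_nonneg x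
    have h2 := hA.posSemidef.dotProduct_mulVec_nonneg (x - k • z)
    have hsymm : z ⬝ᵥ A *ᵥ x = x ⬝ᵥ x := by
      have hT : Aᵀ = A := by
        rw [← conjTranspose_eq_transpose_of_trivial]; exact hA.isHermitian
      rw [dotProduct_mulVec, ← mulVec_transpose, hT, hx]
    simp only [star_trivial, sub_mulVec, smul_mulVec, one_mulVec, dotProduct_sub, sub_dotProduct,
      dotProduct_smul, smul_dotProduct, smul_eq_mul, mulVec_sub, mulVec_smul, hx, hsymm,
      ← hz] at h1 h2 ⊢
    rw [dotProduct_comm z x] at h2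
    have h3 : k ^ 2 * (x ⬝ᵥ z - k⁻¹ * (x ⬝ᵥ x)) = k ^ 2 * (x ⬝ᵥ z) - k * (x ⬝ᵥ x) := by
      field_simp
    have : 0 ≤ k ^ 2 * (x ⬝ᵥ z - k⁻¹ * (x ⬝ᵥ x)) := by rw [h3]; nlinarith
    exact nonneg_of_mul_nonneg_right this (by positivity)

end LinearAlgebra

section Calculus

variable {n : ℕ}

lemma contDiff_pd {f : (Fin n → ℝ) → ℝ} {k m : WithTop ℕ∞} (hf : ContDiff ℝ k f)
    (hm : m + 1 ≤ k) (i : Fin n) : ContDiff ℝ m (pd f i) :=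
  (hf.fderiv_right hm).clm_apply contDiff_const

lemma fderiv_eq_sum (f : (Fin n → ℝ) → ℝ) (x v : Fin n → ℝ) :
    fderiv ℝ f x v = ∑ i, v i * pd f i x := by
  conv_lhs => rw [pi_eq_sum_univ' v]
  simp [pd, map_sum]

lemma fderiv_eq_grad_dotProduct (f : (Fin n → ℝ) → ℝ) (x v : Fin n → ℝ) :
    fderiv ℝ f x v = grad f x ⬝ᵥ v := by
  rw [fderiv_eq_sum, dotProduct]
  exact Finset.sum_congr rfl fun i _ => mul_comm _ _

lemma pd_comm {f : (Fin n → ℝ) → ℝ} (hf : ContDiff ℝ 2 f) (i j : Fin n) :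
    pd (pd f i) j = pd (pd f j) i := by
  funext x
  have hd : DifferentiableAt ℝ (fderiv ℝ f) x :=
    ((hf.fderiv_right (m := 1) (by norm_num)).differentiable (by norm_num)) x
  have key : ∀ a b : Fin n, pd (pd f a) b x
      = fderiv ℝ (fderiv ℝ f) x (Pi.single b 1) (Pi.single a 1) := fun a b => by
    change fderiv ℝ (fun y => fderiv ℝ f y (Pi.single a 1)) x (Pi.single b 1) = _
    rw [fderiv_clm_apply hd (differentiableAt_const _)]
    simp
  rw [key, key]
  exact hf.contDiffAt.isSymmSndFDerivAt (by simp) _ _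

/-- Derivative of a function along a line. -/
lemma hasDerivAt_line {F : Type*} [NormedAddCommGroup F] [NormedSpace ℝ F] {f : (Fin n → ℝ) → F}
    (hf : Differentiable ℝ f) (x v : Fin n → ℝ) (t : ℝ) :
    HasDerivAt (fun s : ℝ => f (x + s • v)) (fderiv ℝ f (x + t • v) v) t := by
  have h1 : HasDerivAt (fun s : ℝ => x + s • v) v t := by
    simpa using ((hasDerivAt_id t).smul_const v).const_add x
  exact (hf (x + t • v)).hasFDerivAt.comp_hasDerivAt t h1

/-- Second derivative of a scalar function along a line. -/
lemma hasDerivAt_fderiv_line {f : (Fin n → ℝ) → ℝ} (hf : ContDiff ℝ 2 f) (x v : Fin n → ℝ)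
    (t : ℝ) : HasDerivAt (fun s : ℝ => fderiv ℝ f (x + s • v) v)
      (v ⬝ᵥ hess f (x + t • v) *ᵥ v) t := by
  have h1 : ∀ i, Differentiable ℝ (pd f i) := fun i =>
    (contDiff_pd hf (m := 1) (by norm_num) i).differentiable (by norm_num)
  have h2 : HasDerivAt (fun s : ℝ => ∑ i, v i * pd f i (x + s • v))
      (∑ i, v i * fderiv ℝ (pd f i) (x + t • v) v) t :=
    HasDerivAt.fun_sum fun i _ => (hasDerivAt_line (h1 i) x v t).const_mul (v i)
  simp only [← fderiv_eq_sum] at h2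
  convert h2 using 1
  simp only [dotProduct, mulVec, fderiv_eq_sum, hess, pd2, of_apply]
  exact Finset.sum_congr rfl fun i _ => by
    congr 1; exact Finset.sum_congr rfl fun j _ => mul_comm _ _

lemma hess_transpose {f : (Fin n → ℝ) → ℝ} (hf : ContDiff ℝ 2 f) (x : Fin n → ℝ) :
    (hess f x)ᵀ = hess f x := by
  ext i j
  simp only [transpose_apply, hess, of_apply, pd2]
  rw [pd_comm hf]

/-- One-variable Taylor inequality with a lower bound of the second derivative. -/
lemma taylor_le_of_deriv2_ge {g g' g'' : ℝ → ℝ} {k : ℝ} (h1 : ∀ t, HasDerivAt g (g' t) t)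
    (h2 : ∀ t, HasDerivAt g' (g'' t) t) (hk : ∀ t, k ≤ g'' t) :
    g 0 + g' 0 + k / 2 ≤ g 1 := by
  have hmono : Monotone fun t => g' t - k * t := by
    refine monotone_of_hasDerivAt_nonneg (f' := fun t => g'' t - k * 1)
      (fun t => (h2 t).sub ((hasDerivAt_id t).const_mul k)) fun t => ?_
    have := hk t
    simp only [Pi.zero_apply]
    linarith
  have hd : ∀ t, HasDerivAt (fun t => g t - g' 0 * t - k / 2 * t ^ 2)
      (g' t - g' 0 * 1 - k / 2 * (2 * t ^ (2 - 1) * 1)) t := fun t =>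
    ((h1 t).sub ((hasDerivAt_id t).const_mul _)).sub (((hasDerivAt_id t).pow 2).const_mul _)
  have hmono2 : MonotoneOn (fun t => g t - g' 0 * t - k / 2 * t ^ 2) (Set.Icc 0 1) := by
    refine monotoneOn_of_deriv_nonneg (convex_Icc 0 1)
      (fun t _ => (hd t).continuousAt.continuousWithinAt)
      (fun t _ => (hd t).differentiableAt.differentiableWithinAt) fun t ht => ?_
    rw [interior_Icc] at ht
    rw [(hd t).deriv]
    have := hmono ht.1.le
    simp only at this
    norm_num
    linarith
  have := hmono2 (Set.left_mem_Icc.mpr zero_le_one) (Set.right_mem_Icc.mpr zero_le_one) zero_le_one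
  simp only at this
  linarith

/-- Uniform convexity inequality from a lower Hessian bound. -/
lemma add_grad_add_le {f : (Fin n → ℝ) → ℝ} (hf : ContDiff ℝ 2 f) {k : ℝ}
    (hk : ∀ x, (hess f x - k • (1 : Matrix (Fin n) (Fin n) ℝ)).PosSemidef) (x v : Fin n → ℝ) :
    f x + grad f x ⬝ᵥ v + k / 2 * (v ⬝ᵥ v) ≤ f (x + v) := by
  have := taylor_le_of_deriv2_ge (k := k * (v ⬝ᵥ v))
    (hasDerivAt_line (hf.differentiable (by norm_num)) x v)
    (hasDerivAt_fderiv_line hf x v) fun t => by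
      have := (hk (x + t • v)).dotProduct_mulVec_nonneg v
      simp only [star_trivial, sub_mulVec, smul_mulVec, one_mulVec, dotProduct_sub,
        dotProduct_smul, smul_eq_mul] at this
      linarith
  simp only [zero_smul, one_smul, add_zero, fderiv_eq_grad_dotProduct] at this
  linarith

/-- Semiconcavity inequality from an upper Hessian bound. -/
lemma le_add_grad_add {f : (Fin n → ℝ) → ℝ} (hf : ContDiff ℝ 2 f) {k : ℝ}
    (hk : ∀ x, (k • (1 : Matrix (Fin n) (Fin n) ℝ) - hess f x).PosSemidef) (x v : Fin n → ℝ) :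
    f (x + v) ≤ f x + grad f x ⬝ᵥ v + k / 2 * (v ⬝ᵥ v) := by
  have := taylor_le_of_deriv2_ge (k := -(k * (v ⬝ᵥ v)))
    (fun t => (hasDerivAt_line (hf.differentiable (by norm_num)) x v t).neg)
    (fun t => (hasDerivAt_fderiv_line hf x v t).neg) fun t => by
      have := (hk (x + t • v)).dotProduct_mulVec_nonneg v
      simp only [star_trivial, sub_mulVec, smul_mulVec, one_mulVec, dotProduct_sub,
        dotProduct_smul, smul_eq_mul] at this
      linarith
  simp only [zero_smul, one_smul, add_zero, fderiv_eq_grad_dotProduct, Pi.neg_apply] at this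
  linarith

/-- Second derivative test at a local maximum, in one variable. -/
lemma deriv2_nonpos_of_isLocalMax {g g' : ℝ → ℝ} {a : ℝ} (hmax : IsLocalMax g 0)
    (h1 : ∀ᶠ t in nhds 0, HasDerivAt g (g' t) t) (h2 : HasDerivAt g' a 0) : g' 0 = 0 ∧ a ≤ 0 := by
  have hz : g' 0 = 0 := hmax.hasDerivAt_eq_zero h1.self_of_nhds
  refine ⟨hz, ?_⟩
  by_contra! ha
  have hev : deriv g =ᶠ[nhds 0] g' := h1.mono fun t ht => ht.deriv
  have hdd : deriv (deriv g) 0 = a := by rw [hev.deriv_eq, h2.deriv]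
  have hmin : IsLocalMin g 0 := isLocalMin_of_deriv_deriv_pos (by rw [hdd]; exact ha)
    (by rw [h1.self_of_nhds.deriv, hz]) h1.self_of_nhds.continuousAt
  have hconst : g =ᶠ[nhds 0] fun _ => g 0 := by
    filter_upwards [hmin, hmax] with t h3 h4 using le_antisymm h4 h3
  have h5 : deriv g =ᶠ[nhds 0] fun _ => 0 := by
    filter_upwards [hconst.eventually_nhds] with t ht
    rw [Filter.EventuallyEq.deriv_eq ht, deriv_const]
  have h6 : deriv (deriv g) 0 = 0 := by rw [h5.deriv_eq, deriv_const]
  linarith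

lemma contDiff_grad {f : (Fin n → ℝ) → ℝ} {k m : WithTop ℕ∞} (hf : ContDiff ℝ k f)
    (hm : m + 1 ≤ k) : ContDiff ℝ m (grad f) :=
  contDiff_pi.mpr fun i => contDiff_pd hf hm i

/-- The derivative of the gradient map is the Hessian matrix. -/
lemma hasFDerivAt_grad {f : (Fin n → ℝ) → ℝ} (hf : ContDiff ℝ 2 f) (x : Fin n → ℝ) :
    HasFDerivAt (grad f) (LinearMap.toContinuousLinearMap (Matrix.toLin' (hess f x))) x := by
  refine hasFDerivAt_pi'' fun i => ?_
  have h1 : DifferentiableAt ℝ (pd f i) x :=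
    (contDiff_pd hf (m := 1) (by norm_num) i).differentiable (by norm_num) x
  refine h1.hasFDerivAt.congr_fderiv (ContinuousLinearMap.ext fun v => ?_)
  rw [fderiv_eq_sum]
  simp only [ContinuousLinearMap.comp_apply, ContinuousLinearMap.proj_apply,
    LinearMap.coe_toContinuousLinearMap', toLin'_apply, mulVec, dotProduct,
    hess, pd2, of_apply]
  exact Finset.sum_congr rfl fun j _ => mul_comm _ _

end Calculus

section Transport

variable {n : ℕ}

/-- A convex potential `Φ` of class `C²` whose gradient transports the probability density
`exp (-V)` to `exp (-W)`, where `D²V ≤ C` and `D²W ≥ c`. -/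
structure IsTransport (Φ V W : (Fin n → ℝ) → ℝ) (c C : ℝ) : Prop where
  contDiff : ContDiff ℝ 2 Φ
  posDef : ∀ x, (hess Φ x).PosDef
  contDiff_source : ContDiff ℝ 2 V
  contDiff_target : ContDiff ℝ 2 W
  source_le : ∀ x, (C • (1 : Matrix (Fin n) (Fin n) ℝ) - hess V x).PosSemidef
  target_ge : ∀ x, (hess W x - c • (1 : Matrix (Fin n) (Fin n) ℝ)).PosSemidef
  lintegral_source : ∫⁻ x, ENNReal.ofReal (Real.exp (-V x)) = 1
  lintegral_target : ∫⁻ x, ENNReal.ofReal (Real.exp (-W x)) = 1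
  monge_ampere : ∀ x, Real.exp (-V x) = Real.exp (-W (grad Φ x)) * (hess Φ x).det

lemma abs_dotProduct_le (u v : Fin n → ℝ) : |u ⬝ᵥ v| ≤ n * (‖u‖ * ‖v‖) := by
  calc |∑ i, u i * v i| ≤ ∑ i, |u i * v i| := Finset.abs_sum_le_sum_abs _ _
    _ ≤ ∑ _i : Fin n, ‖u‖ * ‖v‖ := Finset.sum_le_sum fun i _ => by
        rw [abs_mul]
        exact mul_le_mul (norm_le_pi_norm u i) (norm_le_pi_norm v i) (abs_nonneg _) (norm_nonneg _)
    _ = n * (‖u‖ * ‖v‖) := by simp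

lemma exists_abs_apply_eq_norm [Nonempty (Fin n)] (u : Fin n → ℝ) : ∃ i, |u i| = ‖u‖ := by
  obtain ⟨i, -, hi⟩ := Finset.exists_max_image Finset.univ (fun i => |u i|) Finset.univ_nonempty
  refine ⟨i, le_antisymm (norm_le_pi_norm u i) ?_⟩
  exact (pi_norm_le_iff_of_nonneg (abs_nonneg _)).mpr fun j => hi j (Finset.mem_univ j)

lemma grad_dotProduct_le_sub {Φ : (Fin n → ℝ) → ℝ} (hΦ : ContDiff ℝ 2 Φ)
    (hpos : ∀ x, (hess Φ x).PosDef) (x v : Fin n → ℝ) :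
    Φ x + grad Φ x ⬝ᵥ v ≤ Φ (x + v) := by
  have := add_grad_add_le hΦ (k := 0) (fun x => by simpa using (hpos x).posSemidef) x v
  linarith

/-- The gradient of a function with positive definite Hessian is strictly monotone. -/
lemma grad_sub_dotProduct_pos {Φ : (Fin n → ℝ) → ℝ} (hΦ : ContDiff ℝ 2 Φ)
    (hpos : ∀ x, (hess Φ x).PosDef) (x : Fin n → ℝ) {v : Fin n → ℝ} (hv : v ≠ 0) :
    0 < (grad Φ (x + v) - grad Φ x) ⬝ᵥ v := by
  have hm := strictMono_of_hasDerivAt_pos (hasDerivAt_fderiv_line hΦ x v) fun t => by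
    simpa using (hpos (x + t • v)).dotProduct_mulVec_pos hv
  have := hm zero_lt_one
  simp only [zero_smul, one_smul, add_zero, fderiv_eq_grad_dotProduct] at this
  rw [sub_dotProduct]
  linarith

lemma grad_injective {Φ : (Fin n → ℝ) → ℝ} (hΦ : ContDiff ℝ 2 Φ)
    (hpos : ∀ x, (hess Φ x).PosDef) : Function.Injective (grad Φ) := by
  intro x y hxy
  by_contra hne
  have := grad_sub_dotProduct_pos hΦ hpos x (v := y - x) (sub_ne_zero.mpr (Ne.symm hne))
  rw [add_sub_cancel, hxy, sub_self, zero_dotProduct] at this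
  exact lt_irrefl _ this

variable {Φ V W : (Fin n → ℝ) → ℝ} {c C : ℝ}

/-- Change of variables: the gradient map preserves the mass of measurable sets. -/
lemma IsTransport.lintegral_image (h : IsTransport Φ V W c C) {S : Set (Fin n → ℝ)}
    (hS : MeasurableSet S) :
    ∫⁻ w in grad Φ '' S, ENNReal.ofReal (Real.exp (-W w))
      = ∫⁻ x in S, ENNReal.ofReal (Real.exp (-V x)) := by
  rw [lintegral_image_eq_lintegral_abs_det_fderiv_mul volume hS
    (fun x _ => (hasFDerivAt_grad h.contDiff x).hasFDerivWithinAt)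
    ((grad_injective h.contDiff h.posDef).injOn)]
  refine lintegral_congr fun x => ?_
  rw [← ENNReal.ofReal_mul (abs_nonneg _), h.monge_ampere x, mul_comm]
  congr 2
  rw [ContinuousLinearMap.det, LinearMap.coe_toContinuousLinearMap, LinearMap.det_toLin',
    abs_of_pos (h.posDef x).det_pos]

lemma IsTransport.denseRange (h : IsTransport Φ V W c C) : DenseRange (grad Φ) := by
  rw [DenseRange, dense_iff_closure_eq, ← Set.compl_empty_iff]
  set U := (closure (Set.range (grad Φ)))ᶜ with hU
  have hUo : IsOpen U := isClosed_closure.isOpen_compl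
  rw [← hUo.measure_eq_zero_iff volume]
  have hmeas : Measurable fun w => ENNReal.ofReal (Real.exp (-W w)) := by
    have := h.contDiff_target.continuous
    fun_prop
  have h1 := h.lintegral_image MeasurableSet.univ
  rw [Set.image_univ, Measure.restrict_univ, h.lintegral_source] at h1
  have hdisj : Disjoint (Set.range (grad Φ)) U :=
    Set.disjoint_compl_right_iff_subset.mpr subset_closure
  have h2 := lintegral_union (μ := volume) (f := fun w => ENNReal.ofReal (Real.exp (-W w)))
    hUo.measurableSet hdisj
  have h3 : ∫⁻ w in Set.range (grad Φ) ∪ U, ENNReal.ofReal (Real.exp (-W w)) ≤ 1 :=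
    (setLIntegral_le_lintegral _ _).trans h.lintegral_target.le
  rw [h2, h1] at h3
  have h4 : ∫⁻ w in U, ENNReal.ofReal (Real.exp (-W w)) = 0 := by
    have h5 : (1 : ENNReal) + ∫⁻ w in U, ENNReal.ofReal (Real.exp (-W w)) ≤ 1 + 0 := by simpa using h3
    exact le_antisymm ((ENNReal.add_le_add_iff_left ENNReal.one_ne_top).mp h5) bot_le
  rw [setLIntegral_eq_zero_iff hUo.measurableSet hmeas] at h4
  have h6 : ∀ᵐ w, w ∉ U := h4.mono fun w hw hwU => by
    have := hw hwU
    rw [ENNReal.ofReal_eq_zero] at this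
    exact absurd this (not_le.mpr (Real.exp_pos _))
  simpa [ae_iff] using h6

/-- A strongly log-concave density has Gaussian tails. -/
lemma exists_lintegral_exp_le (hW : ContDiff ℝ 2 W) (hc : 0 < c)
    (hge : ∀ x, (hess W x - c • (1 : Matrix (Fin n) (Fin n) ℝ)).PosSemidef) :
    ∃ M : ℝ, 0 ≤ M ∧
      ∫⁻ w, ENNReal.ofReal (Real.exp (c / 4 * ‖w‖ ^ 2 - W w)) ≤ ENNReal.ofReal M := by
  set G : (Fin n → ℝ) → ℝ := fun w => Real.exp (2 / c * (grad W 0 ⬝ᵥ grad W 0) - W 0) *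
    ∏ i, Real.exp (-(c / 8) * w i ^ 2) with hG
  have hGint : Integrable G := by
    refine Integrable.const_mul ?_ _
    exact Integrable.fintype_prod (f := fun (_ : Fin n) (t : ℝ) => Real.exp (-(c / 8) * t ^ 2))
      (μ := fun _ => volume) fun _ => integrable_exp_neg_mul_sq (by positivity)
  have hG0 : ∀ w, 0 ≤ G w := fun w => by positivity
  have hle : ∀ w, Real.exp (c / 4 * ‖w‖ ^ 2 - W w) ≤ G w := fun w => by
    rw [hG]
    simp only
    rw [← Real.exp_sum, ← Real.exp_add]
    refine Real.exp_le_exp.mpr ?_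
    have h1 := add_grad_add_le hW hge 0 w
    rw [zero_add] at h1
    have h2 : ‖w‖ ^ 2 ≤ w ⬝ᵥ w := by
      rcases isEmpty_or_nonempty (Fin n) with hn | hn
      · simp [Subsingleton.elim w 0]
      · obtain ⟨i, hi⟩ := exists_abs_apply_eq_norm w
        rw [← hi, sq_abs, dotProduct, pow_two]
        exact Finset.single_le_sum (f := fun i => w i * w i) (fun j _ => mul_self_nonneg _)
          (Finset.mem_univ i)
    have h3 : 0 ≤ ∑ i, (2 / c * (grad W 0 i * grad W 0 i) + grad W 0 i * w i
        + c / 8 * (w i * w i)) := Finset.sum_nonneg fun i _ => by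
      have : 2 / c * (grad W 0 i * grad W 0 i) + grad W 0 i * w i + c / 8 * (w i * w i)
        = (1 / (8 * c)) * (4 * grad W 0 i + c * w i) ^ 2 := by field_simp; ring
      rw [this]; positivity
    simp only [Finset.sum_add_distrib, ← Finset.mul_sum] at h3
    rw [← Finset.mul_sum]
    simp only [dotProduct, pow_two] at *
    nlinarith
  refine ⟨∫ w, G w, integral_nonneg hG0, ?_⟩
  rw [ofReal_integral_eq_lintegral_ofReal hGint (Eventually.of_forall hG0)]
  exact lintegral_mono fun w => ENNReal.ofReal_le_ofReal (hle w)

/-- The gradient grows at most linearly. -/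
lemma IsTransport.exists_norm_grad_le (h : IsTransport Φ V W c C) (hc : 0 < c) (hC : 0 < C) :
    ∃ A : ℝ, 0 ≤ A ∧ ∀ x, ‖grad Φ x‖ ≤ A * (1 + ‖x‖) := by
  rcases isEmpty_or_nonempty (Fin n) with hn | hn
  · exact ⟨0, le_rfl, fun x => by simp [Subsingleton.elim (grad Φ x) 0]⟩
  have hn0 : (0 : ℝ) < n := by exact_mod_cast Fin.pos_iff_nonempty.mpr hn
  obtain ⟨M, hM0, hM⟩ := exists_lintegral_exp_le h.contDiff_target hc h.target_ge
  set δ : ℝ := 1 / (2 * n) with hδ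
  have hδ0 : 0 < δ := by positivity
  have hnδ : n * δ = 1 / 2 := by rw [hδ]; field_simp
  have hδ1 : δ ≤ 1 := by
    rw [hδ, div_le_one (by positivity)]
    have : (1 : ℝ) ≤ n := by exact_mod_cast Fin.pos_iff_nonempty.mpr hn
    linarith
  set K : ℝ := |V 0| + n * ‖grad V 0‖ + C / 2 * n with hK
  have hK0 : 0 ≤ K := by positivity
  have hV : ∀ z, V z ≤ K * (1 + ‖z‖) ^ 2 := fun z => by
    have h1 := le_add_grad_add h.contDiff_source h.source_le 0 z
    rw [zero_add] at h1
    have h2 := (le_abs_self _).trans (abs_dotProduct_le (grad V 0) z)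
    have h3 := (le_abs_self _).trans (abs_dotProduct_le z z)
    have h4 := le_abs_self (V 0)
    have h5 := norm_nonneg z
    have h6 := norm_nonneg (grad V 0)
    have e1 : |V 0| ≤ |V 0| * (1 + ‖z‖) ^ 2 := le_mul_of_one_le_right (abs_nonneg _) (by nlinarith)
    have e2 : n * (‖grad V 0‖ * ‖z‖) ≤ n * ‖grad V 0‖ * (1 + ‖z‖) ^ 2 := by
      rw [← mul_assoc]
      exact mul_le_mul_of_nonneg_left (by nlinarith) (by positivity)
    have e3 : C / 2 * (z ⬝ᵥ z) ≤ C / 2 * n * (1 + ‖z‖) ^ 2 := by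
      rw [mul_assoc]
      refine mul_le_mul_of_nonneg_left (h3.trans ?_) (by positivity)
      exact mul_le_mul_of_nonneg_left (by nlinarith) (by positivity)
    rw [hK]
    linarith
  have hWm : Measurable fun w => ENNReal.ofReal (Real.exp (-W w)) := by
    have := h.contDiff_target.continuous
    fun_prop
  -- the key exponential inequality
  have key : ∀ x, (2 * δ) ^ n * Real.exp (-(K * (3 + ‖x‖) ^ 2))
      * Real.exp (c / 4 * (‖grad Φ x‖ / 3) ^ 2) ≤ M := fun x => by
    set y := grad Φ x with hy
    obtain ⟨i, hi⟩ := exists_abs_apply_eq_norm y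
    obtain ⟨s, hs1, hsy⟩ : ∃ s : ℝ, |s| = 1 ∧ s * y i = |y i| := by
      rcases le_total 0 (y i) with hp | hp
      · exact ⟨1, by simp, by rw [abs_of_nonneg hp, one_mul]⟩
      · exact ⟨-1, by simp, by rw [abs_of_nonpos hp, neg_one_mul]⟩
    set p : Fin n → ℝ := x + Pi.single i s with hp
    set S := Metric.closedBall p δ with hS
    have hfar : ∀ z ∈ S, ‖y‖ / 3 ≤ ‖grad Φ z‖ := fun z hz => by
      set u := z - p with hu
      have hun : ‖u‖ ≤ δ := by rw [hu, ← dist_eq_norm]; exact hz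
      have hz' : z = x + (Pi.single i s + u) := by rw [hu, hp]; abel
      have hmono : 0 ≤ (grad Φ z - y) ⬝ᵥ (Pi.single i s + u) := by
        by_cases h0 : Pi.single i s + u = 0
        · rw [h0, dotProduct_zero]
        · rw [hz']
          exact (grad_sub_dotProduct_pos h.contDiff h.posDef x h0).le
      rw [sub_dotProduct, dotProduct_add, dotProduct_add, dotProduct_single, dotProduct_single,
        mul_comm (y i), hsy, hi] at hmono
      have e1 := (abs_le.mp (abs_dotProduct_le y u)).1
      have e2 := (abs_le.mp (abs_dotProduct_le (grad Φ z) u)).2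
      have e3 : grad Φ z i * s ≤ ‖grad Φ z‖ := by
        refine (le_abs_self _).trans ?_
        rw [abs_mul, hs1, mul_one]
        exact norm_le_pi_norm (grad Φ z) i
      have e4 : n * (‖y‖ * ‖u‖) ≤ 1 / 2 * ‖y‖ := by
        rw [← hnδ]
        nlinarith [mul_le_mul_of_nonneg_left hun (mul_nonneg hn0.le (norm_nonneg y))]
      have e5 : n * (‖grad Φ z‖ * ‖u‖) ≤ 1 / 2 * ‖grad Φ z‖ := by
        rw [← hnδ]
        nlinarith [mul_le_mul_of_nonneg_left hun (mul_nonneg hn0.le (norm_nonneg (grad Φ z)))]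
      linarith
    have hnear : ∀ z ∈ S, ENNReal.ofReal (Real.exp (-(K * (3 + ‖x‖) ^ 2)))
        ≤ ENNReal.ofReal (Real.exp (-V z)) := fun z hz => by
      refine ENNReal.ofReal_le_ofReal (Real.exp_le_exp.mpr (neg_le_neg ((hV z).trans ?_)))
      refine mul_le_mul_of_nonneg_left ?_ hK0
      have e1 : ‖z - p‖ ≤ δ := by rw [← dist_eq_norm]; exact hz
      have e2 : ‖p‖ ≤ ‖x‖ + 1 := by
        rw [hp]
        refine (norm_add_le _ _).trans ?_
        rw [Pi.norm_single, Real.norm_eq_abs, hs1]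
      have e3 : ‖z‖ ≤ ‖z - p‖ + ‖p‖ := by simpa using norm_add_le (z - p) p
      have := norm_nonneg z
      exact pow_le_pow_left₀ (by positivity) (by linarith) 2
    have hlow : ENNReal.ofReal ((2 * δ) ^ n * Real.exp (-(K * (3 + ‖x‖) ^ 2)))
        ≤ ∫⁻ z in S, ENNReal.ofReal (Real.exp (-V z)) := by
      calc _ = ∫⁻ _ in S, ENNReal.ofReal (Real.exp (-(K * (3 + ‖x‖) ^ 2))) := by
            rw [setLIntegral_const, hS, Real.volume_pi_closedBall _ hδ0.le, mul_comm,
              ENNReal.ofReal_mul (Real.exp_pos _).le, Fintype.card_fin]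
        _ ≤ _ := setLIntegral_mono' Metric.isClosed_closedBall.measurableSet hnear
    rw [← h.lintegral_image Metric.isClosed_closedBall.measurableSet] at hlow
    have hup : ENNReal.ofReal (Real.exp (c / 4 * (‖y‖ / 3) ^ 2)) *
        ∫⁻ w in grad Φ '' S, ENNReal.ofReal (Real.exp (-W w)) ≤ ENNReal.ofReal M := by
      rw [← lintegral_const_mul _ hWm]
      have hm2 : MeasurableSet {w : Fin n → ℝ | ‖y‖ / 3 ≤ ‖w‖} :=
        measurableSet_le measurable_const measurable_norm
      calc _ ≤ ∫⁻ w in {w : Fin n → ℝ | ‖y‖ / 3 ≤ ‖w‖},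
            ENNReal.ofReal (Real.exp (c / 4 * (‖y‖ / 3) ^ 2)) * ENNReal.ofReal (Real.exp (-W w)) :=
            lintegral_mono_set (by rintro _ ⟨z, hz, rfl⟩; exact hfar z hz)
        _ ≤ ∫⁻ w in {w : Fin n → ℝ | ‖y‖ / 3 ≤ ‖w‖},
            ENNReal.ofReal (Real.exp (c / 4 * ‖w‖ ^ 2 - W w)) := by
            refine setLIntegral_mono' hm2 fun w hw => ?_
            rw [← ENNReal.ofReal_mul (Real.exp_pos _).le, ← Real.exp_add]
            refine ENNReal.ofReal_le_ofReal (Real.exp_le_exp.mpr ?_)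
            have hw' : ‖y‖ / 3 ≤ ‖w‖ := hw
            have : (‖y‖ / 3) ^ 2 ≤ ‖w‖ ^ 2 := pow_le_pow_left₀ (by positivity) hw' 2
            nlinarith
        _ ≤ _ := (setLIntegral_le_lintegral _ _).trans hM
    have hfin := (mul_le_mul_right hlow
      (ENNReal.ofReal (Real.exp (c / 4 * (‖y‖ / 3) ^ 2)))).trans hup
    rw [← ENNReal.ofReal_mul (Real.exp_pos _).le] at hfin
    have := (ENNReal.ofReal_le_ofReal_iff hM0).mp hfin
    linarith
  have hδn : (0 : ℝ) < (2 * δ) ^ n := by positivity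
  set L : ℝ := |Real.log (M / (2 * δ) ^ n)| with hL
  set A : ℝ := 36 / c * (L + 9 * K) + 1 with hA
  have hA1 : 1 ≤ A := by
    have : 0 ≤ 36 / c * (L + 9 * K) := by positivity
    linarith
  refine ⟨A, by linarith, fun x => ?_⟩
  have h1 : Real.exp (c / 4 * (‖grad Φ x‖ / 3) ^ 2 - K * (3 + ‖x‖) ^ 2) ≤ M / (2 * δ) ^ n := by
    rw [le_div_iff₀ hδn, sub_eq_add_neg, Real.exp_add]
    linarith [key x]
  have h2 := (Real.le_log_iff_exp_le ((Real.exp_pos _).trans_le h1)).mpr h1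
  have h3 := h2.trans (le_abs_self _)
  rw [← hL] at h3
  have hx := norm_nonneg x
  have h4 : c / 36 * ‖grad Φ x‖ ^ 2 ≤ (L + 9 * K) * (1 + ‖x‖) ^ 2 := by
    have hL0 : 0 ≤ L := abs_nonneg _
    have e1 : L ≤ L * (1 + ‖x‖) ^ 2 := le_mul_of_one_le_right hL0 (by nlinarith)
    have e2 : K * (3 + ‖x‖) ^ 2 ≤ K * (9 * (1 + ‖x‖) ^ 2) :=
      mul_le_mul_of_nonneg_left (by nlinarith) hK0
    linarith
  have h5 : ‖grad Φ x‖ ^ 2 ≤ 36 / c * (L + 9 * K) * (1 + ‖x‖) ^ 2 := by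
    have : ‖grad Φ x‖ ^ 2 = 36 / c * (c / 36 * ‖grad Φ x‖ ^ 2) := by field_simp
    rw [this, mul_assoc]
    exact mul_le_mul_of_nonneg_left h4 (by positivity)
  have h6 : ‖grad Φ x‖ ^ 2 ≤ (A * (1 + ‖x‖)) ^ 2 := by
    rw [mul_pow]
    refine h5.trans (mul_le_mul_of_nonneg_right ?_ (by positivity))
    nlinarith
  exact le_of_sq_le_sq h6 (by positivity)

/-- The potential grows faster than any linear function. -/
lemma IsTransport.exists_mul_norm_sub_le (h : IsTransport Φ V W c C) (N : ℝ) :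
    ∃ K : ℝ, ∀ z, N * ‖z‖ - K ≤ Φ z := by
  have hdense : ∀ w : Fin n → ℝ, ∃ x, dist w (grad Φ x) < 1 := fun w => h.denseRange.exists_dist_lt w one_pos
  choose X hX using hdense
  set q : Fin n × Bool → (Fin n → ℝ) := fun k =>
    X (Pi.single k.1 ((if k.2 then 1 else -1) * (N + n))) with hq
  set K : ℝ := |Φ 0| + ∑ k, |grad Φ (q k) ⬝ᵥ q k - Φ (q k)| with hK
  refine ⟨K, fun z => ?_⟩
  rcases isEmpty_or_nonempty (Fin n) with hn | hn
  · have : z = 0 := Subsingleton.elim _ _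
    have h2 := neg_abs_le (Φ 0)
    have h3 : 0 ≤ ∑ k, |grad Φ (q k) ⬝ᵥ q k - Φ (q k)| := Finset.sum_nonneg fun _ _ => abs_nonneg _
    rw [this, hK]
    simp only [norm_zero, mul_zero]
    linarith
  obtain ⟨i, hi⟩ := exists_abs_apply_eq_norm z
  obtain ⟨b, hb⟩ : ∃ b : Bool, (if b then (1 : ℝ) else -1) * z i = |z i| := by
    rcases le_total 0 (z i) with hp | hp
    · exact ⟨true, by simp [abs_of_nonneg hp]⟩
    · exact ⟨false, by simp [abs_of_nonpos hp]⟩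
  have h1 := grad_dotProduct_le_sub h.contDiff h.posDef (q (i, b)) (z - q (i, b))
  rw [add_sub_cancel, dotProduct_sub] at h1
  have h2 : |grad Φ (q (i, b)) ⬝ᵥ q (i, b) - Φ (q (i, b))| ≤ K := by
    have := Finset.single_le_sum (f := fun k => |grad Φ (q k) ⬝ᵥ q k - Φ (q k)|)
      (fun _ _ => abs_nonneg _) (Finset.mem_univ (i, b))
    have h3 := abs_nonneg (Φ 0)
    linarith
  have h3 : N * ‖z‖ ≤ grad Φ (q (i, b)) ⬝ᵥ z := by
    set e : Fin n → ℝ := Pi.single i ((if b then 1 else -1) * (N + n)) with he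
    have e1 : ‖grad Φ (q (i, b)) - e‖ ≤ 1 := by
      rw [← dist_eq_norm, dist_comm]
      exact (hX e).le
    have e2 := (abs_le.mp (abs_dotProduct_le (grad Φ (q (i, b)) - e) z)).1
    rw [sub_dotProduct, he, single_dotProduct, mul_right_comm, hb, hi] at e2
    have e3 : ‖grad Φ (q (i, b)) - e‖ * ‖z‖ ≤ 1 * ‖z‖ :=
      mul_le_mul_of_nonneg_right e1 (norm_nonneg _)
    have e4 := mul_le_mul_of_nonneg_left e3 (Nat.cast_nonneg (α := ℝ) n)
    rw [he] at e4
    linarith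
  linarith [le_abs_self (grad Φ (q (i, b)) ⬝ᵥ q (i, b) - Φ (q (i, b)))]

end Transport

section HessianBound

variable {n : ℕ} {Φ V W : (Fin n → ℝ) → ℝ} {c C : ℝ}

lemma dotProduct_self_nonneg (u : Fin n → ℝ) : 0 ≤ u ⬝ᵥ u :=
  Finset.sum_nonneg fun i _ => mul_self_nonneg (u i)

lemma two_mul_dotProduct_le (u v : Fin n → ℝ) : 2 * (u ⬝ᵥ v) ≤ u ⬝ᵥ u + v ⬝ᵥ v := by
  have := dotProduct_self_nonneg (u - v)
  rw [dotProduct_sub, sub_dotProduct, sub_dotProduct, dotProduct_comm v u] at this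
  linarith

/-- For a strongly convex function `⟨∇W(y), y⟩` is bounded from below. -/
lemma exists_neg_le_grad_dotProduct_self (hW : ContDiff ℝ 2 W) (hc : 0 < c)
    (hge : ∀ x, (hess W x - c • (1 : Matrix (Fin n) (Fin n) ℝ)).PosSemidef) :
    ∃ K : ℝ, 0 ≤ K ∧ ∀ y, -K ≤ grad W y ⬝ᵥ y := by
  refine ⟨(grad W 0 ⬝ᵥ grad W 0) / (4 * c), ?_, fun y => ?_⟩
  · have := dotProduct_self_nonneg (grad W 0)
    positivity
  have h1 := add_grad_add_le hW hge y (-y)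
  have h2 := add_grad_add_le hW hge 0 y
  rw [add_neg_cancel, dotProduct_neg, neg_dotProduct, dotProduct_neg, neg_neg] at h1
  rw [zero_add] at h2
  have h3 := dotProduct_self_nonneg (grad W 0 + (2 * c) • y)
  simp only [dotProduct_add, add_dotProduct, smul_dotProduct, dotProduct_smul, smul_eq_mul,
    dotProduct_comm y (grad W 0)] at h3
  have h4 : 0 ≤ (grad W 0 ⬝ᵥ grad W 0) / (4 * c) + grad W 0 ⬝ᵥ y + c * (y ⬝ᵥ y) := by
    have : (grad W 0 ⬝ᵥ grad W 0) / (4 * c) + grad W 0 ⬝ᵥ y + c * (y ⬝ᵥ y)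
      = (grad W 0 ⬝ᵥ grad W 0 + 2 * c * (grad W 0 ⬝ᵥ y)
        + 2 * c * (grad W 0 ⬝ᵥ y + 2 * c * (y ⬝ᵥ y))) / (4 * c) := by field_simp; ring
    rw [this]
    positivity
  linarith

lemma IsTransport.log_det (h : IsTransport Φ V W c C) (x : Fin n → ℝ) :
    Real.log (hess Φ x).det = W (grad Φ x) - V x := by
  have h1 := congrArg Real.log (h.monge_ampere x)
  rw [Real.log_exp, Real.log_mul (Real.exp_ne_zero _) (h.posDef x).det_pos.ne', Real.log_exp] at h1
  linarith

/-- The second difference of the potential at a maximum of its `ε`-penalisation. -/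
lemma IsTransport.second_difference_le_of_isMax (h : IsTransport Φ V W c C) (hc : 0 < c)
    {K ε : ℝ} (hK : ∀ y, -K ≤ grad W y ⬝ᵥ y) (hε : 0 < ε) (x z : Fin n → ℝ)
    (hmax : ∀ y, Φ (y + z) + Φ (y - z) - (2 + ε) * Φ y ≤ Φ (x + z) + Φ (x - z) - (2 + ε) * Φ x) :
    Φ (x + z) + Φ (x - z) - 2 * Φ x ≤ (C / c + 1) * (z ⬝ᵥ z) + ε * ((n + K) / c) := by
  have hdΦ : Differentiable ℝ Φ := h.contDiff.differentiable (by norm_num)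
  have htest : ∀ v, fderiv ℝ Φ (x + z) v + fderiv ℝ Φ (x - z) v - (2 + ε) * fderiv ℝ Φ x v = 0 ∧
      v ⬝ᵥ hess Φ (x + z) *ᵥ v + v ⬝ᵥ hess Φ (x - z) *ᵥ v
        - (2 + ε) * (v ⬝ᵥ hess Φ x *ᵥ v) ≤ 0 := fun v => by
    have hm : IsLocalMax (fun t : ℝ => Φ (x + z + t • v) + Φ (x - z + t • v)
        - (2 + ε) * Φ (x + t • v)) 0 := by
      refine Eventually.of_forall fun t => ?_
      have := hmax (x + t • v)
      simp only [zero_smul, add_zero]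
      rwa [add_right_comm x, add_sub_right_comm x] at this
    have := deriv2_nonpos_of_isLocalMax hm
      (Eventually.of_forall fun t => ((hasDerivAt_line hdΦ (x + z) v t).add
        (hasDerivAt_line hdΦ (x - z) v t)).sub ((hasDerivAt_line hdΦ x v t).const_mul _))
      (((hasDerivAt_fderiv_line h.contDiff (x + z) v 0).add
        (hasDerivAt_fderiv_line h.contDiff (x - z) v 0)).sub
        ((hasDerivAt_fderiv_line h.contDiff x v 0).const_mul _))
    simpa using this
  have hfirst : ∀ v, grad Φ (x + z) ⬝ᵥ v + grad Φ (x - z) ⬝ᵥ v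
      = (2 + ε) * (grad Φ x ⬝ᵥ v) := fun v => by
    have := (htest v).1
    simp only [fderiv_eq_grad_dotProduct] at this
    linarith
  have htr : ((hess Φ x)⁻¹ * hess Φ (x + z)).trace + ((hess Φ x)⁻¹ * hess Φ (x - z)).trace
      ≤ (2 + ε) * n := by
    have hM : ((2 + ε) • hess Φ x - hess Φ (x + z) - hess Φ (x - z)).PosSemidef := by
      refine PosSemidef.of_dotProduct_mulVec_nonneg ?_ fun v => ?_
      · rw [IsHermitian, conjTranspose_eq_transpose_of_trivial]
        simp [hess_transpose h.contDiff]
      · have := (htest v).2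
        simp only [star_trivial, sub_mulVec, smul_mulVec, dotProduct_sub, dotProduct_smul,
          smul_eq_mul]
        linarith
    have := trace_mul_nonneg (h.posDef x).inv.posSemidef hM
    rw [Matrix.mul_sub, Matrix.mul_sub, Matrix.mul_smul,
      nonsing_inv_mul _ ((isUnit_iff_isUnit_det _).mp (h.posDef x).isUnit), trace_sub, trace_sub,
      trace_smul, trace_one, Fintype.card_fin, smul_eq_mul] at this
    linarith
  have hd1 := log_det_sub_le (h.posDef x) (h.posDef (x + z))
  have hd2 := log_det_sub_le (h.posDef x) (h.posDef (x - z))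
  rw [h.log_det, h.log_det] at hd1 hd2
  set δ₁ := grad Φ (x + z) - grad Φ x with hδ₁
  set δ₂ := grad Φ (x - z) - grad Φ x with hδ₂
  have hW1 := add_grad_add_le h.contDiff_target h.target_ge (grad Φ x) δ₁
  have hW2 := add_grad_add_le h.contDiff_target h.target_ge (grad Φ x) δ₂
  have hV1 := le_add_grad_add h.contDiff_source h.source_le x z
  have hV2 := le_add_grad_add h.contDiff_source h.source_le x (-z)
  rw [← sub_eq_add_neg, dotProduct_neg, dotProduct_neg, neg_dotProduct, neg_neg] at hV2
  have hsum : grad W (grad Φ x) ⬝ᵥ δ₁ + grad W (grad Φ x) ⬝ᵥ δ₂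
      = ε * (grad W (grad Φ x) ⬝ᵥ grad Φ x) := by
    have := hfirst (grad W (grad Φ x))
    rw [hδ₁, hδ₂, dotProduct_sub, dotProduct_sub, dotProduct_comm _ (grad Φ (x + z)),
      dotProduct_comm _ (grad Φ (x - z)), dotProduct_comm _ (grad Φ x)]
    linarith
  rw [hδ₁, add_sub_cancel, ← hδ₁] at hW1
  rw [hδ₂, add_sub_cancel, ← hδ₂] at hW2
  have hKx := mul_le_mul_of_nonneg_left (hK (grad Φ x)) hε.le
  have hmain : c / 2 * (δ₁ ⬝ᵥ δ₁ + δ₂ ⬝ᵥ δ₂) ≤ C * (z ⬝ᵥ z) + ε * (n + K) := by linarith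
  have hΦ1 := grad_dotProduct_le_sub h.contDiff h.posDef (x + z) (-z)
  have hΦ2 := grad_dotProduct_le_sub h.contDiff h.posDef (x - z) z
  rw [add_neg_cancel_right, dotProduct_neg] at hΦ1
  rw [sub_add_cancel] at hΦ2
  have hy1 := two_mul_dotProduct_le δ₁ z
  have hy2 := two_mul_dotProduct_le δ₂ (-z)
  rw [dotProduct_neg, dotProduct_neg, neg_dotProduct, neg_neg] at hy2
  have hdiff : δ₁ ⬝ᵥ z - δ₂ ⬝ᵥ z = grad Φ (x + z) ⬝ᵥ z - grad Φ (x - z) ⬝ᵥ z := by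
    rw [hδ₁, hδ₂, sub_dotProduct, sub_dotProduct]
    ring
  have hdiv : (δ₁ ⬝ᵥ δ₁ + δ₂ ⬝ᵥ δ₂) / 2 ≤ C / c * (z ⬝ᵥ z) + ε * ((n + K) / c) := by
    have : C / c * (z ⬝ᵥ z) + ε * ((n + K) / c) = (C * (z ⬝ᵥ z) + ε * (n + K)) / c := by
      field_simp
    rw [this, le_div_iff₀ hc]
    linarith
  linarith

/-- Second differences of the potential are bounded. -/
lemma IsTransport.second_difference_le (h : IsTransport Φ V W c C) (hc : 0 < c) (hC : 0 < C)
    (x z : Fin n → ℝ) : Φ (x + z) + Φ (x - z) - 2 * Φ x ≤ (C / c + 1) * (z ⬝ᵥ z) := by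
  obtain ⟨A, hA0, hA⟩ := h.exists_norm_grad_le hc hC
  obtain ⟨K, hK0, hK⟩ := exists_neg_le_grad_dotProduct_self h.contDiff_target hc h.target_ge
  obtain ⟨m, hm⟩ := h.exists_mul_norm_sub_le 0
  have hcont : Continuous Φ := h.contDiff.continuous
  set L : ℝ := 2 * n * A * (1 + ‖z‖) * ‖z‖ with hL
  have hL0 : 0 ≤ L := by positivity
  have hgrow : ∀ y, Φ (y + z) + Φ (y - z) - 2 * Φ y ≤ L * (1 + ‖y‖) := fun y => by
    have h1 := grad_dotProduct_le_sub h.contDiff h.posDef (y + z) (-z)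
    have h2 := grad_dotProduct_le_sub h.contDiff h.posDef (y - z) z
    rw [add_neg_cancel_right, dotProduct_neg] at h1
    rw [sub_add_cancel] at h2
    have hb : ∀ w, ‖w‖ ≤ ‖y‖ + ‖z‖ →
        |grad Φ w ⬝ᵥ z| ≤ n * A * (1 + ‖z‖) * ‖z‖ * (1 + ‖y‖) := fun w hw => by
      refine (abs_dotProduct_le _ _).trans ?_
      have e1 : ‖grad Φ w‖ ≤ A * ((1 + ‖z‖) * (1 + ‖y‖)) := by
        refine (hA w).trans (mul_le_mul_of_nonneg_left ?_ hA0)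
        nlinarith [norm_nonneg y, norm_nonneg z, mul_nonneg (norm_nonneg y) (norm_nonneg z)]
      have e2 := mul_le_mul_of_nonneg_left
        (mul_le_mul_of_nonneg_right e1 (norm_nonneg z)) (Nat.cast_nonneg (α := ℝ) n)
      linarith
    have h3 := (abs_le.mp (hb (y + z) (norm_add_le _ _))).2
    have h4 := (abs_le.mp (hb (y - z) (norm_sub_le _ _))).1
    rw [hL]
    linarith
  have hpen : ∀ ε : ℝ, 0 < ε → Φ (x + z) + Φ (x - z) - 2 * Φ x
      ≤ (C / c + 1) * (z ⬝ᵥ z) + ε * ((n + K) / c + Φ x + m) := fun ε hε => by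
    obtain ⟨K', hK'⟩ := h.exists_mul_norm_sub_le ((L + 1) / ε)
    have hg : Continuous fun y => Φ (y + z) + Φ (y - z) - (2 + ε) * Φ y := by fun_prop
    have hlim : Tendsto (fun y => Φ (y + z) + Φ (y - z) - (2 + ε) * Φ y)
        (cocompact (Fin n → ℝ)) atBot := by
      have h1 : Tendsto (fun y : Fin n → ℝ => (L + ε * K') + -‖y‖)
          (cocompact (Fin n → ℝ)) atBot :=
        tendsto_atBot_add_const_left _ _ (tendsto_neg_atTop_atBot.comp
          (tendsto_norm_cocompact_atTop (E := Fin n → ℝ)))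
      refine tendsto_atBot_mono (fun y => ?_) h1
      have h2 := hgrow y
      have h3 := mul_le_mul_of_nonneg_left (hK' y) hε.le
      have h4 : ε * ((L + 1) / ε * ‖y‖ - K') = (L + 1) * ‖y‖ - ε * K' := by field_simp
      linarith
    obtain ⟨x₀, hx₀⟩ := hg.exists_forall_ge hlim
    have h1 := h.second_difference_le_of_isMax hc hK hε x₀ z hx₀
    have h2 := hx₀ x
    have h3 := mul_le_mul_of_nonneg_left (hm x₀) hε.le
    simp only [zero_mul, zero_sub] at h3
    linarith
  by_contra! hlt
  set d := Φ (x + z) + Φ (x - z) - 2 * Φ x - (C / c + 1) * (z ⬝ᵥ z) with hd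
  have hd0 : 0 < d := by linarith
  set E := (n + K) / c + Φ x + m with hE
  have h1 := hpen (d / (2 * (|E| + 1))) (by positivity)
  have h2 : d / (2 * (|E| + 1)) * E ≤ d / 2 := by
    rw [div_mul_eq_mul_div, div_le_div_iff₀ (by positivity) (by norm_num)]
    nlinarith [le_abs_self E, abs_nonneg E]
  linarith

/-- A global upper bound for the Hessian of the potential. -/
lemma IsTransport.hess_le (h : IsTransport Φ V W c C) (hc : 0 < c) (hC : 0 < C)
    (x : Fin n → ℝ) :
    ((C / c + 1) • (1 : Matrix (Fin n) (Fin n) ℝ) - hess Φ x).PosSemidef := by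
  have hdΦ : Differentiable ℝ Φ := h.contDiff.differentiable (by norm_num)
  refine PosSemidef.of_dotProduct_mulVec_nonneg ?_ fun v => ?_
  · rw [IsHermitian, conjTranspose_eq_transpose_of_trivial]
    simp [hess_transpose h.contDiff]
  set k := (C / c + 1) * (v ⬝ᵥ v) with hk
  have hm : IsLocalMax (fun t : ℝ => Φ (x + t • v) + Φ (x + t • (-v)) - k * t ^ 2) 0 := by
    refine Eventually.of_forall fun t => ?_
    have := h.second_difference_le hc hC x (t • v)
    simp only [smul_dotProduct, dotProduct_smul, smul_eq_mul] at this
    simp only [zero_smul, add_zero, smul_neg, ← sub_eq_add_neg, sub_zero]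
    rw [hk]
    linarith
  have := (deriv2_nonpos_of_isLocalMax hm
    (Eventually.of_forall fun t => ((hasDerivAt_line hdΦ x v t).add
      (hasDerivAt_line hdΦ x (-v) t)).sub (((hasDerivAt_id t).pow 2).const_mul k))
    (g' := fun t => fderiv ℝ Φ (x + t • v) v + fderiv ℝ Φ (x + t • (-v)) (-v)
      - k * (((2 : ℕ) : ℝ) * t ^ (2 - 1) * 1))
    (((hasDerivAt_fderiv_line h.contDiff x v 0).add
      (hasDerivAt_fderiv_line h.contDiff x (-v) 0)).sub
      (((((hasDerivAt_id (0 : ℝ)).pow 1).const_mul ((2 : ℕ) : ℝ)).mul_const 1).const_mul k))).2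
  simp only [zero_smul, add_zero, mulVec_neg, dotProduct_neg, neg_dotProduct, neg_neg,
    star_trivial, sub_mulVec, smul_mulVec, one_mulVec, dotProduct_sub, dotProduct_smul,
    smul_eq_mul] at this ⊢
  norm_num at this
  rw [hk] at this
  linarith

end HessianBound

section Legendre

variable {n : ℕ} {Φ V W : (Fin n → ℝ) → ℝ} {c C : ℝ}

lemma IsTransport.grad_surjective (h : IsTransport Φ V W c C) :
    Function.Surjective (grad Φ) := by
  intro w
  obtain ⟨K, hK⟩ := h.exists_mul_norm_sub_le (n * ‖w‖ + 1)
  have hcont : Continuous fun y => Φ y - w ⬝ᵥ y := by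
    have := h.contDiff.continuous
    simp only [dotProduct]
    fun_prop
  have hlim : Tendsto (fun y => Φ y - w ⬝ᵥ y) (cocompact (Fin n → ℝ)) atTop := by
    refine tendsto_atTop_mono (fun y => ?_) (tendsto_atTop_add_const_right _ (-K)
      (tendsto_norm_cocompact_atTop (E := Fin n → ℝ)))
    have h1 := hK y
    have h2 := (abs_le.mp (abs_dotProduct_le w y)).2
    linarith
  obtain ⟨x, hx⟩ := hcont.exists_forall_le hlim
  refine ⟨x, funext fun i => ?_⟩
  have hd : HasDerivAt (fun t : ℝ => Φ (x + t • Pi.single i 1) - (w ⬝ᵥ x + t * w i))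
      (fderiv ℝ Φ (x + (0 : ℝ) • Pi.single i 1) (Pi.single i 1) - (1 * w i)) 0 :=
    (hasDerivAt_line (h.contDiff.differentiable (by norm_num)) x _ 0).sub
      (((hasDerivAt_id (0 : ℝ)).mul_const (w i)).const_add _)
  have hm : IsLocalMin (fun t : ℝ => Φ (x + t • Pi.single i 1) - (w ⬝ᵥ x + t * w i)) 0 := by
    refine Eventually.of_forall fun t => ?_
    have := hx (x + t • Pi.single i 1)
    rw [dotProduct_add, dotProduct_smul, dotProduct_single, mul_one, smul_eq_mul] at this
    simpa using this
  have := hm.hasDerivAt_eq_zero hd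
  simp only [zero_smul, add_zero, one_mul] at this
  simp only [grad, pd]
  linarith

/-- The gradient map is a diffeomorphism of class `C¹`. -/
lemma IsTransport.exists_inverse (h : IsTransport Φ V W c C) :
    ∃ S : (Fin n → ℝ) → (Fin n → ℝ), ContDiff ℝ 1 S ∧ (∀ x, S (grad Φ x) = x) ∧
      ∀ y, grad Φ (S y) = y := by
  have hu : ∀ x, IsUnit (hess Φ x).det := fun x => (isUnit_iff_isUnit_det _).mp (h.posDef x).isUnit
  set L : (Fin n → ℝ) → ((Fin n → ℝ) ≃L[ℝ] (Fin n → ℝ)) := fun x =>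
    (toLin'OfInv (nonsing_inv_mul _ (hu x)) (mul_nonsing_inv _ (hu x))).toContinuousLinearEquiv
    with hL
  have hT : ContDiff ℝ 1 (grad Φ) := contDiff_grad h.contDiff (by norm_num)
  have hfd : ∀ x, HasFDerivAt (grad Φ) (L x : (Fin n → ℝ) →L[ℝ] (Fin n → ℝ)) x := fun x =>
    hasFDerivAt_grad h.contDiff x
  have hsd : ∀ x, HasStrictFDerivAt (grad Φ) (L x : (Fin n → ℝ) →L[ℝ] (Fin n → ℝ)) x := fun x =>
    hT.contDiffAt.hasStrictFDerivAt' (hfd x) (by norm_num)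
  set e := (Equiv.ofBijective (grad Φ)
    ⟨grad_injective h.contDiff h.posDef, h.grad_surjective⟩).toHomeomorphOfContinuousOpen
    hT.continuous (isOpenMap_of_hasStrictFDerivAt_equiv hsd) with he
  exact ⟨e.symm, e.contDiff_symm (f₀' := L) hfd hT, e.symm_apply_apply, e.apply_symm_apply⟩

/-- The Legendre transform of the potential transports the target to the source. -/
lemma IsTransport.exists_legendre (h : IsTransport Φ V W c C)
    (hV : ∀ x, (hess V x - c • (1 : Matrix (Fin n) (Fin n) ℝ)).PosSemidef)
    (hW : ∀ x, (C • (1 : Matrix (Fin n) (Fin n) ℝ) - hess W x).PosSemidef) :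
    ∃ Ψ : (Fin n → ℝ) → ℝ, IsTransport Ψ W V c C ∧
      ∀ x, hess Ψ (grad Φ x) = (hess Φ x)⁻¹ := by
  obtain ⟨S, hS, hSl, hSr⟩ := h.exists_inverse
  have hdS : Differentiable ℝ S := hS.differentiable (by norm_num)
  have hdΦ : Differentiable ℝ Φ := h.contDiff.differentiable (by norm_num)
  set Ψ : (Fin n → ℝ) → ℝ := fun y => y ⬝ᵥ S y - Φ (S y) with hΨ
  have hfd : ∀ y v, fderiv ℝ Ψ y v = v ⬝ᵥ S y := fun y v => by
    have h1 : HasFDerivAt (fun y : Fin n → ℝ => ∑ i, y i * S y i)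
        (∑ i, (y i • (ContinuousLinearMap.proj i).comp (fderiv ℝ S y)
          + S y i • (ContinuousLinearMap.proj i : (Fin n → ℝ) →L[ℝ] ℝ))) y := by
      refine HasFDerivAt.fun_sum fun i _ => ?_
      exact (hasFDerivAt_apply i y).mul (hasFDerivAt_pi'.mp (hdS y).hasFDerivAt i)
    have h2 := (hdΦ (S y)).hasFDerivAt.comp y (hdS y).hasFDerivAt
    have h3 : HasFDerivAt Ψ _ y := h1.sub h2
    rw [h3.fderiv]
    simp only [_root_.sub_apply, _root_.sum_apply,
      _root_.add_apply, _root_.smul_apply,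
      ContinuousLinearMap.comp_apply, ContinuousLinearMap.proj_apply, smul_eq_mul,
      Finset.sum_add_distrib, fderiv_eq_grad_dotProduct Φ, hSr]
    simp only [dotProduct, mul_comm]
    ring
  have hdΨ : Differentiable ℝ Ψ := by
    refine Differentiable.sub ?_ (hdΦ.comp hdS)
    simp only [dotProduct]
    fun_prop
  have hgrad : grad Ψ = S := by
    funext y i
    simp [grad, pd, hfd]
  have hΨ2 : ContDiff ℝ 2 Ψ := by
    rw [show (2 : WithTop ℕ∞) = 1 + 1 by norm_num, contDiff_succ_iff_fderiv]
    refine ⟨hdΨ, by simp, contDiff_clm_apply_iff.mpr fun v => ?_⟩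
    simp only [hfd, dotProduct]
    exact ContDiff.sum fun i _ => contDiff_const.mul (contDiff_pi.mp hS i)
  have hmul : ∀ y, hess Φ (S y) * hess Ψ y = 1 := fun y => by
    have h1 := hasFDerivAt_grad hΨ2 y
    rw [hgrad] at h1
    have h2 := (hasFDerivAt_grad h.contDiff (S y)).comp y h1
    have h3 : grad Φ ∘ S = id := funext hSr
    rw [h3] at h2
    have h4 := h2.unique (hasFDerivAt_id y)
    refine Matrix.toLin'.injective (LinearMap.ext fun v => ?_)
    have h5 := DFunLike.congr_fun h4 v
    simpa using h5
  have hinv : ∀ y, hess Ψ y = (hess Φ (S y))⁻¹ := fun y => (inv_eq_right_inv (hmul y)).symm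
  refine ⟨Ψ, ?_, fun x => by rw [hinv, hSl]⟩
  exact
    { contDiff := hΨ2
      posDef := fun y => by rw [hinv]; exact (h.posDef _).inv
      contDiff_source := h.contDiff_target
      contDiff_target := h.contDiff_source
      source_le := hW
      target_ge := hV
      lintegral_source := h.lintegral_target
      lintegral_target := h.lintegral_source
      monge_ampere := fun y => by
        have h1 := congrArg det (hmul y)
        rw [det_mul, det_one] at h1
        rw [hgrad, h.monge_ampere (S y), hSr, mul_assoc, h1, mul_one] }

/-- A global lower bound for the Hessian of the potential. -/
lemma IsTransport.le_hess (h : IsTransport Φ V W c C) (hc : 0 < c) (hC : 0 < C)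
    (hV : ∀ x, (hess V x - c • (1 : Matrix (Fin n) (Fin n) ℝ)).PosSemidef)
    (hW : ∀ x, (C • (1 : Matrix (Fin n) (Fin n) ℝ) - hess W x).PosSemidef) (x : Fin n → ℝ) :
    (hess Φ x - (C / c + 1)⁻¹ • (1 : Matrix (Fin n) (Fin n) ℝ)).PosSemidef := by
  obtain ⟨Ψ, hΨ, hinv⟩ := h.exists_legendre hV hW
  have h1 := hΨ.hess_le hc hC (grad Φ x)
  rw [hinv] at h1
  have h2 := le_inv_of_le (by positivity) (h.posDef x).inv h1
  rwa [nonsing_inv_nonsing_inv _ ((isUnit_iff_isUnit_det _).mp (h.posDef x).isUnit)] at h2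

end Legendre

section DirectionalDerivative

variable {n : ℕ}

/-- The directional derivative `∂_v f`. -/
def dd (f : (Fin n → ℝ) → ℝ) (v : Fin n → ℝ) : (Fin n → ℝ) → ℝ :=
  fun x => fderiv ℝ f x v

lemma contDiff_dd {f : (Fin n → ℝ) → ℝ} {k m : WithTop ℕ∞} (hf : ContDiff ℝ k f)
    (hm : m + 1 ≤ k) (v : Fin n → ℝ) : ContDiff ℝ m (dd f v) :=
  (hf.fderiv_right hm).clm_apply contDiff_const

lemma dd_single (f : (Fin n → ℝ) → ℝ) (i : Fin n) : dd f (Pi.single i 1) = pd f i := rfl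

lemma dd_eq_sum (f : (Fin n → ℝ) → ℝ) (v : Fin n → ℝ) :
    dd f v = fun x => ∑ i, v i * pd f i x :=
  funext fun x => fderiv_eq_sum f x v

lemma dd_comm {f : (Fin n → ℝ) → ℝ} (hf : ContDiff ℝ 2 f) (u v : Fin n → ℝ) :
    dd (dd f u) v = dd (dd f v) u := by
  funext x
  have hd : DifferentiableAt ℝ (fderiv ℝ f) x :=
    ((hf.fderiv_right (m := 1) (by norm_num)).differentiable (by norm_num)) x
  have key : ∀ a b : Fin n → ℝ, dd (dd f a) b x = fderiv ℝ (fderiv ℝ f) x b a := fun a b => by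
    change fderiv ℝ (fun y => fderiv ℝ f y a) x b = _
    rw [fderiv_clm_apply hd (differentiableAt_const _)]
    simp
  rw [key, key]
  exact hf.contDiffAt.isSymmSndFDerivAt (by simp) _ _

lemma dd_dd_eq {f : (Fin n → ℝ) → ℝ} (hf : ContDiff ℝ 2 f) (u v x : Fin n → ℝ) :
    dd (dd f u) v x = u ⬝ᵥ hess f x *ᵥ v := by
  have h1 : ∀ i, dd (pd f i) v x = ∑ j, v j * hess f x i j := fun i => by
    rw [dd_eq_sum]; rfl
  rw [dd_comm hf]
  change fderiv ℝ (dd f v) x u = _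
  rw [fderiv_eq_sum]
  simp only [dotProduct, mulVec]
  refine Finset.sum_congr rfl fun i _ => ?_
  congr 1
  have h2 : pd (dd f v) i x = dd (pd f i) v x := by
    rw [← dd_single, ← dd_single, dd_comm hf]
  rw [h2, h1]
  exact Finset.sum_congr rfl fun j _ => mul_comm _ _

lemma dirHess_eq_hess_dd {f : (Fin n → ℝ) → ℝ} (hf : ContDiff ℝ 3 f) (e x : Fin n → ℝ) :
    dirHess f e x = hess (dd f e) x := by
  have h1 : ∀ i, pd (dd f e) i = dd (pd f i) e := fun i => by
    rw [← dd_single, ← dd_single, dd_comm (hf.of_le (by norm_num))]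
  ext i j
  have h2 : ContDiff ℝ 2 (pd f i) := contDiff_pd hf (by norm_num) i
  simp only [dirHess, hess, of_apply, pd2]
  rw [h1, ← dd_single, dd_comm h2, dd_eq_sum]
  refine Finset.sum_congr rfl fun k _ => ?_
  simp only [pd3, pd2, dd_single]
  rw [pd_comm (hf.of_le (by norm_num)) k i, pd_comm h2 k j]

end DirectionalDerivative

section MatrixCalculus

variable {n : ℕ}

lemma hasDerivAt_matrix {M : ℝ → Matrix (Fin n) (Fin n) ℝ} {M' : Matrix (Fin n) (Fin n) ℝ} {t : ℝ}
    (h : ∀ i j, HasDerivAt (fun s => M s i j) (M' i j) t) : HasDerivAt M M' t :=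
  hasDerivAt_pi.mpr fun i => hasDerivAt_pi.mpr fun j => h i j

lemma hasDerivAt_hess_line {f : (Fin n → ℝ) → ℝ} (hf : ContDiff ℝ 3 f) (x v : Fin n → ℝ) (t : ℝ) :
    HasDerivAt (fun s : ℝ => hess f (x + s • v)) (hess (dd f v) (x + t • v)) t := by
  refine hasDerivAt_matrix fun i j => ?_
  have h1 := hasDerivAt_line (f := pd2 f i j) ((contDiff_pd (contDiff_pd hf (m := 2) (by norm_num) i)
    (m := 1) (by norm_num) j).differentiable (by norm_num)) x v t
  have h2 : hess (dd f v) (x + t • v) i j = fderiv ℝ (pd2 f i j) (x + t • v) v := by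
    change dd (dd (dd f v) _) _ _ = dd (dd (dd f _) _) v _
    rw [dd_comm (hf.of_le (by norm_num)) v, dd_comm (contDiff_dd hf (by norm_num) _) v]
  rw [h2]
  exact h1

lemma hasDerivAt_trace {M : ℝ → Matrix (Fin n) (Fin n) ℝ} {M' : Matrix (Fin n) (Fin n) ℝ} {t : ℝ}
    (h : HasDerivAt M M' t) : HasDerivAt (fun s => (M s).trace) M'.trace t := by
  have := hasDerivAt_pi.mp h
  exact HasDerivAt.fun_sum fun i _ => hasDerivAt_pi.mp (this i) i

lemma hasDerivAt_apply_matrix {M : ℝ → Matrix (Fin n) (Fin n) ℝ} {M' : Matrix (Fin n) (Fin n) ℝ}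
    {t : ℝ} (h : HasDerivAt M M' t) (i j : Fin n) : HasDerivAt (fun s => M s i j) (M' i j) t :=
  hasDerivAt_pi.mp (hasDerivAt_pi.mp h i) j

lemma hasDerivAt_mul_matrix {M N : ℝ → Matrix (Fin n) (Fin n) ℝ} {M' N' : Matrix (Fin n) (Fin n) ℝ}
    {t : ℝ} (hM : HasDerivAt M M' t) (hN : HasDerivAt N N' t) :
    HasDerivAt (fun s => M s * N s) (M' * N t + M t * N') t := by
  refine hasDerivAt_matrix fun i j => ?_
  simp only [Matrix.add_apply, Matrix.mul_apply, ← Finset.sum_add_distrib]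
  exact HasDerivAt.fun_sum fun k _ =>
    (hasDerivAt_apply_matrix hM i k).mul (hasDerivAt_apply_matrix hN k j)

open scoped Matrix.Norms.Operator in
lemma hasDerivAt_inv_matrix {M : ℝ → Matrix (Fin n) (Fin n) ℝ} {M' : Matrix (Fin n) (Fin n) ℝ}
    {t : ℝ} (h : HasDerivAt M M' t) (hu : IsUnit (M t)) :
    HasDerivAt (fun s => (M s)⁻¹) (-((M t)⁻¹ * M' * (M t)⁻¹)) t := by
  obtain ⟨u, hu⟩ := hu
  have h1 := hasFDerivAt_ringInverse (𝕜 := ℝ) u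
  rw [hu] at h1
  have h2 := h1.comp_hasDerivAt t h
  have h3 : (Ring.inverse ∘ M) = fun s => (M s)⁻¹ := funext fun s =>
    (nonsing_inv_eq_ringInverse (M s)).symm
  rw [h3] at h2
  have h4 : ((u⁻¹ : (Matrix (Fin n) (Fin n) ℝ)ˣ) : Matrix (Fin n) (Fin n) ℝ) = (M t)⁻¹ := by
    rw [← hu, coe_units_inv]
  have h5 : (-((ContinuousLinearMap.mulLeftRight ℝ (Matrix (Fin n) (Fin n) ℝ))
      ((u⁻¹ : (Matrix (Fin n) (Fin n) ℝ)ˣ) : Matrix (Fin n) (Fin n) ℝ))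
      ((u⁻¹ : (Matrix (Fin n) (Fin n) ℝ)ˣ) : Matrix (Fin n) (Fin n) ℝ)) M'
      = -((M t)⁻¹ * M' * (M t)⁻¹) := by
    simp [h4]
  rw [h5] at h2
  exact h2

end MatrixCalculus

section LogDet

variable {n : ℕ} {Φ m : (Fin n → ℝ) → ℝ}

lemma hasDerivAt_hess_inv_line (hΦ : ContDiff ℝ 3 Φ) (hpos : ∀ x, (hess Φ x).PosDef)
    (x v : Fin n → ℝ) :
    HasDerivAt (fun s : ℝ => (hess Φ (x + s • v))⁻¹)
      (-((hess Φ x)⁻¹ * hess (dd Φ v) x * (hess Φ x)⁻¹)) 0 := by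
  have := hasDerivAt_inv_matrix (hasDerivAt_hess_line hΦ x v 0) (hpos _).isUnit
  simpa using this

lemma hasDerivAt_hess_line_zero {f : (Fin n → ℝ) → ℝ} (hf : ContDiff ℝ 3 f) (x v : Fin n → ℝ) :
    HasDerivAt (fun s : ℝ => hess f (x + s • v)) (hess (dd f v) x) 0 := by
  simpa using hasDerivAt_hess_line hf x v 0

lemma hasDerivAt_line_zero {f : (Fin n → ℝ) → ℝ} (hf : Differentiable ℝ f) (x v : Fin n → ℝ) :
    HasDerivAt (fun s : ℝ => f (x + s • v)) (dd f v x) 0 := by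
  have := hasDerivAt_line hf x v 0
  rw [zero_smul, add_zero] at this
  exact this

/-- First derivative of `log det D²Φ`. -/
lemma dd_log_det (hΦ : ContDiff ℝ 3 Φ) (hpos : ∀ x, (hess Φ x).PosDef) (hm : Differentiable ℝ m)
    (hdet : ∀ x, Real.log (hess Φ x).det = m x) (v x : Fin n → ℝ) :
    dd m v x = ((hess Φ x)⁻¹ * hess (dd Φ v) x).trace := by
  have h1 : HasDerivAt (fun s : ℝ => ((hess Φ x)⁻¹ * hess Φ (x + s • v)).trace)
      (0 * hess Φ (x + (0 : ℝ) • v) + (hess Φ x)⁻¹ * hess (dd Φ v) x).trace 0 :=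
    hasDerivAt_trace (hasDerivAt_mul_matrix
      (hasDerivAt_matrix fun i j => hasDerivAt_const (0 : ℝ) ((hess Φ x)⁻¹ i j))
      (hasDerivAt_hess_line_zero hΦ x v))
  rw [Matrix.zero_mul, zero_add] at h1
  have hmin : IsLocalMin (fun s : ℝ => ((hess Φ x)⁻¹ * hess Φ (x + s • v)).trace
      - m (x + s • v)) 0 := by
    refine Eventually.of_forall fun s => ?_
    have h2 := log_det_sub_le (hpos x) (hpos (x + s • v))
    rw [hdet, hdet] at h2
    simp only [zero_smul, add_zero]
    rw [nonsing_inv_mul _ ((isUnit_iff_isUnit_det _).mp (hpos x).isUnit), trace_one,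
      Fintype.card_fin]
    linarith
  have := hmin.hasDerivAt_eq_zero (h1.sub (hasDerivAt_line_zero hm x v))
  linarith

/-- Second derivatives of `log det D²Φ`. -/
lemma dd_dd_log_det (hΦ : ContDiff ℝ 4 Φ) (hpos : ∀ x, (hess Φ x).PosDef) (hm : ContDiff ℝ 2 m)
    (hdet : ∀ x, Real.log (hess Φ x).det = m x) (v u x : Fin n → ℝ) :
    dd (dd m v) u x = ((hess Φ x)⁻¹ * hess (dd (dd Φ v) u) x).trace
      - ((hess Φ x)⁻¹ * hess (dd Φ u) x * (hess Φ x)⁻¹ * hess (dd Φ v) x).trace := by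
  have h3 : ContDiff ℝ 3 Φ := hΦ.of_le (by norm_num)
  have h1 := hasDerivAt_trace (hasDerivAt_mul_matrix (hasDerivAt_hess_inv_line h3 hpos x u)
    (hasDerivAt_hess_line_zero (contDiff_dd hΦ (m := 3) (by norm_num) v) x u))
  have h2 := hasDerivAt_line_zero
    ((contDiff_dd hm (m := 1) (by norm_num) v).differentiable (by norm_num)) x u
  simp only [dd_log_det h3 hpos (hm.differentiable (by norm_num)) hdet] at h2
  rw [h2.unique h1]
  simp only [zero_smul, add_zero, trace_add, Matrix.neg_mul, trace_neg]
  ring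

/-- Third derivatives of `log det D²Φ` at a point where `D²Φ` is the identity. -/
lemma dd_dd_dd_log_det (hΦ : ContDiff ℝ 5 Φ) (hpos : ∀ x, (hess Φ x).PosDef)
    (hm : ContDiff ℝ 3 m) (hdet : ∀ x, Real.log (hess Φ x).det = m x) (v e : Fin n → ℝ)
    {x : Fin n → ℝ} (hx : hess Φ x = 1) :
    dd (dd (dd m v) v) e x = (hess (dd (dd (dd Φ v) v) e) x).trace
      - (hess (dd Φ e) x * hess (dd (dd Φ v) v) x).trace
      - 2 * (hess (dd (dd Φ v) e) x * hess (dd Φ v) x).trace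
      + 2 * (hess (dd Φ e) x * hess (dd Φ v) x * hess (dd Φ v) x).trace := by
  have h3 : ContDiff ℝ 3 Φ := hΦ.of_le (by norm_num)
  have h4 : ContDiff ℝ 4 Φ := hΦ.of_le (by norm_num)
  have hK := hasDerivAt_hess_inv_line h3 hpos x e
  have hA := hasDerivAt_hess_line_zero (contDiff_dd h4 (m := 3) (by norm_num) v) x e
  have hB := hasDerivAt_hess_line_zero
    (contDiff_dd (contDiff_dd hΦ (m := 4) (by norm_num) v) (m := 3) (by norm_num) v) x e
  have h1 := (hasDerivAt_trace (hasDerivAt_mul_matrix hK hB)).sub (hasDerivAt_trace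
    (hasDerivAt_mul_matrix (hasDerivAt_mul_matrix (hasDerivAt_mul_matrix hK hA) hK) hA))
  have h2 := hasDerivAt_line_zero ((contDiff_dd (contDiff_dd hm (m := 2) (by norm_num) v)
    (m := 1) (by norm_num) v).differentiable (by norm_num)) x e
  simp only [dd_dd_log_det h4 hpos (hm.of_le (by norm_num)) hdet] at h2
  rw [h2.unique h1]
  simp only [zero_smul, add_zero, trace_add, Matrix.neg_mul, Matrix.mul_neg, trace_neg, hx, inv_one,
    Matrix.one_mul, Matrix.mul_one, Matrix.add_mul]
  rw [trace_mul_comm (hess (dd Φ v) x) (hess (dd (dd Φ v) e) x),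
    trace_mul_cycle (hess (dd Φ v) x) (hess (dd Φ e) x) (hess (dd Φ v) x),
    trace_mul_cycle (hess (dd Φ v) x) (hess (dd Φ v) x) (hess (dd Φ e) x)]
  ring

end LogDet

section Composition

variable {n : ℕ} {Φ V W m : (Fin n → ℝ) → ℝ} {κ : ℝ}

lemma hasDerivAt_comp_grad {G : (Fin n → ℝ) → ℝ} (hG : Differentiable ℝ G) (hΦ : ContDiff ℝ 2 Φ)
    (x v : Fin n → ℝ) :
    HasDerivAt (fun s : ℝ => G (grad Φ (x + s • v)))
      (∑ i, pd G i (grad Φ x) * dd (pd Φ i) v x) 0 := by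
  have h1 : HasDerivAt (fun s : ℝ => grad Φ (x + s • v)) (fun i => dd (pd Φ i) v x) 0 :=
    hasDerivAt_pi.mpr fun i => hasDerivAt_line_zero
      ((contDiff_pd hΦ (m := 1) (by norm_num) i).differentiable (by norm_num)) x v
  have h2 := (hG (grad Φ (x + (0 : ℝ) • v))).hasFDerivAt.comp_hasDerivAt (0 : ℝ) h1
  rw [fderiv_eq_grad_dotProduct, zero_smul, add_zero] at h2
  exact h2

lemma dd_comp_grad (hΦ : ContDiff ℝ 2 Φ) (hV : Differentiable ℝ V) (hW : Differentiable ℝ W)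
    (hm : Differentiable ℝ m) (heq : ∀ x, m x = W (grad Φ x) - V x + κ) (v x : Fin n → ℝ) :
    dd m v x = ∑ i, pd W i (grad Φ x) * dd (pd Φ i) v x - dd V v x := by
  have h1 := hasDerivAt_line_zero hm x v
  simp only [heq] at h1
  exact h1.unique (((hasDerivAt_comp_grad hW hΦ x v).sub
    (hasDerivAt_line_zero hV x v)).add_const κ)

lemma dd_dd_comp_grad (hΦ : ContDiff ℝ 3 Φ) (hV : ContDiff ℝ 2 V) (hW : ContDiff ℝ 2 W)
    (hm : ContDiff ℝ 2 m) (heq : ∀ x, m x = W (grad Φ x) - V x + κ) (v x : Fin n → ℝ) :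
    dd (dd m v) v x = ∑ i, ((∑ j, pd2 W i j (grad Φ x) * dd (pd Φ j) v x) * dd (pd Φ i) v x
      + pd W i (grad Φ x) * dd (dd (pd Φ i) v) v x) - dd (dd V v) v x := by
  have h1 := hasDerivAt_line_zero ((contDiff_dd hm (m := 1) (by norm_num) v).differentiable
    (by norm_num)) x v
  simp only [dd_comp_grad (hΦ.of_le (by norm_num)) (hV.differentiable (by norm_num))
    (hW.differentiable (by norm_num)) (hm.differentiable (by norm_num)) heq] at h1
  have h2 := (HasDerivAt.fun_sum fun (i : Fin n) (_ : i ∈ Finset.univ) =>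
    (hasDerivAt_comp_grad ((contDiff_pd hW (m := 1) (by norm_num) i).differentiable
      (by norm_num)) (hΦ.of_le (by norm_num)) x v).mul
    (hasDerivAt_line_zero ((contDiff_dd (contDiff_pd hΦ (m := 2) (by norm_num) i) (m := 1)
      (by norm_num) v).differentiable (by norm_num)) x v)).sub
    (hasDerivAt_line_zero ((contDiff_dd hV (m := 1) (by norm_num) v).differentiable
      (by norm_num)) x v)
  rw [h1.unique h2]
  simp [pd2]

lemma dd_dd_dd_comp_grad (hΦ : ContDiff ℝ 4 Φ) (hV : ContDiff ℝ 3 V) (hW : ContDiff ℝ 3 W)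
    (hm : ContDiff ℝ 3 m) (heq : ∀ x, m x = W (grad Φ x) - V x + κ) (v e x : Fin n → ℝ) :
    dd (dd (dd m v) v) e x = ∑ i, ((∑ j, ((∑ k, pd3 W i j k (grad Φ x) * dd (pd Φ k) e x)
        * dd (pd Φ j) v x + pd2 W i j (grad Φ x) * dd (dd (pd Φ j) v) e x)) * dd (pd Φ i) v x
      + (∑ j, pd2 W i j (grad Φ x) * dd (pd Φ j) v x) * dd (dd (pd Φ i) v) e x
      + ((∑ j, pd2 W i j (grad Φ x) * dd (pd Φ j) e x) * dd (dd (pd Φ i) v) v x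
      + pd W i (grad Φ x) * dd (dd (dd (pd Φ i) v) v) e x)) - dd (dd (dd V v) v) e x := by
  have h1 := hasDerivAt_line_zero ((contDiff_dd (contDiff_dd hm (m := 2) (by norm_num) v)
    (m := 1) (by norm_num) v).differentiable (by norm_num)) x e
  simp only [dd_dd_comp_grad (hΦ.of_le (by norm_num)) (hV.of_le (by norm_num))
    (hW.of_le (by norm_num)) (hm.of_le (by norm_num)) heq] at h1
  have hΦ2 : ContDiff ℝ 2 Φ := hΦ.of_le (by norm_num)
  have hp : ∀ i, HasDerivAt (fun s : ℝ => dd (pd Φ i) v (x + s • e)) (dd (dd (pd Φ i) v) e x) 0 :=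
    fun i => hasDerivAt_line_zero ((contDiff_dd (contDiff_pd hΦ (m := 3) (by norm_num) i) (m := 2)
      (by norm_num) v).differentiable (by norm_num)) x e
  have hpp : ∀ i, HasDerivAt (fun s : ℝ => dd (dd (pd Φ i) v) v (x + s • e))
      (dd (dd (dd (pd Φ i) v) v) e x) 0 :=
    fun i => hasDerivAt_line_zero ((contDiff_dd (contDiff_dd (contDiff_pd hΦ (m := 3)
      (by norm_num) i) (m := 2) (by norm_num) v) (m := 1) (by norm_num) v).differentiable
      (by norm_num)) x e
  have hw : ∀ i, HasDerivAt (fun s : ℝ => pd W i (grad Φ (x + s • e)))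
      (∑ j, pd2 W i j (grad Φ x) * dd (pd Φ j) e x) 0 := fun i =>
    hasDerivAt_comp_grad ((contDiff_pd hW (m := 2) (by norm_num) i).differentiable
      (by norm_num)) hΦ2 x e
  have hww : ∀ i j, HasDerivAt (fun s : ℝ => pd2 W i j (grad Φ (x + s • e)))
      (∑ k, pd3 W i j k (grad Φ x) * dd (pd Φ k) e x) 0 := fun i j =>
    hasDerivAt_comp_grad ((contDiff_pd (contDiff_pd hW (m := 2) (by norm_num) i) (m := 1)
      (by norm_num) j).differentiable (by norm_num)) hΦ2 x e
  have h2 := (HasDerivAt.fun_sum fun (i : Fin n) (_ : i ∈ Finset.univ) =>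
    ((HasDerivAt.fun_sum fun (j : Fin n) (_ : j ∈ Finset.univ) => (hww i j).mul (hp j)).mul
      (hp i)).add ((hw i).mul (hpp i))).sub
    (hasDerivAt_line_zero ((contDiff_dd (contDiff_dd hV (m := 2) (by norm_num) v) (m := 1)
      (by norm_num) v).differentiable (by norm_num)) x e)
  rw [h1.unique h2]
  simp

end Composition

section TraceForm

variable {n : ℕ} {h h₁ A A₁ : ℝ → Matrix (Fin n) (Fin n) ℝ} {h₂ A₂ : Matrix (Fin n) (Fin n) ℝ}

/-- First derivative of `Tr[h⁻¹ A h⁻¹ A]` along a path. -/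
lemma hasDerivAt_trace_inv_mul_sq {t : ℝ} (hh : HasDerivAt h (h₁ t) t) (hA : HasDerivAt A (A₁ t) t)
    (hu : IsUnit (h t)) :
    HasDerivAt (fun s => ((h s)⁻¹ * A s * (h s)⁻¹ * A s).trace)
      (2 * ((h t)⁻¹ * A₁ t * (h t)⁻¹ * A t).trace
        - 2 * ((h t)⁻¹ * h₁ t * (h t)⁻¹ * A t * (h t)⁻¹ * A t).trace) t := by
  have hK := hasDerivAt_inv_matrix hh hu
  have h1 := hasDerivAt_trace (hasDerivAt_mul_matrix (hasDerivAt_mul_matrix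
    (hasDerivAt_mul_matrix hK hA) hK) hA)
  convert h1 using 1
  simp only [Matrix.add_mul, trace_add, Matrix.neg_mul, Matrix.mul_neg, trace_neg]
  have e1 : ((h t)⁻¹ * A t * (h t)⁻¹ * A₁ t).trace = ((h t)⁻¹ * A₁ t * (h t)⁻¹ * A t).trace := by
    rw [Matrix.mul_assoc ((h t)⁻¹ * A t), trace_mul_comm]
    simp only [Matrix.mul_assoc]
  have e2 : ((h t)⁻¹ * A t * ((h t)⁻¹ * h₁ t * (h t)⁻¹) * A t).trace
      = ((h t)⁻¹ * h₁ t * (h t)⁻¹ * A t * (h t)⁻¹ * A t).trace := by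
    rw [show (h t)⁻¹ * A t * ((h t)⁻¹ * h₁ t * (h t)⁻¹) * A t
      = ((h t)⁻¹ * A t) * ((h t)⁻¹ * h₁ t * (h t)⁻¹ * A t) by simp only [Matrix.mul_assoc],
      trace_mul_comm]
    simp only [Matrix.mul_assoc]
  rw [e1, e2]
  ring

/-- Second derivative of `Tr[h⁻¹ A h⁻¹ A]` along a path through the identity. -/
lemma hasDerivAt_deriv_trace_inv_mul_sq (hh : HasDerivAt h (h₁ 0) 0)
    (hh₁ : HasDerivAt h₁ h₂ 0) (hA : HasDerivAt A (A₁ 0) 0) (hA₁ : HasDerivAt A₁ A₂ 0)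
    (h0 : h 0 = 1) :
    HasDerivAt (fun t => 2 * ((h t)⁻¹ * A₁ t * (h t)⁻¹ * A t).trace
        - 2 * ((h t)⁻¹ * h₁ t * (h t)⁻¹ * A t * (h t)⁻¹ * A t).trace)
      (2 * (A₂ * A 0).trace + 2 * (A₁ 0 * A₁ 0).trace + 4 * (h₁ 0 * h₁ 0 * A 0 * A 0).trace
        - 2 * (h₂ * A 0 * A 0).trace + 2 * (h₁ 0 * A 0 * h₁ 0 * A 0).trace
        - 4 * (h₁ 0 * A₁ 0 * A 0).trace - 4 * (h₁ 0 * A 0 * A₁ 0).trace) 0 := by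
  have hK := hasDerivAt_inv_matrix hh (by rw [h0]; exact isUnit_one)
  have h1 := ((hasDerivAt_trace (hasDerivAt_mul_matrix (hasDerivAt_mul_matrix
    (hasDerivAt_mul_matrix hK hA₁) hK) hA)).const_mul 2).sub
    ((hasDerivAt_trace (hasDerivAt_mul_matrix (hasDerivAt_mul_matrix (hasDerivAt_mul_matrix
    (hasDerivAt_mul_matrix (hasDerivAt_mul_matrix hK hh₁) hK) hA) hK) hA)).const_mul 2)
  refine h1.congr_deriv ?_
  simp only [h0, inv_one, Matrix.add_mul, trace_add, Matrix.neg_mul, Matrix.mul_neg, trace_neg,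
    Matrix.one_mul, Matrix.mul_one]
  rw [trace_mul_cycle (A₁ 0) (h₁ 0) (A 0), trace_mul_cycle (A 0) (A₁ 0) (h₁ 0)]
  ring

end TraceForm

section Algebra

variable {n : ℕ}

lemma sum_swap_left {G : Fin n → Fin n → Fin n → ℝ} (hG : ∀ p a b, G p a b = G a p b)
    (φ : Fin n → Fin n → Fin n → ℝ) :
    ∑ p, ∑ a, ∑ b, φ p a b * G p a b = ∑ p, ∑ a, ∑ b, φ a p b * G p a b := by
  rw [Finset.sum_comm]
  exact Finset.sum_congr rfl fun p _ => Finset.sum_congr rfl fun a _ =>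
    Finset.sum_congr rfl fun b _ => by rw [hG]

lemma sum_swap_right {G : Fin n → Fin n → Fin n → ℝ} (hG : ∀ p a b, G p a b = G p b a)
    (φ : Fin n → Fin n → Fin n → ℝ) :
    ∑ p, ∑ a, ∑ b, φ p a b * G p a b = ∑ p, ∑ a, ∑ b, φ p b a * G p a b := by
  refine Finset.sum_congr rfl fun p _ => ?_
  rw [Finset.sum_comm]
  exact Finset.sum_congr rfl fun a _ => Finset.sum_congr rfl fun b _ => by rw [hG]

/-- Positivity of the quadratic form in the third and fourth derivatives. -/
lemma third_order_form_nonneg {T f : Fin n → Fin n → Fin n → ℝ} (τ : Fin n → ℝ)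
    (hT : ∀ p a b, T p a b = T a p b) (hT' : ∀ p a b, T p a b = T p b a)
    (hf : ∀ p a b, f p a b = f a p b) (hf' : ∀ p a b, f p a b = f p b a) :
    0 ≤ 2 * ∑ p, ∑ a, ∑ b, f p a b ^ 2 - 6 * ∑ p, ∑ a, ∑ b, τ p * (T p a b * f p a b)
      + 5 / 2 * ∑ p, ∑ a, ∑ b, τ p ^ 2 * T p a b ^ 2
      + 2 * ∑ p, ∑ a, ∑ b, (τ p * τ a) * T p a b ^ 2 := by
  have h0 : 0 ≤ ∑ p, ∑ a, ∑ b, (2 * (f p a b - 1 / 2 * (τ p + τ a + τ b) * T p a b) ^ 2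
      + 1 / 2 * ((τ a - τ p) * T p a b) ^ 2) := by positivity
  have hG : ∀ p a b, T p a b ^ 2 = T a p b ^ 2 := fun p a b => by rw [hT]
  have hG' : ∀ p a b, T p a b ^ 2 = T p b a ^ 2 := fun p a b => by rw [hT']
  have hH : ∀ p a b, T p a b * f p a b = T a p b * f a p b := fun p a b => by rw [hT, hf]
  have hH' : ∀ p a b, T p a b * f p a b = T p b a * f p b a := fun p a b => by rw [hT', hf']
  have e1 := sum_swap_left hG fun p _ _ => τ p ^ 2
  have e2 := sum_swap_right hG' fun _ a _ => τ a ^ 2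
  have e3 := sum_swap_right hG' fun p a _ => τ p * τ a
  have e4 := sum_swap_left hG fun p _ b => τ p * τ b
  have e5 := sum_swap_left hH fun p _ _ => τ p
  have e6 := sum_swap_right hH' fun _ a _ => τ a
  have h1 : ∑ p, ∑ a, ∑ b, (2 * (f p a b - 1 / 2 * (τ p + τ a + τ b) * T p a b) ^ 2
      + 1 / 2 * ((τ a - τ p) * T p a b) ^ 2)
      = 2 * ∑ p, ∑ a, ∑ b, f p a b ^ 2 - 2 * ∑ p, ∑ a, ∑ b, τ p * (T p a b * f p a b)
      - 2 * ∑ p, ∑ a, ∑ b, τ a * (T p a b * f p a b)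
      - 2 * ∑ p, ∑ a, ∑ b, τ b * (T p a b * f p a b)
      + ∑ p, ∑ a, ∑ b, τ p ^ 2 * T p a b ^ 2 + ∑ p, ∑ a, ∑ b, τ a ^ 2 * T p a b ^ 2
      + 1 / 2 * ∑ p, ∑ a, ∑ b, τ b ^ 2 * T p a b ^ 2
      + ∑ p, ∑ a, ∑ b, (τ p * τ b) * T p a b ^ 2
      + ∑ p, ∑ a, ∑ b, (τ a * τ b) * T p a b ^ 2 := by
    simp only [Finset.mul_sum, ← Finset.sum_add_distrib, ← Finset.sum_sub_distrib]
    exact Finset.sum_congr rfl fun p _ => Finset.sum_congr rfl fun a _ =>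
      Finset.sum_congr rfl fun b _ => by ring
  linarith

/-- The algebraic core of the third-order estimate: the differentiated Monge–Ampère equations and
the conditions at an interior maximum. -/
lemma third_order_algebra {T f : Fin n → Fin n → Fin n → ℝ} {F Z : Fin n → Fin n → ℝ}
    {τ e w Y Fe Wd Vd W3 V3 η₁ η₂ q₁ q₂ : Fin n → ℝ} {Wee Vee η Q : ℝ}
    (hη : 0 < η) (hQ : Q = ∑ p, τ p ^ 2)
    (hT : ∀ p a b, T p a b = T a p b) (hT' : ∀ p a b, T p a b = T p b a)
    (hf : ∀ p a b, f p a b = f a p b) (hf' : ∀ p a b, f p a b = f p b a)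
    (hF : ∀ p a, F p a = F a p) (hY : ∑ j, Y j * e j = Wee)
    (hMA : ∀ a, ∑ p, F a p - ∑ p, ∑ q, T a p q ^ 2 = Wd a + ∑ i, w i * T i a a - Vd a)
    (hMAe : ∑ p, Fe p - ∑ p, τ p ^ 2 = Wee + ∑ i, w i * (τ i * e i) - Vee)
    (hMA3 : ∀ a, 2 * ∑ p, ∑ q, τ p * T a p q ^ 2 - ∑ p, τ p * F a p
      - 2 * ∑ p, ∑ q, T a p q * f a p q + ∑ p, Z a p
      = W3 a + ∑ j, Y j * T j a a + 2 * (τ a * Wd a) + ∑ i, w i * f i a a - V3 a)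
    (hq₁ : ∀ p, q₁ p = -2 * ∑ a, τ a ^ 2 * T p a a + 2 * ∑ a, τ a * f p a a
      - τ p * ∑ a, τ a * T p a a)
    (hcrit : ∀ p, η * q₁ p + Q * η₁ p = 0)
    (hq₂ : ∀ p, q₂ p = 4 * ∑ a, ∑ b, τ a ^ 2 * T p a b ^ 2 - 2 * ∑ a, τ a ^ 2 * F p a
      + 2 * ∑ a, τ a * Z p a - 2 * ∑ a, τ p * (τ a * F p a)
      + 2 * ∑ a, ∑ b, (f p a b - 1 / 2 * τ p * T p a b) ^ 2
      + 2 * ∑ a, ∑ b, τ a * τ b * T p a b ^ 2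
      - 8 * ∑ a, ∑ b, T p a b * (f p a b - 1 / 2 * τ p * T p a b) * τ a)
    (hmax : ∀ p, η * q₂ p + 2 * (η₁ p * q₁ p) + Q * η₂ p
      - η * Q * (Fe p - 3 / 2 * τ p ^ 2) ≤ 0)
    (heig : ∀ j, ∑ a, τ a * T j a a = Q * e j) (hZ : ∀ p a, Z p a = Z a p) :
    η * (1 / 2 * Q ^ 2 + Q * (Wee + Vee) + 2 * ∑ a, τ a ^ 2 * (Wd a + Vd a)
        + 2 * ∑ a, τ a * (W3 a - V3 a))
      - 2 * Q / η * ∑ p, η₁ p ^ 2 + Q * (∑ p, η₂ p - ∑ i, w i * η₁ i) ≤ 0 := by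
  have hG : ∀ p a b, T p a b ^ 2 = T a p b ^ 2 := fun p a b => by rw [hT]
  have hG' : ∀ p a b, T p a b ^ 2 = T p b a ^ 2 := fun p a b => by rw [hT']
  have hH : ∀ p a b, T p a b * f p a b = T a p b * f a p b := fun p a b => by rw [hT, hf]
  have hpos := third_order_form_nonneg τ hT hT' hf hf'
  have e1 := sum_swap_left hG fun p _ _ => τ p ^ 2
  have e3 := sum_swap_right hG' fun p a _ => τ p * τ a
  have e4 := sum_swap_left hG fun p _ b => τ p * τ b
  have e5 := sum_swap_left hH fun p _ _ => τ p
  -- the sum of the second-order conditions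
  have hsum : ∑ p, (η * q₂ p + 2 * (η₁ p * q₁ p) + Q * η₂ p
      - η * Q * (Fe p - 3 / 2 * τ p ^ 2)) ≤ 0 := Finset.sum_nonpos fun p _ => hmax p
  have hsum' : ∑ p, (η * q₂ p + 2 * (η₁ p * q₁ p) + Q * η₂ p
      - η * Q * (Fe p - 3 / 2 * τ p ^ 2)) = η * ∑ p, q₂ p + 2 * ∑ p, η₁ p * q₁ p
      + Q * ∑ p, η₂ p - η * Q * ∑ p, Fe p + 3 / 2 * η * Q * ∑ p, τ p ^ 2 := by
    simp only [Finset.mul_sum, ← Finset.sum_add_distrib, ← Finset.sum_sub_distrib]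
    exact Finset.sum_congr rfl fun p _ => by ring
  have hq₂' : ∑ p, q₂ p = 4 * ∑ p, ∑ a, ∑ b, τ a ^ 2 * T p a b ^ 2
      - 2 * ∑ p, ∑ a, τ a ^ 2 * F p a + 2 * ∑ p, ∑ a, τ a * Z p a
      - 2 * ∑ p, ∑ a, τ p * (τ a * F p a) + 2 * ∑ p, ∑ a, ∑ b, f p a b ^ 2
      - 2 * ∑ p, ∑ a, ∑ b, τ p * (T p a b * f p a b)
      + 1 / 2 * ∑ p, ∑ a, ∑ b, τ p ^ 2 * T p a b ^ 2
      + 2 * ∑ p, ∑ a, ∑ b, (τ a * τ b) * T p a b ^ 2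
      - 8 * ∑ p, ∑ a, ∑ b, τ a * (T p a b * f p a b)
      + 4 * ∑ p, ∑ a, ∑ b, (τ p * τ a) * T p a b ^ 2 := by
    have d1 : ∀ p, ∑ a, ∑ b, (f p a b - 1 / 2 * τ p * T p a b) ^ 2 = ∑ a, ∑ b, f p a b ^ 2
        - ∑ a, ∑ b, τ p * (T p a b * f p a b) + 1 / 4 * ∑ a, ∑ b, τ p ^ 2 * T p a b ^ 2 := by
      intro p
      simp only [Finset.mul_sum, ← Finset.sum_add_distrib, ← Finset.sum_sub_distrib]
      exact Finset.sum_congr rfl fun a _ => Finset.sum_congr rfl fun b _ => by ring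
    have d2 : ∀ p, ∑ a, ∑ b, T p a b * (f p a b - 1 / 2 * τ p * T p a b) * τ a
        = ∑ a, ∑ b, τ a * (T p a b * f p a b)
        - 1 / 2 * ∑ a, ∑ b, (τ p * τ a) * T p a b ^ 2 := by
      intro p
      simp only [Finset.mul_sum, ← Finset.sum_sub_distrib]
      exact Finset.sum_congr rfl fun a _ => Finset.sum_congr rfl fun b _ => by ring
    simp only [hq₂, d1, d2, Finset.mul_sum, ← Finset.sum_add_distrib, ← Finset.sum_sub_distrib]
    exact Finset.sum_congr rfl fun p _ => by
      simp only [Finset.sum_add_distrib, Finset.sum_sub_distrib, ← Finset.mul_sum]; ring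
  -- the differentiated equations, weighted and summed
  have g1 : ∑ p, ∑ a, τ a ^ 2 * F p a = ∑ p, ∑ a, ∑ b, τ p ^ 2 * T p a b ^ 2
      + ∑ a, τ a ^ 2 * (Wd a - Vd a) + ∑ i, w i * ∑ a, τ a ^ 2 * T i a a := by
    simp only [Finset.mul_sum]
    rw [Finset.sum_comm (f := fun i a => w i * (τ a ^ 2 * T i a a)), Finset.sum_comm,
      ← Finset.sum_add_distrib, ← Finset.sum_add_distrib]
    refine Finset.sum_congr rfl fun a _ => ?_
    have := hMA a
    rw [← Finset.mul_sum, Finset.sum_congr rfl fun p _ => hF p a,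
      show ∑ p, F a p = ∑ p, ∑ q, T a p q ^ 2 + (Wd a - Vd a) + ∑ i, w i * T i a a by linarith]
    simp only [mul_add, Finset.mul_sum]
    congr 1
    exact Finset.sum_congr rfl fun i _ => by ring
  have g2 : ∑ p, ∑ a, τ a * Z p a = ∑ a, τ a * (W3 a - V3 a) + Q * Wee
      + 2 * ∑ a, τ a ^ 2 * Wd a + ∑ i, w i * ∑ a, τ a * f i a a
      - 2 * ∑ p, ∑ a, ∑ b, (τ p * τ a) * T p a b ^ 2 + ∑ p, ∑ a, τ p * (τ a * F p a)
      + 2 * ∑ p, ∑ a, ∑ b, τ p * (T p a b * f p a b) := by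
    have gY : Q * Wee = ∑ a, τ a * ∑ j, Y j * T j a a := by
      rw [← hY]
      simp only [Finset.mul_sum]
      rw [Finset.sum_comm]
      refine Finset.sum_congr rfl fun j _ => ?_
      rw [show Q * (Y j * e j) = Y j * (Q * e j) by ring, ← heig, Finset.mul_sum]
      exact Finset.sum_congr rfl fun a _ => by ring
    have gw : ∑ i, w i * ∑ a, τ a * f i a a = ∑ a, τ a * ∑ i, w i * f i a a := by
      simp only [Finset.mul_sum]
      rw [Finset.sum_comm]
      exact Finset.sum_congr rfl fun a _ => Finset.sum_congr rfl fun i _ => by ring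
    have gT : ∑ p, ∑ a, ∑ b, (τ p * τ a) * T p a b ^ 2
        = ∑ p, τ p * ∑ a, ∑ b, τ a * T p a b ^ 2 := by
      simp only [Finset.mul_sum, mul_assoc]
    have gF : ∑ p, ∑ a, τ p * (τ a * F p a) = ∑ p, τ p * ∑ a, τ a * F p a := by
      simp only [Finset.mul_sum]
    have gTf : ∑ p, ∑ a, ∑ b, τ p * (T p a b * f p a b)
        = ∑ p, τ p * ∑ a, ∑ b, T p a b * f p a b := by
      simp only [Finset.mul_sum]
    rw [gY, gw, gT, gF, gTf, Finset.sum_comm, Finset.mul_sum, Finset.mul_sum, Finset.mul_sum]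
    simp only [← Finset.sum_add_distrib, ← Finset.sum_sub_distrib]
    refine Finset.sum_congr rfl fun a _ => ?_
    rw [← Finset.mul_sum, Finset.sum_congr rfl fun p _ => hZ p a]
    linear_combination τ a * hMA3 a
  have g3 : ∑ i, w i * q₁ i = -2 * ∑ i, w i * ∑ a, τ a ^ 2 * T i a a
      + 2 * ∑ i, w i * ∑ a, τ a * f i a a - Q * ∑ i, w i * (τ i * e i) := by
    rw [Finset.mul_sum, Finset.mul_sum, Finset.mul_sum]
    simp only [← Finset.sum_add_distrib, ← Finset.sum_sub_distrib]
    refine Finset.sum_congr rfl fun i _ => ?_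
    rw [hq₁, heig]
    ring
  have g4 : η * ∑ i, w i * q₁ i = - (Q * ∑ i, w i * η₁ i) := by
    rw [Finset.mul_sum, Finset.mul_sum, ← Finset.sum_neg_distrib]
    exact Finset.sum_congr rfl fun i _ => by linear_combination w i * hcrit i
  have g5 : ∑ p, η₁ p * q₁ p = - (Q / η * ∑ p, η₁ p ^ 2) := by
    rw [Finset.mul_sum, ← Finset.sum_neg_distrib]
    refine Finset.sum_congr rfl fun i _ => ?_
    have : q₁ i = -(Q * η₁ i) / η := by
      rw [eq_div_iff hη.ne']; linarith [hcrit i]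
    rw [this]; ring
  have g6 : ∑ a, τ a ^ 2 * (Wd a + Vd a) = 2 * ∑ a, τ a ^ 2 * Wd a
      - ∑ a, τ a ^ 2 * (Wd a - Vd a) := by
    rw [Finset.mul_sum, ← Finset.sum_sub_distrib]
    exact Finset.sum_congr rfl fun a _ => by ring
  rw [hsum', hq₂', g5] at hsum
  rw [← hQ] at hsum hMAe
  have hFe : ∑ p, Fe p = Q + Wee + ∑ i, w i * (τ i * e i) - Vee := by linarith
  rw [g1, g2, hFe, ← e4, ← e3, ← e1, ← e5] at hsum
  rw [g6]
  have hpos' := mul_nonneg hη.le hpos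
  rw [g3] at g4
  have : 2 * Q / η = 2 * (Q / η) := by ring
  rw [this]
  linarith

end Algebra

section AlongLine

variable {n : ℕ} {Φ η : (Fin n → ℝ) → ℝ}

lemma hasDerivAt_sub_smul_matrix {M N : ℝ → Matrix (Fin n) (Fin n) ℝ}
    {M' N' : Matrix (Fin n) (Fin n) ℝ} {r : ℝ → ℝ} {r' t : ℝ} (hM : HasDerivAt M M' t)
    (hr : HasDerivAt r r' t) (hN : HasDerivAt N N' t) :
    HasDerivAt (fun s => M s - r s • N s) (M' - (r' • N t + r t • N')) t :=
  hasDerivAt_matrix fun i j => (hasDerivAt_apply_matrix hM i j).sub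
    (hr.mul (hasDerivAt_apply_matrix hN i j))

lemma hess_dd_sub_smul (hΦ : ContDiff ℝ 3 Φ) (u v y : Fin n → ℝ) (r : ℝ) :
    hess (dd Φ (u - r • v)) y = hess (dd Φ u) y - r • hess (dd Φ v) y := by
  simp only [← dirHess_eq_hess_dd hΦ]
  ext i j
  simp [dirHess, sub_mul, Finset.sum_sub_distrib, Finset.mul_sum, mul_assoc]

/-- First- and second-order conditions in direction `v` at a maximum of
`η Tr[h⁻¹ ∂_u h h⁻¹ ∂_u h] / ⟨h u, u⟩`, tested along `u = e - s t v`. -/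
lemma conditions_along_line (hΦ : ContDiff ℝ 5 Φ) (hpos : ∀ x, (hess Φ x).PosDef)
    (hη : ContDiff ℝ 2 η) {x e : Fin n → ℝ} (hx : hess Φ x = 1) {M : ℝ}
    (heq : η x * (hess (dd Φ e) x * hess (dd Φ e) x).trace = M * (e ⬝ᵥ e))
    (hmax : ∀ᶠ y in nhds x, ∀ u, η y * ((hess Φ y)⁻¹ * hess (dd Φ u) y * (hess Φ y)⁻¹
      * hess (dd Φ u) y).trace ≤ M * (u ⬝ᵥ hess Φ y *ᵥ u)) (v : Fin n → ℝ) (s : ℝ)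
    {A A₁ A₂ h₁ h₂ : Matrix (Fin n) (Fin n) ℝ} (hA : A = hess (dd Φ e) x)
    (hA₁ : A₁ = hess (dd (dd Φ e) v) x - s • hess (dd Φ v) x)
    (hA₂ : A₂ = hess (dd (dd (dd Φ e) v) v) x - (2 * s) • hess (dd (dd Φ v) v) x)
    (hh₁ : h₁ = hess (dd Φ v) x) (hh₂ : h₂ = hess (dd (dd Φ v) v) x) :
    dd η v x * (A * A).trace + η x * (2 * (A₁ * A).trace - 2 * (h₁ * A * A).trace)
        - M * (dd (dd (dd Φ e) e) v x - 2 * s * (e ⬝ᵥ v)) = 0 ∧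
      dd (dd η v) v x * (A * A).trace
        + 2 * (dd η v x * (2 * (A₁ * A).trace - 2 * (h₁ * A * A).trace))
        + η x * (2 * (A₂ * A).trace + 2 * (A₁ * A₁).trace + 4 * (h₁ * h₁ * A * A).trace
          - 2 * (h₂ * A * A).trace + 2 * (h₁ * A * h₁ * A).trace
          - 4 * (h₁ * A₁ * A).trace - 4 * (h₁ * A * A₁).trace)
        - M * (dd (dd (dd (dd Φ e) e) v) v x - 4 * s * dd (dd (dd Φ e) v) v x
          + 2 * s ^ 2 * (v ⬝ᵥ v)) ≤ 0 := by
  have h4 : ContDiff ℝ 4 Φ := hΦ.of_le (by norm_num)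
  have h3 : ContDiff ℝ 3 Φ := hΦ.of_le (by norm_num)
  have h2 : ContDiff ℝ 2 Φ := hΦ.of_le (by norm_num)
  have c4 : ∀ u, ContDiff ℝ 4 (dd Φ u) := fun u => contDiff_dd hΦ (by norm_num) u
  have c3 : ∀ u w, ContDiff ℝ 3 (dd (dd Φ u) w) := fun u w => contDiff_dd (c4 u) (by norm_num) w
  have c2 : ∀ u w z, ContDiff ℝ 2 (dd (dd (dd Φ u) w) z) :=
    fun u w z => contDiff_dd (c3 u w) (by norm_num) z
  have hl : ∀ {f : (Fin n → ℝ) → ℝ}, ContDiff ℝ 1 f → ∀ t : ℝ,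
      HasDerivAt (fun r : ℝ => f (x + r • v)) (dd f v (x + t • v)) t :=
    fun hf t => hasDerivAt_line (hf.differentiable (by norm_num)) x v t
  -- the path of matrices
  let h : ℝ → Matrix (Fin n) (Fin n) ℝ := fun t => hess Φ (x + t • v)
  let k₁ : ℝ → Matrix (Fin n) (Fin n) ℝ := fun t => hess (dd Φ v) (x + t • v)
  let P : ℝ → Matrix (Fin n) (Fin n) ℝ := fun t =>
    hess (dd Φ e) (x + t • v) - (s * t) • hess (dd Φ v) (x + t • v)
  let P₁ : ℝ → Matrix (Fin n) (Fin n) ℝ := fun t => hess (dd (dd Φ e) v) (x + t • v)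
    - (s • hess (dd Φ v) (x + t • v) + (s * t) • hess (dd (dd Φ v) v) (x + t • v))
  have hst : ∀ t : ℝ, HasDerivAt (fun t : ℝ => s * t) s t := fun t => by
    simpa using (hasDerivAt_id t).const_mul s
  have dh : ∀ t, HasDerivAt h (k₁ t) t := fun t => hasDerivAt_hess_line h3 x v t
  have dk : HasDerivAt k₁ h₂ 0 := by
    rw [hh₂]; exact hasDerivAt_hess_line_zero ((c4 v).of_le (by norm_num)) x v
  have dP : ∀ t, HasDerivAt P (P₁ t) t := fun t => hasDerivAt_sub_smul_matrix
    (hasDerivAt_hess_line ((c4 e).of_le (by norm_num)) x v t) (hst t)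
    (hasDerivAt_hess_line ((c4 v).of_le (by norm_num)) x v t)
  have dP₁ : HasDerivAt P₁ A₂ 0 := by
    have e1 : P₁ = fun t => (hess (dd (dd Φ e) v) (x + t • v) - s • hess (dd Φ v) (x + t • v))
        - (s * t) • hess (dd (dd Φ v) v) (x + t • v) := by
      funext t; simp only [P₁]; abel
    rw [e1]
    have e2 := hasDerivAt_sub_smul_matrix (hasDerivAt_sub_smul_matrix
      (hasDerivAt_hess_line_zero (c3 e v) x v) (hasDerivAt_const (0 : ℝ) s)
      (hasDerivAt_hess_line_zero ((c4 v).of_le (by norm_num)) x v)) (hst 0)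
      (hasDerivAt_hess_line_zero (c3 v v) x v)
    have e3 : A₂ = hess (dd (dd (dd Φ e) v) v) x - ((0 : ℝ) • hess (dd Φ v) (x + (0 : ℝ) • v)
        + s • hess (dd (dd Φ v) v) x) - (s • hess (dd (dd Φ v) v) (x + (0 : ℝ) • v)
        + (s * 0) • hess (dd (dd (dd Φ v) v) v) x) := by
      rw [hA₂]
      simp only [zero_smul, add_zero, mul_zero, zero_add, two_mul, add_smul]
      abel
    rw [e3]
    exact e2
  have h0 : h 0 = 1 := by simp only [h, zero_smul, add_zero, hx]
  have hk0 : k₁ 0 = h₁ := by simp only [k₁, zero_smul, add_zero, hh₁]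
  have hP0 : P 0 = A := by simp only [P, zero_smul, add_zero, mul_zero, sub_zero, hA]
  have hP10 : P₁ 0 = A₁ := by simp only [P₁, zero_smul, add_zero, mul_zero, hA₁]
  have dq := fun t => hasDerivAt_trace_inv_mul_sq (dh t) (dP t) (hpos (x + t • v)).isUnit
  have dq₁ := hasDerivAt_deriv_trace_inv_mul_sq (dh 0) dk (dP 0) dP₁ h0
  rw [hk0, hP0, hP10] at dq₁
  -- the normalising factor
  have dN : ∀ t, HasDerivAt (fun t : ℝ => dd (dd Φ e) e (x + t • v)
      - 2 * (s * t) * dd (dd Φ e) v (x + t • v) + (s * t) ^ 2 * dd (dd Φ v) v (x + t • v))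
      (dd (dd (dd Φ e) e) v (x + t • v)
        - (2 * s * dd (dd Φ e) v (x + t • v) + 2 * (s * t) * dd (dd (dd Φ e) v) v (x + t • v))
        + (2 * s * (s * t) * dd (dd Φ v) v (x + t • v)
          + (s * t) ^ 2 * dd (dd (dd Φ v) v) v (x + t • v))) t := fun t => by
    have := ((hl ((c3 e e).of_le (by norm_num)) t).sub
      (((hst t).const_mul 2).mul (hl ((c3 e v).of_le (by norm_num)) t))).add
      (((hst t).pow 2).mul (hl ((c3 v v).of_le (by norm_num)) t))
    refine this.congr_deriv ?_
    simp only [Pi.pow_apply]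
    push_cast
    ring
  have dN₁ : HasDerivAt (fun t : ℝ => dd (dd (dd Φ e) e) v (x + t • v)
        - (2 * s * dd (dd Φ e) v (x + t • v) + 2 * (s * t) * dd (dd (dd Φ e) v) v (x + t • v))
        + (2 * s * (s * t) * dd (dd Φ v) v (x + t • v)
          + (s * t) ^ 2 * dd (dd (dd Φ v) v) v (x + t • v)))
      (dd (dd (dd (dd Φ e) e) v) v x - 4 * s * dd (dd (dd Φ e) v) v x
        + 2 * s ^ 2 * (v ⬝ᵥ v)) 0 := by
    have := ((hl ((c2 e e v).of_le (by norm_num)) 0).sub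
      (((hl ((c3 e v).of_le (by norm_num)) 0).const_mul (2 * s)).add
        (((hst 0).const_mul 2).mul (hl ((c2 e v v).of_le (by norm_num)) 0)))).add
      ((((hst 0).const_mul (2 * s)).mul (hl ((c3 v v).of_le (by norm_num)) 0)).add
        (((hst 0).pow 2).mul (hl ((c2 v v v).of_le (by norm_num)) 0)))
    refine this.congr_deriv ?_
    have hvv : dd (dd Φ v) v x = v ⬝ᵥ v := by rw [dd_dd_eq h2, hx, one_mulVec]
    simp only [zero_smul, add_zero, hvv, Pi.pow_apply]
    push_cast
    ring
  have dη : ∀ t, HasDerivAt (fun t : ℝ => η (x + t • v)) (dd η v (x + t • v)) t :=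
    hl (hη.of_le (by norm_num))
  have dη₁ : HasDerivAt (fun t : ℝ => dd η v (x + t • v)) (dd (dd η v) v x) 0 :=
    hasDerivAt_line_zero ((contDiff_dd hη (m := 1) (by norm_num) v).differentiable
      (by norm_num)) x v
  have key := deriv2_nonpos_of_isLocalMax (g := fun t : ℝ => η (x + t • v)
      * ((h t)⁻¹ * P t * (h t)⁻¹ * P t).trace - M * (dd (dd Φ e) e (x + t • v)
      - 2 * (s * t) * dd (dd Φ e) v (x + t • v) + (s * t) ^ 2 * dd (dd Φ v) v (x + t • v))) ?_
    (Eventually.of_forall fun t => ((dη t).mul (dq t)).sub ((dN t).const_mul M))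
    (((dη₁.mul (dq 0)).add ((dη 0).mul dq₁)).sub (dN₁.const_mul M))
  · have hev : dd (dd Φ e) v x = e ⬝ᵥ v := by rw [dd_dd_eq h2, hx, one_mulVec]
    simp only [Pi.sub_apply, Pi.add_apply, Pi.mul_apply, h0, hk0, hP0, hP10, zero_smul, add_zero,
      inv_one, Matrix.one_mul, Matrix.mul_one, mul_zero, zero_mul, hev] at key
    refine ⟨?_, ?_⟩
    · rw [← key.1]; ring
    · refine le_of_eq_of_le ?_ key.2; ring
  · have hc : Tendsto (fun t : ℝ => x + t • v) (nhds 0) (nhds x) := by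
      have : Continuous fun t : ℝ => x + t • v := by fun_prop
      simpa using this.tendsto 0
    filter_upwards [hc.eventually hmax] with t ht
    have h5 := ht (e - (s * t) • v)
    rw [hess_dd_sub_smul h3] at h5
    have h6 : (e - (s * t) • v) ⬝ᵥ hess Φ (x + t • v) *ᵥ (e - (s * t) • v)
        = dd (dd Φ e) e (x + t • v) - 2 * (s * t) * dd (dd Φ e) v (x + t • v)
          + (s * t) ^ 2 * dd (dd Φ v) v (x + t • v) := by
      have h7 : v ⬝ᵥ hess Φ (x + t • v) *ᵥ e = e ⬝ᵥ hess Φ (x + t • v) *ᵥ v := by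
        rw [← dd_dd_eq h2, ← dd_dd_eq h2, dd_comm h2]
      simp only [dd_dd_eq h2, mulVec_sub, mulVec_smul, sub_dotProduct, dotProduct_sub,
        smul_dotProduct, dotProduct_smul, smul_eq_mul, h7]
      ring
    rw [h6] at h5
    simp only [h0, hP0, zero_smul, add_zero, inv_one, Matrix.one_mul, Matrix.mul_one, mul_zero,
      zero_mul, dd_dd_eq h2, hx, one_mulVec]
    rw [hA, heq]
    simp only [dd_dd_eq h2] at h5
    simp only [h, P]
    nlinarith [h5]

end AlongLine

section DiagonalTrace

variable {n : ℕ} (M N : Matrix (Fin n) (Fin n) ℝ) (τ : Fin n → ℝ)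

lemma trace_mul_diagonal : (M * diagonal τ).trace = ∑ a, τ a * M a a := by
  simp only [trace, diag_apply, mul_diagonal, mul_comm]

lemma trace_mul_diagonal_mul_diagonal :
    (M * diagonal τ * diagonal τ).trace = ∑ a, τ a ^ 2 * M a a := by
  simp only [trace, diag_apply, mul_diagonal]
  exact Finset.sum_congr rfl fun a _ => by ring

variable {M N}

lemma trace_mul_of_symm (hN : Nᵀ = N) : (M * N).trace = ∑ a, ∑ b, M a b * N a b := by
  simp only [trace, diag_apply, Matrix.mul_apply]
  exact Finset.sum_congr rfl fun a _ => Finset.sum_congr rfl fun b _ => by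
    rw [← hN, transpose_apply]; nth_rewrite 2 [← hN]; rfl

lemma trace_mul_mul_diagonal (hN : Nᵀ = N) :
    (M * N * diagonal τ).trace = ∑ a, ∑ b, M a b * N a b * τ a := by
  rw [trace_mul_diagonal]
  refine Finset.sum_congr rfl fun a _ => ?_
  rw [Matrix.mul_apply, Finset.mul_sum]
  refine Finset.sum_congr rfl fun b _ => ?_
  rw [show N b a = N a b from congrFun (congrFun hN a) b]
  ring

lemma trace_mul_diagonal_mul (hM : Mᵀ = M) (hN : Nᵀ = N) :
    (M * diagonal τ * N).trace = ∑ a, ∑ b, M a b * N a b * τ a := by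
  rw [trace_mul_of_symm hN, Finset.sum_comm]
  refine Finset.sum_congr rfl fun a _ => Finset.sum_congr rfl fun b _ => ?_
  rw [mul_diagonal, show N b a = N a b from congrFun (congrFun hN a) b,
    show M b a = M a b from congrFun (congrFun hM a) b]
  ring

lemma trace_sq_mul_diagonal_mul_diagonal (hM : Mᵀ = M) :
    (M * M * diagonal τ * diagonal τ).trace = ∑ a, ∑ b, τ a ^ 2 * M a b ^ 2 := by
  rw [trace_mul_diagonal_mul_diagonal]
  refine Finset.sum_congr rfl fun a _ => ?_
  rw [Matrix.mul_apply, Finset.mul_sum]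
  refine Finset.sum_congr rfl fun b _ => ?_
  rw [show M b a = M a b from congrFun (congrFun hM a) b]
  ring

lemma trace_mul_diagonal_sq (hM : Mᵀ = M) :
    (M * diagonal τ * M * diagonal τ).trace = ∑ a, ∑ b, τ a * τ b * M a b ^ 2 := by
  rw [trace_mul_mul_diagonal _ hM]
  refine Finset.sum_congr rfl fun a _ => Finset.sum_congr rfl fun b _ => ?_
  rw [mul_diagonal]
  ring

end DiagonalTrace

section ThirdOrder

variable {n : ℕ} {Φ V W η : (Fin n → ℝ) → ℝ} {κ : ℝ}

lemma eq_zero_of_forall_mul_add_sq_le {a b : ℝ} (h : ∀ s : ℝ, s * a + s ^ 2 * b ≤ 0) : a = 0 := by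
  by_contra ha
  have hb : 0 < |b| + 1 := by positivity
  have h1 := h (a / (|b| + 1))
  have h2 : a / (|b| + 1) * a + (a / (|b| + 1)) ^ 2 * b
      = a ^ 2 / (|b| + 1) ^ 2 * ((|b| + 1) + b) := by
    field_simp
  rw [h2] at h1
  have h3 : 0 < a ^ 2 / (|b| + 1) ^ 2 := by positivity
  have h4 : 0 < (|b| + 1) + b := by linarith [neg_abs_le b]
  linarith [mul_pos h3 h4]

/-- The differential inequality at an interior maximum of
`η Tr[h⁻¹ ∂_u h h⁻¹ ∂_u h] / ⟨h u, u⟩` in coordinates with `h = D²Φ = Id` and `∂_e h` diagonal. -/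
lemma third_order_inequality (hΦ : ContDiff ℝ 5 Φ) (hpos : ∀ x, (hess Φ x).PosDef)
    (hV : ContDiff ℝ 3 V) (hW : ContDiff ℝ 3 W) (hη : ContDiff ℝ 2 η)
    (hdet : ∀ x, Real.log (hess Φ x).det = W (grad Φ x) - V x + κ)
    {x e τ : Fin n → ℝ} (hx : hess Φ x = 1) (he : e ⬝ᵥ e = 1)
    (hτ : hess (dd Φ e) x = diagonal τ) (hηx : 0 < η x) {Q : ℝ} (hQ : Q = ∑ p, τ p ^ 2)
    (hmax : ∀ᶠ y in nhds x, ∀ u, η y * ((hess Φ y)⁻¹ * hess (dd Φ u) y * (hess Φ y)⁻¹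
      * hess (dd Φ u) y).trace ≤ η x * Q * (u ⬝ᵥ hess Φ y *ᵥ u)) :
    η x * (1 / 2 * Q ^ 2 + Q * (e ⬝ᵥ hess W (grad Φ x) *ᵥ e + e ⬝ᵥ hess V x *ᵥ e)
        + 2 * ∑ a, τ a ^ 2 * (hess W (grad Φ x) a a + hess V x a a)
        + 2 * ∑ a, τ a * (dirHess W e (grad Φ x) a a - dirHess V e x a a))
      - 2 * Q / η x * ∑ p, pd η p x ^ 2
      + Q * (∑ p, pd2 η p p x - ∑ i, pd W i (grad Φ x) * pd η i x) ≤ 0 := by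
  have h4 : ContDiff ℝ 4 Φ := hΦ.of_le (by norm_num)
  have h3 : ContDiff ℝ 3 Φ := hΦ.of_le (by norm_num)
  have h2 : ContDiff ℝ 2 Φ := hΦ.of_le (by norm_num)
  have hm : ContDiff ℝ 3 fun x => W (grad Φ x) - V x + κ :=
    ((hW.comp (contDiff_grad hΦ (by norm_num))).sub hV).add contDiff_const
  have c4 : ∀ u, ContDiff ℝ 4 (dd Φ u) := fun u => contDiff_dd hΦ (by norm_num) u
  have c3 : ∀ u w, ContDiff ℝ 3 (dd (dd Φ u) w) := fun u w => contDiff_dd (c4 u) (by norm_num) w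
  have c2 : ∀ u w z, ContDiff ℝ 2 (dd (dd (dd Φ u) w) z) :=
    fun u w z => contDiff_dd (c3 u w) (by norm_num) z
  have s0 : ∀ u v, dd (dd Φ u) v = dd (dd Φ v) u := fun u v => dd_comm h2 u v
  have s1 : ∀ u v w, dd (dd (dd Φ u) v) w = dd (dd (dd Φ u) w) v :=
    fun u v w => dd_comm ((c4 u).of_le (by norm_num)) v w
  have s2 : ∀ u v w z, dd (dd (dd (dd Φ u) v) w) z = dd (dd (dd (dd Φ u) v) z) w :=
    fun u v w z => dd_comm ((c3 u v).of_le (by norm_num)) w z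
  have s3 : ∀ u v w z y, dd (dd (dd (dd (dd Φ u) v) w) z) y = dd (dd (dd (dd (dd Φ u) v) w) y) z :=
    fun u v w z y => dd_comm (c2 u v w) z y
  let E : Fin n → Fin n → ℝ := fun i => Pi.single i 1
  have hE : ∀ (f : (Fin n → ℝ) → ℝ) a b y, hess f y a b = dd (dd f (E a)) (E b) y :=
    fun f a b y => rfl
  have hpdE : ∀ (f : (Fin n → ℝ) → ℝ) i, pd f i = dd f (E i) := fun f i => rfl
  have hdiag : ∀ a b, dd (dd (dd Φ e) (E a)) (E b) x = diagonal τ a b := fun a b => by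
    rw [← hτ]; rfl
  have hd2 : ∀ u v, dd (dd Φ u) v x = u ⬝ᵥ v := fun u v => by rw [dd_dd_eq h2, hx, one_mulVec]
  have hEe : ∀ i u, E i ⬝ᵥ u = u i := fun i u => single_one_dotProduct i u
  have heE : ∀ i (u : Fin n → ℝ), u ⬝ᵥ E i = u i := fun i u => dotProduct_single_one u i
  have hsymT : ∀ u, (hess (dd Φ u) x)ᵀ = hess (dd Φ u) x := fun u =>
    hess_transpose ((c4 u).of_le (by norm_num)) x
  have hsymf : ∀ u v, (hess (dd (dd Φ u) v) x)ᵀ = hess (dd (dd Φ u) v) x := fun u v =>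
    hess_transpose ((c3 u v).of_le (by norm_num)) x
  have hQtr : (hess (dd Φ e) x * hess (dd Φ e) x).trace = Q := by
    rw [hτ, trace_mul_diagonal, hQ]
    exact Finset.sum_congr rfl fun a _ => by rw [diagonal_apply_eq, sq]
  have hδ : ∀ i a, dd (pd Φ i) (E a) x = if i = a then 1 else 0 := fun i a => by
    rw [hpdE, hd2, hEe]
    simp only [E, Pi.single_apply]
  have hδe : ∀ i, dd (pd Φ i) e x = e i := fun i => by rw [hpdE, hd2, hEe]
  have hδτ : ∀ i a, dd (dd (pd Φ i) (E a)) e x = if i = a then τ a else 0 := fun i a => by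
    rw [hpdE, s1, s0, hdiag, diagonal_apply]
    split_ifs with h
    · rw [h]
    · rfl
  have hee : ∀ i, dd (dd (pd Φ i) e) e x = τ i * e i := fun i => by
    rw [hpdE, s0, dd_dd_eq ((c4 e).of_le (by norm_num)), hτ, hEe, mulVec_diagonal]
  have hdir : ∀ {f : (Fin n → ℝ) → ℝ}, ContDiff ℝ 3 f → ∀ a y,
      dd (dd (dd f (E a)) (E a)) e y = dirHess f e y a a := fun hf a y => by
    rw [dirHess_eq_hess_dd hf, hE, dd_comm (contDiff_dd hf (by norm_num) _),
      dd_comm (hf.of_le (by norm_num))]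
  have hline := fun p => conditions_along_line hΦ hpos hη hx (M := η x * Q) (e := e)
    (by rw [hQtr, he, mul_one]) hmax (E p) (1 / 2 * τ p) rfl rfl rfl rfl rfl
  refine third_order_algebra (n := n) (T := fun p a b => hess (dd Φ (E p)) x a b)
    (f := fun p a b => hess (dd (dd Φ (E p)) e) x a b)
    (F := fun p a => hess (dd (dd Φ (E p)) (E p)) x a a)
    (Z := fun p a => hess (dd (dd (dd Φ (E p)) (E p)) e) x a a)
    (Fe := fun p => hess (dd (dd Φ e) e) x p p) (e := e)
    (Y := fun j => ∑ i, pd2 W j i (grad Φ x) * e i)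
    (q₁ := fun p => 2 * ((hess (dd (dd Φ e) (E p)) x - (1 / 2 * τ p) • hess (dd Φ (E p)) x)
      * diagonal τ).trace - 2 * (hess (dd Φ (E p)) x * diagonal τ * diagonal τ).trace)
    (q₂ := fun p => 4 * ∑ a, ∑ b, τ a ^ 2 * hess (dd Φ (E p)) x a b ^ 2
      - 2 * ∑ a, τ a ^ 2 * hess (dd (dd Φ (E p)) (E p)) x a a
      + 2 * ∑ a, τ a * hess (dd (dd (dd Φ (E p)) (E p)) e) x a a
      - 2 * ∑ a, τ p * (τ a * hess (dd (dd Φ (E p)) (E p)) x a a)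
      + 2 * ∑ a, ∑ b, (hess (dd (dd Φ (E p)) e) x a b
        - 1 / 2 * τ p * hess (dd Φ (E p)) x a b) ^ 2
      + 2 * ∑ a, ∑ b, τ a * τ b * hess (dd Φ (E p)) x a b ^ 2
      - 8 * ∑ a, ∑ b, hess (dd Φ (E p)) x a b * (hess (dd (dd Φ (E p)) e) x a b
        - 1 / 2 * τ p * hess (dd Φ (E p)) x a b) * τ a)
    hηx hQ ?_ ?_ ?_ ?_ ?_ ?_ ?_ ?_ ?_ ?_ ?_ ?_ ?_ ?_ ?_
  · intro p a b
    simp only [hE]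
    rw [s0]
  · intro p a b
    simp only [hE]
    rw [s1]
  · intro p a b
    simp only [hE]
    rw [s1 (E p) e, s0 (E p), s1 (E a) e]
  · intro p a b
    simp only [hE]
    rw [s2]
  · intro p a
    simp only [hE]
    rw [s1 (E p) (E p), s0 (E p) (E a), s2 (E a) (E p) (E p), s1 (E a) (E p)]
  · simp only [dotProduct, mulVec, Finset.sum_mul, Finset.mul_sum]
    exact Finset.sum_congr rfl fun j _ => Finset.sum_congr rfl fun i _ => by
      simp only [hess, of_apply]; ring
  · intro a
    have e1 := dd_dd_log_det h4 hpos (hm.of_le (by norm_num)) hdet (E a) (E a) x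
    rw [dd_dd_comp_grad h3 (hV.of_le (by norm_num)) (hW.of_le (by norm_num))
      (hm.of_le (by norm_num)) (fun _ => rfl), hx, inv_one, Matrix.one_mul, Matrix.one_mul,
      Matrix.mul_one, trace_mul_of_symm (hsymT _)] at e1
    simp only [hδ, mul_ite, mul_one, mul_zero, Finset.sum_ite_eq', Finset.mem_univ, if_true,
      Finset.sum_add_distrib] at e1
    simp only [trace, diag_apply, ← sq] at e1
    exact e1.symm
  · have e1 := dd_dd_log_det h4 hpos (hm.of_le (by norm_num)) hdet e e x
    rw [dd_dd_comp_grad h3 (hV.of_le (by norm_num)) (hW.of_le (by norm_num))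
      (hm.of_le (by norm_num)) (fun _ => rfl), hx, inv_one, Matrix.one_mul, Matrix.one_mul,
      Matrix.mul_one, hQtr, hQ, dd_dd_eq (hV.of_le (by norm_num))] at e1
    simp only [hδe, hee, Finset.sum_add_distrib] at e1
    simp only [trace, diag_apply] at e1
    rw [← e1]
    congr 2
    simp only [dotProduct, mulVec, Finset.sum_mul, Finset.mul_sum]
    exact Finset.sum_congr rfl fun j _ => Finset.sum_congr rfl fun i _ => by
      simp only [hess, of_apply]; ring
  · intro a
    have e1 := dd_dd_dd_log_det hΦ hpos hm hdet (E a) e hx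
    rw [dd_dd_dd_comp_grad h4 hV hW hm (fun _ => rfl), trace_mul_of_symm (hsymT _), hτ,
      trace_mul_comm (diagonal τ), trace_mul_diagonal, Matrix.mul_assoc,
      trace_mul_comm (diagonal τ), trace_mul_mul_diagonal _ (hsymT _)] at e1
    simp only [hδ, hδe, hδτ, mul_ite, mul_one, mul_zero, Finset.sum_ite_eq', Finset.mem_univ,
      if_true, Finset.sum_add_distrib] at e1
    have e2 : ∑ k, pd3 W a a k (grad Φ x) * e k = dirHess W e (grad Φ x) a a := by
      rw [← hdir hW, dd_eq_sum]
      exact Finset.sum_congr rfl fun k _ => mul_comm _ _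
    have e3 : ∀ i, dd (dd (dd (pd Φ i) (E a)) (E a)) e x = hess (dd (dd Φ (E i)) e) x a a :=
      fun i => by rw [hpdE, s2, s1, hE]
    have e4 : ∑ p, ∑ q, hess (dd Φ (E a)) x p q * hess (dd Φ (E a)) x p q * τ p
        = ∑ p, ∑ q, τ p * hess (dd Φ (E a)) x p q ^ 2 :=
      Finset.sum_congr rfl fun p _ => Finset.sum_congr rfl fun q _ => by ring
    have e5 : ∑ p, ∑ q, hess (dd (dd Φ (E a)) e) x p q * hess (dd Φ (E a)) x p q
        = ∑ p, ∑ q, hess (dd Φ (E a)) x p q * hess (dd (dd Φ (E a)) e) x p q :=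
      Finset.sum_congr rfl fun p _ => Finset.sum_congr rfl fun q _ => by ring
    rw [e2, hdir hV, e4, e5] at e1
    simp only [e3, trace, diag_apply] at e1
    change _ = _ + ∑ j, (∑ i, pd2 W j i (grad Φ x) * e i) * dd (dd (pd Φ j) (E a)) (E a) x
      + 2 * (τ a * pd2 W a a (grad Φ x)) + _ - _
    linarith [e1]
  · intro p
    have e1 : ∑ a, τ a * (hess (dd (dd Φ (E p)) e) x - (1 / 2 * τ p) • hess (dd Φ (E p)) x) a a
        = ∑ a, τ a * hess (dd (dd Φ (E p)) e) x a a
          - 1 / 2 * τ p * ∑ a, τ a * hess (dd Φ (E p)) x a a := by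
      rw [Finset.mul_sum, ← Finset.sum_sub_distrib]
      exact Finset.sum_congr rfl fun a _ => by
        simp only [Matrix.sub_apply, Matrix.smul_apply, smul_eq_mul]; ring
    rw [trace_mul_diagonal, trace_mul_diagonal_mul_diagonal, s0 e (E p), e1]
    ring
  · intro p
    have e1 := (hline p).1
    have e2 : dd (dd (dd Φ e) e) (E p) x = τ p * e p := by
      rw [s1, s0 e, ← hpdE, hee]
    rw [hQtr, hτ, e2, heE] at e1
    rw [hpdE]
    linear_combination e1
  · intro p
    rfl
  · intro p
    have e1 := (hline p).2
    have hsymA : (hess (dd (dd Φ (E p)) e) x - (1 / 2 * τ p) • hess (dd Φ (E p)) x)ᵀ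
        = hess (dd (dd Φ (E p)) e) x - (1 / 2 * τ p) • hess (dd Φ (E p)) x := by
      rw [transpose_sub, transpose_smul, hsymf, hsymT]
    have e2 : dd (dd (dd (dd Φ e) e) (E p)) (E p) x = hess (dd (dd Φ e) e) x p p := rfl
    have e3 : dd (dd (dd Φ e) (E p)) (E p) x = τ p := by rw [hdiag, diagonal_apply_eq]
    have e4 : dd (dd (dd Φ e) (E p)) (E p) = dd (dd (dd Φ (E p)) (E p)) e := by
      rw [s0 e, s1]
    have e5 : E p ⬝ᵥ E p = 1 := by rw [hEe]; simp [E]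
    rw [hQtr, e2, e3, e4, e5, hτ] at e1
    have t1 : ((hess (dd (dd (dd Φ (E p)) (E p)) e) x
        - (2 * (1 / 2 * τ p)) • hess (dd (dd Φ (E p)) (E p)) x) * diagonal τ).trace
        = ∑ a, τ a * hess (dd (dd (dd Φ (E p)) (E p)) e) x a a
          - ∑ a, τ p * (τ a * hess (dd (dd Φ (E p)) (E p)) x a a) := by
      rw [trace_mul_diagonal, ← Finset.sum_sub_distrib]
      exact Finset.sum_congr rfl fun a _ => by
        simp only [Matrix.sub_apply, Matrix.smul_apply, smul_eq_mul]; ring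
    have t2 : ((hess (dd (dd Φ e) (E p)) x - (1 / 2 * τ p) • hess (dd Φ (E p)) x)
        * (hess (dd (dd Φ e) (E p)) x - (1 / 2 * τ p) • hess (dd Φ (E p)) x)).trace
        = ∑ a, ∑ b, (hess (dd (dd Φ (E p)) e) x a b
          - 1 / 2 * τ p * hess (dd Φ (E p)) x a b) ^ 2 := by
      rw [s0 e, trace_mul_of_symm hsymA]
      exact Finset.sum_congr rfl fun a _ => Finset.sum_congr rfl fun b _ => by
        simp only [Matrix.sub_apply, Matrix.smul_apply, smul_eq_mul]; ring
    have t3 : (hess (dd Φ (E p)) x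
        * (hess (dd (dd Φ e) (E p)) x - (1 / 2 * τ p) • hess (dd Φ (E p)) x) * diagonal τ).trace
        = ∑ a, ∑ b, hess (dd Φ (E p)) x a b * (hess (dd (dd Φ (E p)) e) x a b
          - 1 / 2 * τ p * hess (dd Φ (E p)) x a b) * τ a := by
      rw [s0 e, trace_mul_mul_diagonal _ hsymA]
      rfl
    have t4 : (hess (dd Φ (E p)) x * diagonal τ
        * (hess (dd (dd Φ e) (E p)) x - (1 / 2 * τ p) • hess (dd Φ (E p)) x)).trace
        = ∑ a, ∑ b, hess (dd Φ (E p)) x a b * (hess (dd (dd Φ (E p)) e) x a b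
          - 1 / 2 * τ p * hess (dd Φ (E p)) x a b) * τ a := by
      rw [s0 e, trace_mul_diagonal_mul _ (hsymT _) hsymA]
      rfl
    rw [t1, t2, t3, t4, trace_sq_mul_diagonal_mul_diagonal _ (hsymT _),
      trace_mul_diagonal_mul_diagonal (hess (dd (dd Φ (E p)) (E p)) x),
      trace_mul_diagonal_sq _ (hsymT _)] at e1
    simp only [hpdE, pd2]
    refine le_of_eq_of_le ?_ e1
    ring
  · intro j
    have e1 := hmax.self_of_nhds
    simp only [hx, inv_one, Matrix.one_mul, Matrix.mul_one, one_mulVec] at e1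
    have e2 : ∀ r : ℝ, r * (2 * (Q * e j - ∑ a, τ a * hess (dd Φ (E j)) x a a))
        + r ^ 2 * ((hess (dd Φ (E j)) x * hess (dd Φ (E j)) x).trace - Q) ≤ 0 := by
      intro r
      have e3 := e1 (e - r • E j)
      rw [hess_dd_sub_smul h3, hτ] at e3
      simp only [Matrix.sub_mul, Matrix.mul_sub, trace_sub, Matrix.smul_mul, Matrix.mul_smul,
        trace_smul, smul_eq_mul, trace_mul_comm (diagonal τ) (hess (dd Φ (E j)) x),
        trace_mul_diagonal, sub_dotProduct, dotProduct_sub, smul_dotProduct, dotProduct_smul, he,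
        hEe, heE] at e3
      have e4 : ∑ a, τ a * diagonal τ a a = Q := by
        rw [hQ]
        exact Finset.sum_congr rfl fun a _ => by rw [diagonal_apply_eq, sq]
      have e5 : E j j = 1 := by simp [E]
      rw [e4, Pi.sub_apply, Pi.smul_apply, e5, smul_eq_mul] at e3
      refine nonpos_of_mul_nonpos_right ?_ hηx
      linarith [e3]
    have := eq_zero_of_forall_mul_add_sq_le e2
    linarith
  · intro p a
    simp only [hE]
    rw [s2 (E p) (E p) e (E a), s1 (E p) (E p) (E a), s0 (E p) (E a), s3 (E a) (E p) (E p) e (E a),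
      s2 (E a) (E p) (E p) (E a), s1 (E a) (E p) (E a), s3 (E a) (E a) (E p) (E p) e,
      s2 (E a) (E a) (E p) e]

end ThirdOrder

section AffineChange

variable {n : ℕ} {f : (Fin n → ℝ) → ℝ} (P : Matrix (Fin n) (Fin n) ℝ) (a : Fin n → ℝ)

lemma contDiff_comp_affine {k : WithTop ℕ∞} (hf : ContDiff ℝ k f) :
    ContDiff ℝ k fun y => f (a + P *ᵥ y) :=
  hf.comp (contDiff_const.add (LinearMap.toContinuousLinearMap (Matrix.toLin' P)).contDiff)

lemma dd_comp_affine (hf : Differentiable ℝ f) (v : Fin n → ℝ) :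
    dd (fun y => f (a + P *ᵥ y)) v = fun y => dd f (P *ᵥ v) (a + P *ᵥ y) := by
  funext y
  have h1 : HasFDerivAt (fun y => a + P *ᵥ y)
      (LinearMap.toContinuousLinearMap (Matrix.toLin' P)) y :=
    ((LinearMap.toContinuousLinearMap (Matrix.toLin' P)).hasFDerivAt).const_add a
  have h2 := (hf (a + P *ᵥ y)).hasFDerivAt.comp y h1
  change fderiv ℝ (f ∘ fun y => a + P *ᵥ y) y v = _
  rw [h2.fderiv]
  rfl

lemma grad_comp_affine (hf : Differentiable ℝ f) (y : Fin n → ℝ) :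
    grad (fun y => f (a + P *ᵥ y)) y = Pᵀ *ᵥ grad f (a + P *ᵥ y) := by
  funext i
  change dd (fun y => f (a + P *ᵥ y)) (Pi.single i 1) y = _
  rw [dd_comp_affine P a hf]
  change fderiv ℝ f _ _ = _
  rw [fderiv_eq_sum, mulVec_single_one]
  rfl

lemma hess_comp_affine (hf : ContDiff ℝ 2 f) (y : Fin n → ℝ) :
    hess (fun y => f (a + P *ᵥ y)) y = Pᵀ * hess f (a + P *ᵥ y) * P := by
  ext i j
  change dd (dd (fun y => f (a + P *ᵥ y)) (Pi.single i 1)) (Pi.single j 1) y = _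
  rw [dd_comp_affine P a (hf.differentiable (by norm_num)), dd_comp_affine P a
    ((contDiff_dd hf (m := 1) (by norm_num) _).differentiable (by norm_num))]
  beta_reduce
  rw [dd_dd_eq hf, mulVec_single_one, mulVec_single_one, Matrix.mul_assoc, Matrix.mul_apply]
  simp only [dotProduct, mulVec, Matrix.mul_apply, col_apply, transpose_apply]

lemma hess_dd_comp_affine (hf : ContDiff ℝ 3 f) (v y : Fin n → ℝ) :
    hess (dd (fun y => f (a + P *ᵥ y)) v) y = Pᵀ * hess (dd f (P *ᵥ v)) (a + P *ᵥ y) * P := by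
  rw [dd_comp_affine P a (hf.differentiable (by norm_num)),
    hess_comp_affine P a (contDiff_dd hf (by norm_num) _)]

lemma dirHess_comp_affine (hf : ContDiff ℝ 3 f) (v y : Fin n → ℝ) :
    dirHess (fun y => f (a + P *ᵥ y)) v y = Pᵀ * dirHess f (P *ᵥ v) (a + P *ᵥ y) * P := by
  rw [dirHess_eq_hess_dd (contDiff_comp_affine P a hf), dirHess_eq_hess_dd hf,
    hess_dd_comp_affine P a hf]

lemma dirHess_transpose (hf : ContDiff ℝ 3 f) (v y : Fin n → ℝ) :
    (dirHess f v y)ᵀ = dirHess f v y := by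
  rw [dirHess_eq_hess_dd hf, hess_transpose (contDiff_dd hf (by norm_num) v)]

end AffineChange

section QuadraticForms

variable {n : ℕ} {A : Matrix (Fin n) (Fin n) ℝ} {k : ℝ}

lemma mul_dotProduct_self_le (h : (A - k • 1).PosSemidef) (v : Fin n → ℝ) :
    k * (v ⬝ᵥ v) ≤ v ⬝ᵥ A *ᵥ v := by
  have := h.dotProduct_mulVec_nonneg v
  simp only [star_trivial, sub_mulVec, smul_mulVec, one_mulVec, dotProduct_sub, dotProduct_smul,
    smul_eq_mul] at this
  linarith

lemma dotProduct_mulVec_le (h : (k • 1 - A).PosSemidef) (v : Fin n → ℝ) :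
    v ⬝ᵥ A *ᵥ v ≤ k * (v ⬝ᵥ v) := by
  have := h.dotProduct_mulVec_nonneg v
  simp only [star_trivial, sub_mulVec, smul_mulVec, one_mulVec, dotProduct_sub, dotProduct_smul,
    smul_eq_mul] at this
  linarith

/-- `|A v|² ≤ k ⟨A v, v⟩` for `0 ≤ A ≤ k`. -/
lemma mulVec_dotProduct_mulVec_le (hA : A.PosSemidef) (hk : 0 < k) (h : (k • 1 - A).PosSemidef)
    (v : Fin n → ℝ) : A *ᵥ v ⬝ᵥ A *ᵥ v ≤ k * (v ⬝ᵥ A *ᵥ v) := by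
  have hs : Aᵀ = A := hA.1
  have h1 := hA.dotProduct_mulVec_nonneg (k⁻¹ • A *ᵥ v - v)
  have h2 := dotProduct_mulVec_le h (A *ᵥ v)
  have h3 : v ⬝ᵥ A *ᵥ A *ᵥ v = A *ᵥ v ⬝ᵥ A *ᵥ v := by
    rw [dotProduct_mulVec, ← mulVec_transpose, hs]
  simp only [star_trivial, mulVec_sub, mulVec_smul, sub_dotProduct, dotProduct_sub,
    smul_dotProduct, dotProduct_smul, smul_eq_mul, h3] at h1
  have h4 : k⁻¹ * (k⁻¹ * (A *ᵥ v ⬝ᵥ A *ᵥ A *ᵥ v)) ≤ k⁻¹ * (A *ᵥ v ⬝ᵥ A *ᵥ v) := by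
    gcongr
    rwa [inv_mul_le_iff₀ hk]
  have h5 : k⁻¹ * (A *ᵥ v ⬝ᵥ A *ᵥ v) ≤ v ⬝ᵥ A *ᵥ v := by linarith
  rwa [inv_mul_le_iff₀ hk] at h5

lemma sum_sq_diag_le_trace (hA : Aᵀ = A) : ∑ a, A a a ^ 2 ≤ (A * A).trace := by
  rw [trace_mul_of_symm hA]
  refine Finset.sum_le_sum fun a _ => ?_
  rw [sq]
  exact Finset.single_le_sum (f := fun b => A a b * A a b) (fun b _ => mul_self_nonneg _)
    (Finset.mem_univ a)

lemma dirHess_smul (F : (Fin n → ℝ) → ℝ) (r : ℝ) (u x : Fin n → ℝ) :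
    dirHess F (r • u) x = r • dirHess F u x := by
  ext i j
  simp [dirHess, Finset.mul_sum, mul_assoc]

/-- A bound on `Tr[(∂_e D²F)²]` for unit vectors scales quadratically. -/
lemma trace_dirHess_sq_le {F : (Fin n → ℝ) → ℝ} {B : ℝ} {x : Fin n → ℝ}
    (h : ∀ e : Fin n → ℝ, (∑ k, e k ^ 2) = 1 → (dirHess F e x * dirHess F e x).trace ≤ B)
    (u : Fin n → ℝ) : (dirHess F u x * dirHess F u x).trace ≤ (u ⬝ᵥ u) * B := by
  rcases eq_or_ne u 0 with rfl | hu
  · have := dirHess_smul F 0 0 x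
    rw [zero_smul, zero_smul] at this
    simp [this]
  · have hpos : 0 < u ⬝ᵥ u := by
      refine lt_of_le_of_ne (dotProduct_self_nonneg u) fun h0 => hu ?_
      exact dotProduct_self_eq_zero.mp h0.symm
    have hs : 0 < Real.sqrt (u ⬝ᵥ u) := Real.sqrt_pos.mpr hpos
    have h1 := h ((Real.sqrt (u ⬝ᵥ u))⁻¹ • u) (by
      simp only [Pi.smul_apply, smul_eq_mul, mul_pow, ← Finset.mul_sum, inv_pow,
        Real.sq_sqrt hpos.le]
      rw [show ∑ i, u i ^ 2 = u ⬝ᵥ u by simp [dotProduct, sq], inv_mul_cancel₀ hpos.ne'])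
    rw [dirHess_smul, Matrix.smul_mul, Matrix.mul_smul, trace_smul, trace_smul, smul_eq_mul, smul_eq_mul,
      ← mul_assoc, ← mul_inv, Real.mul_self_sqrt hpos.le, inv_mul_le_iff₀ hpos] at h1
    exact h1

end QuadraticForms

section MaximumPoint

variable {n : ℕ}

/-- The Calabi-type contraction `Tr[(A⁻¹ T)²]` is invariant under congruence. -/
lemma trace_inv_congr {P : Matrix (Fin n) (Fin n) ℝ} (hP : IsUnit P.det)
    (A T : Matrix (Fin n) (Fin n) ℝ) :
    ((Pᵀ * A * P)⁻¹ * (Pᵀ * T * P) * (Pᵀ * A * P)⁻¹ * (Pᵀ * T * P)).trace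
      = (A⁻¹ * T * A⁻¹ * T).trace := by
  have hPT : IsUnit Pᵀ.det := by rwa [det_transpose]
  have h1 : (Pᵀ * A * P)⁻¹ * (Pᵀ * T * P) = P⁻¹ * (A⁻¹ * T * P) := by
    rw [Matrix.mul_inv_rev, Matrix.mul_inv_rev]
    calc P⁻¹ * (A⁻¹ * Pᵀ⁻¹) * (Pᵀ * T * P) = P⁻¹ * A⁻¹ * (Pᵀ⁻¹ * Pᵀ) * T * P := by
          simp only [Matrix.mul_assoc]
      _ = _ := by rw [nonsing_inv_mul _ hPT, Matrix.mul_one]; simp only [Matrix.mul_assoc]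
  rw [Matrix.mul_assoc _ _ (Pᵀ * T * P), h1]
  calc (P⁻¹ * (A⁻¹ * T * P) * (P⁻¹ * (A⁻¹ * T * P))).trace
      = (P⁻¹ * (A⁻¹ * T * (P * P⁻¹) * (A⁻¹ * T * P))).trace := by simp only [Matrix.mul_assoc]
    _ = _ := by
        rw [mul_nonsing_inv _ hP, Matrix.mul_one, trace_mul_comm]
        simp only [Matrix.mul_assoc, mul_nonsing_inv _ hP, Matrix.mul_one]

lemma dotProduct_mulVec_congr (P A : Matrix (Fin n) (Fin n) ℝ) (u : Fin n → ℝ) :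
    u ⬝ᵥ (Pᵀ * A * P) *ᵥ u = (P *ᵥ u) ⬝ᵥ A *ᵥ (P *ᵥ u) := by
  rw [Matrix.mul_assoc, ← mulVec_mulVec, dotProduct_mulVec, vecMul_transpose, ← mulVec_mulVec]

variable {Φ V W η : (Fin n → ℝ) → ℝ}

/-- The third order inequality at a maximum point, in coordinates adapted to that point by `P`. -/
lemma third_order_inequality_congr (hΦ : ContDiff ℝ 5 Φ) (hpos : ∀ x, (hess Φ x).PosDef)
    (hV : ContDiff ℝ 3 V) (hW : ContDiff ℝ 3 W) (hη : ContDiff ℝ 2 η)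
    (hdet : ∀ x, Real.log (hess Φ x).det = W (grad Φ x) - V x)
    {x e τ : Fin n → ℝ} {P R : Matrix (Fin n) (Fin n) ℝ} (hPR : R * Pᵀ = 1)
    (hP : IsUnit P.det) (hPA : Pᵀ * hess Φ x * P = 1) (he : e ⬝ᵥ hess Φ x *ᵥ e = 1)
    (hPS : Pᵀ * hess (dd Φ e) x * P = diagonal τ) (hηx : 0 < η x) {Q : ℝ}
    (hQ : Q = ∑ p, τ p ^ 2)
    (hmax : ∀ᶠ y in nhds x, ∀ u, η y * ((hess Φ y)⁻¹ * hess (dd Φ u) y * (hess Φ y)⁻¹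
      * hess (dd Φ u) y).trace ≤ η x * Q * (u ⬝ᵥ hess Φ y *ᵥ u)) :
    η x * (1 / 2 * Q ^ 2 + Q * ((Rᵀ *ᵥ e) ⬝ᵥ (Rᵀ * hess W (grad Φ x) * R) *ᵥ (Rᵀ *ᵥ e)
          + (Rᵀ *ᵥ e) ⬝ᵥ (Pᵀ * hess V x * P) *ᵥ (Rᵀ *ᵥ e))
        + 2 * ∑ a, τ a ^ 2 * ((Rᵀ * hess W (grad Φ x) * R) a a + (Pᵀ * hess V x * P) a a)
        + 2 * ∑ a, τ a * ((Rᵀ * dirHess W (R *ᵥ (Rᵀ *ᵥ e)) (grad Φ x) * R) a a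
          - (Pᵀ * dirHess V e x * P) a a))
      - 2 * Q / η x * ∑ p, (Pᵀ *ᵥ grad η x) p ^ 2
      + Q * ((Pᵀ * hess η x * P).trace
        - (Rᵀ *ᵥ grad W (grad Φ x)) ⬝ᵥ (Pᵀ *ᵥ grad η x)) ≤ 0 := by
  have h3 : ContDiff ℝ 3 Φ := hΦ.of_le (by norm_num)
  have h2 : ContDiff ℝ 2 Φ := hΦ.of_le (by norm_num)
  have hW2 : ContDiff ℝ 2 W := hW.of_le (by norm_num)
  have hV2 : ContDiff ℝ 2 V := hV.of_le (by norm_num)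
  have hPR' : P * Rᵀ = 1 := by
    have := congrArg Matrix.transpose hPR
    rwa [transpose_mul, transpose_transpose, transpose_one] at this
  have hPe : P *ᵥ (Rᵀ *ᵥ e) = e := by rw [mulVec_mulVec, hPR', one_mulVec]
  have hd : Differentiable ℝ Φ := h2.differentiable (by norm_num)
  have hgrad : ∀ y, 0 + R *ᵥ grad (fun y => Φ (x + P *ᵥ y)) y = grad Φ (x + P *ᵥ y) := fun y => by
    rw [zero_add, grad_comp_affine P x hd, mulVec_mulVec, hPR, one_mulVec]
  have hgrad0 : 0 + R *ᵥ grad (fun y => Φ (x + P *ᵥ y)) 0 = grad Φ x := by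
    rw [hgrad, mulVec_zero, add_zero]
  have hx0 : x + P *ᵥ 0 = x := by rw [mulVec_zero, add_zero]
  have hdetP : P.det ≠ 0 := hP.ne_zero
  have key := third_order_inequality (Φ := fun y => Φ (x + P *ᵥ y))
    (V := fun y => V (x + P *ᵥ y)) (W := fun y => W (0 + R *ᵥ y)) (η := fun y => η (x + P *ᵥ y))
    (κ := Real.log (P.det ^ 2)) (x := 0) (e := Rᵀ *ᵥ e) (τ := τ) (Q := Q)
    (contDiff_comp_affine P x hΦ) ?_ (contDiff_comp_affine P x hV) (contDiff_comp_affine R 0 hW)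
    (contDiff_comp_affine P x hη) ?_ ?_ ?_ ?_ ?_ hQ ?_
  · rw [hess_comp_affine R 0 hW2, hess_comp_affine P x hV2, dirHess_comp_affine R 0 hW,
      dirHess_comp_affine P x hV, hPe, hgrad0, hx0] at key
    have e1 : ∀ p, pd (fun y => η (x + P *ᵥ y)) p 0 = (Pᵀ *ᵥ grad η x) p := fun p => by
      have := congrFun (grad_comp_affine P x (hη.differentiable (by norm_num)) 0) p
      rwa [hx0] at this
    have e2 : ∀ p, pd (fun y => W (0 + R *ᵥ y)) p (grad (fun y => Φ (x + P *ᵥ y)) 0)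
        = (Rᵀ *ᵥ grad W (grad Φ x)) p := fun p => by
      have := congrFun (grad_comp_affine R 0 (hW.differentiable (by norm_num))
        (grad (fun y => Φ (x + P *ᵥ y)) 0)) p
      rwa [hgrad0] at this
    have e3 : ∑ p, pd2 (fun y => η (x + P *ᵥ y)) p p 0 = (Pᵀ * hess η x * P).trace := by
      have := congrArg Matrix.trace (hess_comp_affine P x hη 0)
      rwa [hx0] at this
    simp only [e1, e2, e3] at key
    exact key
  · intro y
    rw [hess_comp_affine P x h2]
    have := (hpos (x + P *ᵥ y)).conjTranspose_mul_mul_same (B := P)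
      (mulVec_injective_iff_isUnit.mpr ((isUnit_iff_isUnit_det P).mpr hP))
    rwa [conjTranspose_eq_transpose_of_trivial] at this
  · intro y
    rw [hgrad, hess_comp_affine P x h2, det_mul, det_mul, det_transpose, ← hdet,
      show P.det * (hess Φ (x + P *ᵥ y)).det * P.det = (hess Φ (x + P *ᵥ y)).det * P.det ^ 2 by ring,
      Real.log_mul (hpos _).det_pos.ne' (pow_ne_zero 2 hdetP)]
  · rw [hess_comp_affine P x h2, hx0, hPA]
  · have h1 : e ⬝ᵥ hess Φ x *ᵥ e
        = (P *ᵥ (Rᵀ *ᵥ e)) ⬝ᵥ hess Φ x *ᵥ (P *ᵥ (Rᵀ *ᵥ e)) := by rw [hPe]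
    rw [he] at h1
    rw [h1, ← dotProduct_mulVec_congr, hPA, one_mulVec]
  · rw [hess_dd_comp_affine P x h3, hPe, hx0, hPS]
  · rwa [hx0]
  · have hc : Continuous fun y : Fin n → ℝ => x + P *ᵥ y := by fun_prop
    have ht : Tendsto (fun y : Fin n → ℝ => x + P *ᵥ y) (nhds 0) (nhds x) := by
      have := hc.tendsto 0
      rwa [hx0] at this
    filter_upwards [ht.eventually hmax] with y hy u
    rw [hess_comp_affine P x h2, hess_dd_comp_affine P x h3, trace_inv_congr hP, hx0,
      dotProduct_mulVec_congr]
    exact hy _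

end MaximumPoint

section MaximumPointBound

variable {n : ℕ}

lemma dotProduct_single_mulVec_single (A : Matrix (Fin n) (Fin n) ℝ) (a : Fin n) :
    Pi.single a 1 ⬝ᵥ A *ᵥ Pi.single a 1 = A a a := by
  rw [mulVec_single_one, single_dotProduct, one_mul, col_apply]

lemma trace_congr_mul_self (P S : Matrix (Fin n) (Fin n) ℝ) :
    ((Pᵀ * S * P) * (Pᵀ * S * P)).trace = ((P * Pᵀ) * S * (P * Pᵀ) * S).trace := by
  rw [show (Pᵀ * S * P) * (Pᵀ * S * P) = (Pᵀ * S * P * Pᵀ * S) * P by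
    simp only [Matrix.mul_assoc], trace_mul_comm]
  simp only [Matrix.mul_assoc]

lemma sum_sq_diag_congr_le {P S : Matrix (Fin n) (Fin n) ℝ} {k : ℝ} (hk : 0 ≤ k)
    (hP : (k • (1 : Matrix (Fin n) (Fin n) ℝ) - P * Pᵀ).PosSemidef) (hS : Sᵀ = S) :
    ∑ a, (Pᵀ * S * P) a a ^ 2 ≤ k ^ 2 * (S * S).trace := by
  refine (sum_sq_diag_le_trace (A := Pᵀ * S * P) ?_).trans ?_
  · rw [transpose_mul, transpose_mul, transpose_transpose, hS, Matrix.mul_assoc]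
  · rw [trace_congr_mul_self]
    refine trace_conj_sq_le hk ?_ hP hS
    have := posSemidef_self_mul_conjTranspose P
    rwa [conjTranspose_eq_transpose_of_trivial] at this

variable {Φ V W η : (Fin n → ℝ) → ℝ} {c Λ B : ℝ}

/-- The third order inequality at a maximum point of `η · Tr[(h⁻¹ ∂_e h)²] / ⟨h e, e⟩`,
where `h = D²Φ` is comparable to the identity. -/
lemma third_order_bound (hΦ : ContDiff ℝ 5 Φ) (hpos : ∀ x, (hess Φ x).PosDef)
    (hV : ContDiff ℝ 3 V) (hW : ContDiff ℝ 3 W) (hη : ContDiff ℝ 2 η)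
    (hdet : ∀ x, Real.log (hess Φ x).det = W (grad Φ x) - V x)
    (hc : 0 < c) (hΛ : 0 < Λ) (hB : 0 ≤ B) {x e : Fin n → ℝ}
    (hle : (Λ • (1 : Matrix (Fin n) (Fin n) ℝ) - hess Φ x).PosSemidef)
    (hge : (hess Φ x - Λ⁻¹ • (1 : Matrix (Fin n) (Fin n) ℝ)).PosSemidef)
    (hVc : (hess V x - c • (1 : Matrix (Fin n) (Fin n) ℝ)).PosSemidef)
    (hWc : (hess W (grad Φ x)).PosSemidef)
    (hV3 : ∀ e : Fin n → ℝ, (∑ k, e k ^ 2) = 1 → (dirHess V e x * dirHess V e x).trace ≤ B)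
    (hW3 : ∀ e : Fin n → ℝ, (∑ k, e k ^ 2) = 1 →
      (dirHess W e (grad Φ x) * dirHess W e (grad Φ x)).trace ≤ B)
    (he : e ⬝ᵥ hess Φ x *ᵥ e = 1) (hηx : 0 < η x) {Q : ℝ}
    (hQ : Q = ((hess Φ x)⁻¹ * hess (dd Φ e) x * (hess Φ x)⁻¹ * hess (dd Φ e) x).trace)
    (hmax : ∀ᶠ y in nhds x, ∀ u, η y * ((hess Φ y)⁻¹ * hess (dd Φ u) y * (hess Φ y)⁻¹
      * hess (dd Φ u) y).trace ≤ η x * Q * (u ⬝ᵥ hess Φ y *ᵥ u)) :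
    η x * (1 / 2 * Q ^ 2 + c / Λ * Q - 2 * Λ ^ 3 * B / (c / Λ))
      - 2 * Q / η x * (grad η x ⬝ᵥ (hess Φ x)⁻¹ *ᵥ grad η x)
      + Q * (((hess Φ x)⁻¹ * hess η x).trace - grad W (grad Φ x) ⬝ᵥ grad η x) ≤ 0 := by
  have h3 : ContDiff ℝ 3 Φ := hΦ.of_le (by norm_num)
  obtain ⟨P, τ, hP, hPA, hPS⟩ := exists_congruence_one_diagonal (hpos x)
    (hess_transpose (contDiff_dd h3 (m := 2) (by norm_num) e) x)
  have hPP := mul_transpose_eq_inv hPA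
  obtain ⟨R, hPR⟩ : ∃ R : Matrix (Fin n) (Fin n) ℝ, R * Pᵀ = 1 :=
    ⟨Pᵀ⁻¹, nonsing_inv_mul _ (by rwa [det_transpose])⟩
  have hPR' : P * Rᵀ = 1 := by
    have := congrArg Matrix.transpose hPR
    rwa [transpose_mul, transpose_transpose, transpose_one] at this
  have hRR : R * Rᵀ = hess Φ x := by
    calc R * Rᵀ = R * (Pᵀ * hess Φ x * P) * Rᵀ := by rw [hPA, Matrix.mul_one]
      _ = (R * Pᵀ) * hess Φ x * (P * Rᵀ) := by simp only [Matrix.mul_assoc]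
      _ = hess Φ x := by rw [hPR, hPR', Matrix.one_mul, Matrix.mul_one]
  have hPe : P *ᵥ (Rᵀ *ᵥ e) = e := by rw [mulVec_mulVec, hPR', one_mulVec]
  have hQτ : Q = ∑ p, τ p ^ 2 := by
    rw [hQ, ← trace_inv_congr hP, hPA, hPS, inv_one, Matrix.one_mul, Matrix.mul_one,
      diagonal_mul_diagonal, trace_diagonal]
    simp only [sq]
  have key := third_order_inequality_congr hΦ hpos hV hW hη hdet hPR hP hPA he hPS hηx hQτ hmax
  set a := c / Λ with ha
  have ha0 : 0 < a := div_pos hc hΛ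
  have hQ0 : 0 ≤ Q := hQτ ▸ Finset.sum_nonneg fun p _ => sq_nonneg _
  have hVa : ∀ u : Fin n → ℝ, u ⬝ᵥ hess Φ x *ᵥ u = 1 → a ≤ u ⬝ᵥ hess V x *ᵥ u := by
    intro u hu
    have h1 := mul_dotProduct_self_le hVc u
    have h2 := dotProduct_mulVec_le hle u
    rw [hu] at h2
    refine le_trans ?_ h1
    rw [ha, div_le_iff₀ hΛ]
    nlinarith
  have t1 : 0 ≤ (Rᵀ *ᵥ e) ⬝ᵥ (Rᵀ * hess W (grad Φ x) * R) *ᵥ (Rᵀ *ᵥ e) := by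
    rw [dotProduct_mulVec_congr]
    exact hWc.dotProduct_mulVec_nonneg _
  have t2 : a ≤ (Rᵀ *ᵥ e) ⬝ᵥ (Pᵀ * hess V x * P) *ᵥ (Rᵀ *ᵥ e) := by
    rw [dotProduct_mulVec_congr, hPe]
    exact hVa e he
  have t3 : ∀ i, a ≤ (Rᵀ * hess W (grad Φ x) * R) i i + (Pᵀ * hess V x * P) i i := by
    intro i
    rw [← dotProduct_single_mulVec_single (Rᵀ * hess W (grad Φ x) * R),
      ← dotProduct_single_mulVec_single (Pᵀ * hess V x * P),
      dotProduct_mulVec_congr, dotProduct_mulVec_congr]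
    have h1 := hWc.dotProduct_mulVec_nonneg (R *ᵥ Pi.single i 1)
    rw [star_trivial] at h1
    have h2 := hVa (P *ᵥ Pi.single i 1) (by
      rw [← dotProduct_mulVec_congr, hPA, dotProduct_single_mulVec_single, one_apply_eq])
    linarith
  have hee : e ⬝ᵥ e ≤ Λ := by
    have h1 := mul_dotProduct_self_le hge e
    rwa [he, inv_mul_le_iff₀ hΛ, mul_one] at h1
  have t4 : ∑ i, (Pᵀ * dirHess V e x * P) i i ^ 2 ≤ Λ ^ 3 * B := by
    have h1 := sum_sq_diag_congr_le hΛ.le (P := P) (S := dirHess V e x)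
      (hPP ▸ inv_le_of_le hΛ (hpos x) hge) (dirHess_transpose hV e x)
    have h2 := trace_dirHess_sq_le hV3 e
    calc _ ≤ Λ ^ 2 * (Λ * B) := h1.trans (by
            gcongr
            exact h2.trans (by gcongr))
      _ = _ := by ring
  have t5 : ∑ i, (Rᵀ * dirHess W (R *ᵥ (Rᵀ *ᵥ e)) (grad Φ x) * R) i i ^ 2 ≤ Λ ^ 3 * B := by
    rw [mulVec_mulVec, hRR]
    have h1 := sum_sq_diag_congr_le hΛ.le (P := R) (S := dirHess W (hess Φ x *ᵥ e) (grad Φ x))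
      (hRR ▸ hle) (dirHess_transpose hW _ _)
    have h2 := trace_dirHess_sq_le hW3 (hess Φ x *ᵥ e)
    have h4 := mulVec_dotProduct_mulVec_le (hpos x).posSemidef hΛ hle e
    rw [he, mul_one] at h4
    calc _ ≤ Λ ^ 2 * (Λ * B) := h1.trans (by
            gcongr
            exact h2.trans (by gcongr))
      _ = _ := by ring
  have t6 : -(2 * Λ ^ 3 * B / a)
      ≤ 2 * ∑ i, τ i ^ 2 * ((Rᵀ * hess W (grad Φ x) * R) i i + (Pᵀ * hess V x * P) i i)
        + 2 * ∑ i, τ i * ((Rᵀ * dirHess W (R *ᵥ (Rᵀ *ᵥ e)) (grad Φ x) * R) i i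
          - (Pᵀ * dirHess V e x * P) i i) := by
    have h1 : ∀ i, -((Rᵀ * dirHess W (R *ᵥ (Rᵀ *ᵥ e)) (grad Φ x) * R) i i ^ 2
          + (Pᵀ * dirHess V e x * P) i i ^ 2) / a
        ≤ 2 * (τ i ^ 2 * ((Rᵀ * hess W (grad Φ x) * R) i i + (Pᵀ * hess V x * P) i i))
          + 2 * (τ i * ((Rᵀ * dirHess W (R *ᵥ (Rᵀ *ᵥ e)) (grad Φ x) * R) i i
          - (Pᵀ * dirHess V e x * P) i i)) := by
      intro i
      have h2 := mul_le_mul_of_nonneg_left (t3 i) (sq_nonneg (τ i))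
      generalize (Rᵀ * dirHess W (R *ᵥ (Rᵀ *ᵥ e)) (grad Φ x) * R) i i = w
      generalize (Pᵀ * dirHess V e x * P) i i = v
      rw [div_le_iff₀ ha0]
      have h5 := mul_le_mul_of_nonneg_right h2 ha0.le
      nlinarith [sq_nonneg (a * τ i + w), sq_nonneg (a * τ i - v)]
    have h2 := Finset.sum_le_sum fun i (_ : i ∈ Finset.univ) => h1 i
    rw [← Finset.sum_div, Finset.sum_neg_distrib, Finset.sum_add_distrib, Finset.sum_add_distrib,
      ← Finset.mul_sum, ← Finset.mul_sum] at h2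
    refine le_trans ?_ h2
    rw [← neg_div, div_le_div_iff_of_pos_right ha0]
    linarith
  have e1 : ∑ p, (Pᵀ *ᵥ grad η x) p ^ 2 = grad η x ⬝ᵥ (hess Φ x)⁻¹ *ᵥ grad η x := by
    rw [← hPP, ← mulVec_mulVec, dotProduct_mulVec, ← mulVec_transpose]
    simp only [dotProduct, sq]
  have e2 : (Pᵀ * hess η x * P).trace = ((hess Φ x)⁻¹ * hess η x).trace := by
    rw [← hPP, trace_mul_comm, ← Matrix.mul_assoc]
  have e3 : (Rᵀ *ᵥ grad W (grad Φ x)) ⬝ᵥ (Pᵀ *ᵥ grad η x) = grad W (grad Φ x) ⬝ᵥ grad η x := by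
    rw [dotProduct_mulVec, vecMul_transpose, mulVec_mulVec, hPR', one_mulVec]
  rw [e1, e2, e3] at key
  refine le_trans ?_ key
  gcongr
  have t7 := mul_le_mul_of_nonneg_left (add_le_add t1 t2) hQ0
  linarith

end MaximumPointBound

section Cutoff

variable {n : ℕ} {Φ W : (Fin n → ℝ) → ℝ} {m R : ℝ}

/-- A cutoff function adapted to the sublevel set `{Φ ≤ m + R}`. -/
def cutoff (Φ : (Fin n → ℝ) → ℝ) (m R : ℝ) (x : Fin n → ℝ) : ℝ := (1 - (Φ x - m) / R) ^ 2

lemma contDiff_cutoff {k : WithTop ℕ∞} (hΦ : ContDiff ℝ k Φ) (m R : ℝ) :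
    ContDiff ℝ k (cutoff Φ m R) :=
  (contDiff_const.sub ((hΦ.sub contDiff_const).div_const R)).pow 2

lemma pd_cutoff (hΦ : Differentiable ℝ Φ) (i : Fin n) :
    pd (cutoff Φ m R) i = fun x => -(2 / R) * (1 - (Φ x - m) / R) * pd Φ i x := by
  funext x
  have h1 : HasFDerivAt (cutoff Φ m R) _ x :=
    (((hΦ x).hasFDerivAt.sub_const m).mul_const R⁻¹ |>.const_sub 1).pow 2
  rw [pd, h1.fderiv]
  simp [pd]
  ring

lemma grad_cutoff (hΦ : Differentiable ℝ Φ) (x : Fin n → ℝ) :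
    grad (cutoff Φ m R) x = (-(2 / R) * (1 - (Φ x - m) / R)) • grad Φ x := by
  funext i
  exact congrFun (pd_cutoff hΦ i) x

lemma hess_cutoff (hΦ : ContDiff ℝ 2 Φ) (x : Fin n → ℝ) :
    hess (cutoff Φ m R) x = (2 / R ^ 2) • vecMulVec (grad Φ x) (grad Φ x)
      - (2 / R * (1 - (Φ x - m) / R)) • hess Φ x := by
  have hd : Differentiable ℝ Φ := hΦ.differentiable (by norm_num)
  ext i j
  change pd (pd (cutoff Φ m R) i) j x = _
  rw [pd_cutoff hd]
  have hdi : Differentiable ℝ (pd Φ i) :=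
    (contDiff_pd hΦ (m := 1) (by norm_num) i).differentiable (by norm_num)
  have h1 := ((((hd x).hasFDerivAt.sub_const m).mul_const R⁻¹ |>.const_sub 1).const_mul
    (-(2 / R))).mul (hdi x).hasFDerivAt
  have h2 : HasFDerivAt (fun x => -(2 / R) * (1 - (Φ x - m) / R) * pd Φ i x) _ x := h1
  rw [pd, h2.fderiv]
  simp [pd2, hess, grad, vecMulVec_apply]
  simp only [pd]
  ring

/-- `|∇Φ|² ≤ 2 Λ (Φ - inf Φ)` when `D²Φ ≤ Λ`. -/
lemma grad_dotProduct_self_le {Λ : ℝ} (hΛ : 0 < Λ) (hΦ : ContDiff ℝ 2 Φ)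
    (hle : ∀ x, (Λ • (1 : Matrix (Fin n) (Fin n) ℝ) - hess Φ x).PosSemidef)
    (hm : ∀ x, m ≤ Φ x) (x : Fin n → ℝ) :
    grad Φ x ⬝ᵥ grad Φ x ≤ 2 * Λ * (Φ x - m) := by
  have h1 := le_add_grad_add hΦ hle x (-Λ⁻¹ • grad Φ x)
  have h2 := hm (x + -Λ⁻¹ • grad Φ x)
  simp only [dotProduct_smul, smul_dotProduct, smul_eq_mul] at h1
  have h3 : Λ / 2 * (-Λ⁻¹ * (-Λ⁻¹ * (grad Φ x ⬝ᵥ grad Φ x)))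
      = 1 / 2 * (Λ⁻¹ * (grad Φ x ⬝ᵥ grad Φ x)) := by
    field_simp
  have h4 : Λ⁻¹ * (grad Φ x ⬝ᵥ grad Φ x) ≤ 2 * (Φ x - m) := by linarith
  rw [inv_mul_le_iff₀ hΛ] at h4
  linarith

/-- The error terms produced by the cutoff function. -/
lemma cutoff_error_le {Λ K : ℝ} (hΛ : 0 < Λ) (hR : 0 < R) (hK : 0 ≤ K) (hΦ : ContDiff ℝ 2 Φ)
    (hpos : ∀ x, (hess Φ x).PosDef)
    (hle : ∀ x, (Λ • (1 : Matrix (Fin n) (Fin n) ℝ) - hess Φ x).PosSemidef)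
    (hge : ∀ x, (hess Φ x - Λ⁻¹ • (1 : Matrix (Fin n) (Fin n) ℝ)).PosSemidef)
    (hW : ∀ y, -K ≤ grad W y ⬝ᵥ y)
    (hm : ∀ x, m ≤ Φ x) {x : Fin n → ℝ} (hx : Φ x - m < R) {Q : ℝ} (hQ : 0 ≤ Q) :
    2 * Q / cutoff Φ m R x
        * (grad (cutoff Φ m R) x ⬝ᵥ (hess Φ x)⁻¹ *ᵥ grad (cutoff Φ m R) x)
      - Q * (((hess Φ x)⁻¹ * hess (cutoff Φ m R) x).trace
        - grad W (grad Φ x) ⬝ᵥ grad (cutoff Φ m R) x)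
      ≤ Q * ((16 * Λ ^ 2 + 2 * n + 2 * K) / R) := by
  have hd : Differentiable ℝ Φ := hΦ.differentiable (by norm_num)
  have hdet : IsUnit (hess Φ x).det := (hpos x).det_pos.ne'.isUnit
  rw [grad_cutoff hd, hess_cutoff hΦ, cutoff]
  set s := 1 - (Φ x - m) / R with hs
  have hs0 : 0 < s := by
    rw [hs, sub_pos, div_lt_one hR]
    exact hx
  have hs1 : s ≤ 1 := by
    have : 0 ≤ (Φ x - m) / R := div_nonneg (by linarith [hm x]) hR.le
    linarith
  set G := grad Φ x ⬝ᵥ (hess Φ x)⁻¹ *ᵥ grad Φ x with hG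
  have hG0 : 0 ≤ G := (hpos x).inv.posSemidef.dotProduct_mulVec_nonneg _
  have hG1 : G ≤ 2 * Λ ^ 2 * R := by
    have h1 := dotProduct_mulVec_le (inv_le_of_le hΛ (hpos x) (hge x)) (grad Φ x)
    have h2 := grad_dotProduct_self_le hΛ hΦ hle hm x
    calc G ≤ Λ * (grad Φ x ⬝ᵥ grad Φ x) := h1
      _ ≤ Λ * (2 * Λ * (Φ x - m)) := by gcongr
      _ ≤ Λ * (2 * Λ * R) := by gcongr
      _ = _ := by ring
  have e1 : ((hess Φ x)⁻¹ * ((2 / R ^ 2) • vecMulVec (grad Φ x) (grad Φ x)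
      - (2 / R * s) • hess Φ x)).trace = 2 / R ^ 2 * G - 2 / R * s * n := by
    rw [Matrix.mul_sub, Matrix.mul_smul, Matrix.mul_smul, nonsing_inv_mul _ hdet, trace_sub,
      trace_smul, trace_smul, mul_vecMulVec, trace_vecMulVec, trace_one, Fintype.card_fin,
      dotProduct_comm]
    rfl
  rw [e1, mulVec_smul, dotProduct_smul, smul_dotProduct, dotProduct_smul, ← hG]
  simp only [smul_eq_mul]
  have hw := hW (grad Φ x)
  set w := grad W (grad Φ x) ⬝ᵥ grad Φ x
  have e2 : 2 * Q / s ^ 2 * (-(2 / R) * s * (-(2 / R) * s * G))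
      - Q * (2 / R ^ 2 * G - 2 / R * s * n - -(2 / R) * s * w)
      = Q * (6 * G / R ^ 2 + 2 * s * n / R + 2 * s * (-w) / R) := by
    field_simp
    ring
  rw [e2]
  refine mul_le_mul_of_nonneg_left ?_ hQ
  have b1 : 6 * G / R ^ 2 ≤ 16 * Λ ^ 2 / R := by
    rw [div_le_div_iff₀ (by positivity) hR]
    nlinarith [mul_le_mul_of_nonneg_right hG1 hR.le, sq_nonneg (Λ * R)]
  have b2 : 2 * s * n / R ≤ 2 * n / R := by
    gcongr
    nlinarith [(Nat.cast_nonneg n : (0 : ℝ) ≤ n)]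
  have b3 : 2 * s * (-w) / R ≤ 2 * K / R := by
    rw [div_le_div_iff_of_pos_right hR]
    nlinarith
  rw [add_div, add_div]
  linarith

/-- The elementary inequality which turns the differential inequality at a maximum point into an
upper bound for the maximum. -/
lemma mul_le_of_quadratic_le {η Q a β k : ℝ} (ha : 0 < a) (hη1 : η ≤ 1)
    (hQ : 0 ≤ Q) (hβ : 0 ≤ β) (hk : 0 ≤ k)
    (h : η * (1 / 2 * Q ^ 2 + a * Q - β) ≤ Q * k) : η * Q ≤ β / a + 2 * k := by
  rcases le_or_gt (η * Q) (2 * k) with h1 | h1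
  · have : 0 ≤ β / a := by positivity
    linarith
  · have h2 : a * (η * Q) ≤ β := by nlinarith
    have h3 : η * Q ≤ β / a := by
      rw [le_div_iff₀ ha]
      linarith
    linarith

end Cutoff

section GlobalEstimate

variable {n : ℕ} {Φ V W : (Fin n → ℝ) → ℝ} {c C B Λ : ℝ}

/-- The scalar `Tr[(h⁻¹ ∂_u h)²]`, where `h = D²Φ`. -/
def cubicNorm (Φ : (Fin n → ℝ) → ℝ) (x u : Fin n → ℝ) : ℝ :=
  ((hess Φ x)⁻¹ * dirHess Φ u x * (hess Φ x)⁻¹ * dirHess Φ u x).trace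

lemma cubicNorm_smul (Φ : (Fin n → ℝ) → ℝ) (x : Fin n → ℝ) (r : ℝ) (u : Fin n → ℝ) :
    cubicNorm Φ x (r • u) = r ^ 2 * cubicNorm Φ x u := by
  simp only [cubicNorm, dirHess_smul, Matrix.mul_smul, Matrix.smul_mul, trace_smul, smul_eq_mul]
  ring

lemma cubicNorm_nonneg (hΦ : ContDiff ℝ 3 Φ) (hpos : ∀ x, (hess Φ x).PosDef) (x u : Fin n → ℝ) :
    0 ≤ cubicNorm Φ x u := by
  have h1 := (hpos x).inv.posSemidef.conjTranspose_mul_mul_same (dirHess Φ u x)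
  rw [conjTranspose_eq_transpose_of_trivial, dirHess_transpose hΦ] at h1
  have h2 := trace_mul_nonneg (hpos x).inv.posSemidef h1
  rw [cubicNorm]
  simpa only [Matrix.mul_assoc] using h2

lemma continuous_hess (hΦ : ContDiff ℝ 2 Φ) : Continuous (hess Φ) :=
  continuous_matrix fun i j => (contDiff_pd (contDiff_pd hΦ (m := 1) (by norm_num) i)
    (m := 0) (by norm_num) j).continuous

lemma continuous_cubicNorm (hΦ : ContDiff ℝ 3 Φ) (hpos : ∀ x, (hess Φ x).PosDef) :
    Continuous fun p : (Fin n → ℝ) × (Fin n → ℝ) => cubicNorm Φ p.1 p.2 := by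
  have h1 : Continuous fun p : (Fin n → ℝ) × (Fin n → ℝ) => hess Φ p.1 :=
    (continuous_hess (hΦ.of_le (by norm_num))).comp continuous_fst
  have h2 : Continuous fun p : (Fin n → ℝ) × (Fin n → ℝ) => (hess Φ p.1)⁻¹ := by
    simp only [Matrix.inv_def, Ring.inverse_eq_inv']
    exact (h1.matrix_det.inv₀ fun p => (hpos p.1).det_pos.ne').smul h1.matrix_adjugate
  have h3 : Continuous fun p : (Fin n → ℝ) × (Fin n → ℝ) => dirHess Φ p.2 p.1 := by
    refine continuous_matrix fun i j => ?_
    have : ∀ k, Continuous (pd3 Φ k i j) := fun k =>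
      (contDiff_pd (contDiff_pd (contDiff_pd hΦ (m := 2) (by norm_num) k) (m := 1)
        (by norm_num) i) (m := 0) (by norm_num) j).continuous
    simp only [dirHess, of_apply]
    fun_prop
  exact (((h2.matrix_mul h3).matrix_mul h2).matrix_mul h3).matrix_trace

/-- The maximum principle estimate on a sublevel set of `Φ`. -/
lemma cutoff_mul_cubicNorm_le (hΦ : ContDiff ℝ 5 Φ) (hpos : ∀ x, (hess Φ x).PosDef)
    (hV : ContDiff ℝ 3 V) (hW : ContDiff ℝ 3 W)
    (hdet : ∀ x, Real.log (hess Φ x).det = W (grad Φ x) - V x)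
    (hc : 0 < c) (hΛ : 0 < Λ) (hB : 0 ≤ B)
    (hle : ∀ x, (Λ • (1 : Matrix (Fin n) (Fin n) ℝ) - hess Φ x).PosSemidef)
    (hge : ∀ x, (hess Φ x - Λ⁻¹ • (1 : Matrix (Fin n) (Fin n) ℝ)).PosSemidef)
    (hVc : ∀ x, (hess V x - c • (1 : Matrix (Fin n) (Fin n) ℝ)).PosSemidef)
    (hWc : ∀ y, (hess W y).PosSemidef)
    (hV3 : ∀ x e : Fin n → ℝ, (∑ k, e k ^ 2) = 1 → (dirHess V e x * dirHess V e x).trace ≤ B)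
    (hW3 : ∀ x e : Fin n → ℝ, (∑ k, e k ^ 2) = 1 → (dirHess W e x * dirHess W e x).trace ≤ B)
    {K m R : ℝ} (hK : 0 ≤ K) (hWK : ∀ y, -K ≤ grad W y ⬝ᵥ y) (hm : ∀ x, m ≤ Φ x) (hR : 0 < R)
    (hcpt : IsCompact {x | Φ x - m ≤ R}) {x u : Fin n → ℝ} (hx : Φ x - m ≤ R) (hu : u ≠ 0) :
    cutoff Φ m R x * cubicNorm Φ x u
      ≤ (2 * Λ ^ 3 * B / (c / Λ) / (c / Λ) + 2 * ((16 * Λ ^ 2 + 2 * n + 2 * K) / R))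
        * (u ⬝ᵥ hess Φ x *ᵥ u) := by
  have h3 : ContDiff ℝ 3 Φ := hΦ.of_le (by norm_num)
  have h2 : ContDiff ℝ 2 Φ := hΦ.of_le (by norm_num)
  have hN : ∀ (y : Fin n → ℝ) {v : Fin n → ℝ}, v ≠ 0 → 0 < v ⬝ᵥ hess Φ y *ᵥ v := fun y v hv => by
    simpa using (hpos y).dotProduct_mulVec_pos hv
  have hNs : ∀ (y v : Fin n → ℝ) (r : ℝ),
      (r • v) ⬝ᵥ hess Φ y *ᵥ (r • v) = r ^ 2 * (v ⬝ᵥ hess Φ y *ᵥ v) := fun y v r => by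
    rw [mulVec_smul, smul_dotProduct, dotProduct_smul, smul_eq_mul, smul_eq_mul]
    ring
  set S : Set ((Fin n → ℝ) × (Fin n → ℝ)) := {x | Φ x - m ≤ R} ×ˢ Metric.sphere 0 1 with hS
  have hSc : IsCompact S := hcpt.prod (isCompact_sphere 0 1)
  have hne : ∀ v ∈ Metric.sphere (0 : Fin n → ℝ) 1, v ≠ 0 := fun v hv h0 => by simp [h0] at hv
  have hcut : Continuous (cutoff Φ m R) := (contDiff_cutoff h2 m R).continuous
  have hcont : ContinuousOn (fun p : (Fin n → ℝ) × (Fin n → ℝ) =>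
      cutoff Φ m R p.1 * cubicNorm Φ p.1 p.2 / (p.2 ⬝ᵥ hess Φ p.1 *ᵥ p.2)) S := by
    refine ContinuousOn.div ?_ ?_ fun p hp => (hN p.1 (hne _ hp.2)).ne'
    · exact ((hcut.comp continuous_fst).mul (continuous_cubicNorm h3 hpos)).continuousOn
    · have := continuous_hess h2
      exact (continuous_snd.dotProduct ((this.comp continuous_fst).matrix_mulVec
        continuous_snd)).continuousOn
  have hmem : ∀ {y v : Fin n → ℝ}, Φ y - m ≤ R → v ≠ 0 → (y, ‖v‖⁻¹ • v) ∈ S := by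
    intro y v hy hv
    refine ⟨hy, ?_⟩
    rw [mem_sphere_zero_iff_norm, norm_smul, norm_inv, norm_norm,
      inv_mul_cancel₀ (norm_ne_zero_iff.mpr hv)]
  obtain ⟨⟨x₀, e₁⟩, hp, hmax⟩ := hSc.exists_isMaxOn ⟨_, hmem hx hu⟩ hcont
  have hN1 : 0 < e₁ ⬝ᵥ hess Φ x₀ *ᵥ e₁ := hN x₀ (hne _ hp.2)
  set Q := cubicNorm Φ x₀ e₁ / (e₁ ⬝ᵥ hess Φ x₀ *ᵥ e₁) with hQ
  have hQ0 : 0 ≤ Q := div_nonneg (cubicNorm_nonneg h3 hpos _ _) hN1.le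
  have hall : ∀ y, Φ y - m ≤ R → ∀ v, cutoff Φ m R y * cubicNorm Φ y v
      ≤ cutoff Φ m R x₀ * Q * (v ⬝ᵥ hess Φ y *ᵥ v) := by
    intro y hy v
    rcases eq_or_ne v 0 with rfl | hv
    · have h1 := cubicNorm_smul Φ y 0 0
      rw [zero_smul, zero_pow two_ne_zero, zero_mul] at h1
      rw [h1, mul_zero, zero_dotProduct, mul_zero]
    · have h1 := hmax (hmem hy hv)
      simp only [Set.mem_ofPred_eq, cubicNorm_smul, hNs] at h1
      have h4 : 0 < ‖v‖⁻¹ ^ 2 := by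
        have := norm_pos_iff.mpr hv
        positivity
      rw [mul_left_comm, mul_div_mul_left _ _ h4.ne', div_le_iff₀ (hN y hv), mul_div_assoc] at h1
      exact h1
  have hbound : cutoff Φ m R x₀ * Q
      ≤ 2 * Λ ^ 3 * B / (c / Λ) / (c / Λ) + 2 * ((16 * Λ ^ 2 + 2 * n + 2 * K) / R) := by
    rcases (show Φ x₀ - m ≤ R from hp.1).lt_or_eq with hlt | heq
    · have hs0 : 0 < 1 - (Φ x₀ - m) / R := by
        rw [sub_pos, div_lt_one hR]
        exact hlt
      have hs1 : 1 - (Φ x₀ - m) / R ≤ 1 := by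
        have : 0 ≤ (Φ x₀ - m) / R := div_nonneg (by linarith [hm x₀]) hR.le
        linarith
      have hη0 : 0 < cutoff Φ m R x₀ := pow_pos hs0 2
      have hη1 : cutoff Φ m R x₀ ≤ 1 := pow_le_one₀ hs0.le hs1
      have hr : (Real.sqrt (e₁ ⬝ᵥ hess Φ x₀ *ᵥ e₁))⁻¹ ^ 2 = (e₁ ⬝ᵥ hess Φ x₀ *ᵥ e₁)⁻¹ := by
        rw [inv_pow, Real.sq_sqrt hN1.le]
      have hopen : ∀ᶠ y in nhds x₀, Φ y - m < R :=
        (h2.continuous.sub continuous_const).continuousAt.eventually (gt_mem_nhds hlt)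
      have key := third_order_bound hΦ hpos hV hW (contDiff_cutoff h2 m R) hdet hc hΛ hB
        (x := x₀) (e := (Real.sqrt (e₁ ⬝ᵥ hess Φ x₀ *ᵥ e₁))⁻¹ • e₁) (Q := Q)
        (hle x₀) (hge x₀) (hVc x₀) (hWc _) (hV3 x₀) (hW3 _)
        (by rw [hNs, hr, inv_mul_cancel₀ hN1.ne']) hη0
        (by
          rw [← dirHess_eq_hess_dd h3]
          change Q = cubicNorm Φ x₀ _
          rw [cubicNorm_smul, hr, hQ, div_eq_inv_mul])
        (by
          filter_upwards [hopen] with y hy v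
          rw [← dirHess_eq_hess_dd h3]
          exact hall y hy.le v)
      have herr := cutoff_error_le hΛ hR hK h2 hpos hle hge hWK hm hlt hQ0
      exact mul_le_of_quadratic_le (div_pos hc hΛ) hη1 hQ0 (by positivity) (by positivity)
        (by linarith)
    · have : cutoff Φ m R x₀ = 0 := by
        rw [cutoff, heq, div_self hR.ne', sub_self, zero_pow two_ne_zero]
      rw [this, zero_mul]
      positivity
  exact (hall x hx u).trans (mul_le_mul_of_nonneg_right hbound (hN x hu).le)

end GlobalEstimate

section Conclusion

variable {n : ℕ} {Φ V W : (Fin n → ℝ) → ℝ} {c C B : ℝ}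

lemma IsTransport.isCompact_sublevel (h : IsTransport Φ V W c C) (r : ℝ) :
    IsCompact {x | Φ x ≤ r} := by
  obtain ⟨K, hK⟩ := h.exists_mul_norm_sub_le 1
  refine Metric.isCompact_of_isClosed_isBounded
    (isClosed_le h.contDiff.continuous continuous_const)
    ((Metric.isBounded_closedBall (x := (0 : Fin n → ℝ)) (r := r + K)).subset fun x hx => ?_)
  rw [mem_closedBall_zero_iff]
  have h1 := hK x
  have h2 : Φ x ≤ r := hx
  linarith

/-- The dimension-free bound for `Tr[(h⁻¹ ∂_u h)²]`, where `h = D²Φ` satisfies `Λ⁻¹ ≤ h ≤ Λ`. -/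
lemma IsTransport.cubicNorm_le (h : IsTransport Φ V W c C) (hΦ : ContDiff ℝ 5 Φ)
    (hV : ContDiff ℝ 3 V) (hW : ContDiff ℝ 3 W) (hc : 0 < c) {Λ : ℝ} (hΛ : 0 < Λ) (hB : 0 ≤ B)
    (hle : ∀ x, (Λ • (1 : Matrix (Fin n) (Fin n) ℝ) - hess Φ x).PosSemidef)
    (hge : ∀ x, (hess Φ x - Λ⁻¹ • (1 : Matrix (Fin n) (Fin n) ℝ)).PosSemidef)
    (hVc : ∀ x, (hess V x - c • (1 : Matrix (Fin n) (Fin n) ℝ)).PosSemidef)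
    (hV3 : ∀ x e : Fin n → ℝ, (∑ k, e k ^ 2) = 1 → (dirHess V e x * dirHess V e x).trace ≤ B)
    (hW3 : ∀ x e : Fin n → ℝ, (∑ k, e k ^ 2) = 1 → (dirHess W e x * dirHess W e x).trace ≤ B)
    (x : Fin n → ℝ) {u : Fin n → ℝ} (hu : u ≠ 0) :
    cubicNorm Φ x u ≤ 2 * Λ ^ 3 * B / (c / Λ) / (c / Λ) * (u ⬝ᵥ hess Φ x *ᵥ u) := by
  obtain ⟨K₀, hK₀⟩ := h.exists_mul_norm_sub_le 0
  obtain ⟨K, hK, hWK⟩ := exists_neg_le_grad_dotProduct_self h.contDiff_target hc h.target_ge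
  have hm : ∀ x, -K₀ ≤ Φ x := fun x => by
    have := hK₀ x
    linarith
  have hWc : ∀ y, (hess W y).PosSemidef := fun y => by
    have h1 := (h.target_ge y).add
      (PosSemidef.one.smul hc.le : (c • (1 : Matrix (Fin n) (Fin n) ℝ)).PosSemidef)
    rwa [sub_add_cancel] at h1
  have hcpt : ∀ R, IsCompact {x | Φ x - -K₀ ≤ R} := fun R => by
    simpa only [sub_le_iff_le_add] using h.isCompact_sublevel (R + -K₀)
  have hinv : ∀ b : ℝ, Tendsto (fun R : ℝ => b / R) atTop (nhds 0) := fun b =>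
    tendsto_const_nhds.div_atTop tendsto_id
  have hl : Tendsto (fun R => cutoff Φ (-K₀) R x * cubicNorm Φ x u) atTop
      (nhds (cubicNorm Φ x u)) := by
    have := (((hinv (Φ x - -K₀)).const_sub 1).pow 2).mul_const (cubicNorm Φ x u)
    simpa only [cutoff, sub_zero, one_pow, one_mul] using this
  have hr : Tendsto (fun R => (2 * Λ ^ 3 * B / (c / Λ) / (c / Λ)
      + 2 * ((16 * Λ ^ 2 + 2 * n + 2 * K) / R)) * (u ⬝ᵥ hess Φ x *ᵥ u)) atTop
      (nhds (2 * Λ ^ 3 * B / (c / Λ) / (c / Λ) * (u ⬝ᵥ hess Φ x *ᵥ u))) := by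
    have := (((hinv (16 * Λ ^ 2 + 2 * n + 2 * K)).const_mul 2).const_add
      (2 * Λ ^ 3 * B / (c / Λ) / (c / Λ))).mul_const (u ⬝ᵥ hess Φ x *ᵥ u)
    simpa only [mul_zero, add_zero] using this
  refine le_of_tendsto_of_tendsto hl hr ?_
  filter_upwards [eventually_gt_atTop 0, eventually_ge_atTop (Φ x - -K₀)] with R hR hxR
  exact cutoff_mul_cubicNorm_le hΦ h.posDef hV hW h.log_det hc hΛ hB hle hge hVc hWc hV3 hW3
    hK hWK hm hR (hcpt R) hxR hu

lemma trace_dirHess_sq_le_cubicNorm (hΦ : ContDiff ℝ 3 Φ) (hpos : ∀ x, (hess Φ x).PosDef) {Λ : ℝ}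
    (hΛ : 0 < Λ) {x : Fin n → ℝ}
    (hle : (Λ • (1 : Matrix (Fin n) (Fin n) ℝ) - hess Φ x).PosSemidef) (u : Fin n → ℝ) :
    (dirHess Φ u x * dirHess Φ u x).trace ≤ Λ ^ 2 * cubicNorm Φ x u := by
  set T := dirHess Φ u x with hT
  have hTs : Tᵀ = T := dirHess_transpose hΦ u x
  have hK := le_inv_of_le hΛ (hpos x) hle
  have conj : ∀ {M : Matrix (Fin n) (Fin n) ℝ}, M.PosSemidef → (T * M * T).PosSemidef := by
    intro M hM
    have := hM.conjTranspose_mul_mul_same T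
    rwa [conjTranspose_eq_transpose_of_trivial, hTs] at this
  have h1 := trace_mul_nonneg hK (conj (hpos x).inv.posSemidef)
  have h2 := trace_mul_nonneg hK (conj (PosSemidef.one))
  have h3 : (T * (hess Φ x)⁻¹ * T).trace = ((hess Φ x)⁻¹ * (T * T)).trace := by
    rw [Matrix.mul_assoc, trace_mul_comm, Matrix.mul_assoc]
  have h4 : cubicNorm Φ x u = ((hess Φ x)⁻¹ * (T * (hess Φ x)⁻¹ * T)).trace := by
    rw [cubicNorm, Matrix.mul_assoc, Matrix.mul_assoc, Matrix.mul_assoc]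
  rw [Matrix.sub_mul, trace_sub, Matrix.smul_mul, trace_smul, Matrix.one_mul, smul_eq_mul, h3,
    ← h4, sub_nonneg, inv_mul_le_iff₀ hΛ] at h1
  rw [Matrix.mul_one, Matrix.sub_mul, trace_sub, Matrix.smul_mul, trace_smul, Matrix.one_mul,
    smul_eq_mul, sub_nonneg, inv_mul_le_iff₀ hΛ] at h2
  calc (T * T).trace ≤ Λ * ((hess Φ x)⁻¹ * (T * T)).trace := h2
    _ ≤ Λ * (Λ * cubicNorm Φ x u) := mul_le_mul_of_nonneg_left h1 hΛ.le
    _ = Λ ^ 2 * cubicNorm Φ x u := by ring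

end Conclusion

end MongeAmpere

/-- dimension-free third-order estimate: under two-sided bounds on `D²V, D²W`
and third-order bounds `Tr[(∂_e D²V)²] ≤ B`, `Tr[(∂_e D²W)²] ≤ B`, there is `D = D(c,C) > 0`
with `Tr[(∂_e D²Φ)²] ≤ D·B`. -/
theorem stmt_17 (c C : ℝ) (hc : 0 < c) (hcC : c ≤ C) :
    ∃ D : ℝ, 0 < D ∧
      ∀ (n : ℕ) (B : ℝ), 0 < B →
      ∀ (Φ V W : (Fin n → ℝ) → ℝ) (μ ν : Measure (Fin n → ℝ)),
        ContDiff ℝ 5 Φ → ConvexOn ℝ Set.univ Φ → (∀ x, (hess Φ x).PosDef) →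
        ContDiff ℝ 3 V → ContDiff ℝ 3 W →
        μ = MeasureTheory.volume.withDensity (fun x => ENNReal.ofReal (Real.exp (-V x))) →
        ν = MeasureTheory.volume.withDensity (fun x => ENNReal.ofReal (Real.exp (-W x))) →
        IsProbabilityMeasure μ → IsProbabilityMeasure ν →
        (∀ x, Real.exp (-V x) = Real.exp (-W (grad Φ x)) * (hess Φ x).det) →
        (∀ x, (hess V x - c • (1 : Matrix (Fin n) (Fin n) ℝ)).PosSemidef) →
        (∀ x, (C • (1 : Matrix (Fin n) (Fin n) ℝ) - hess V x).PosSemidef) →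
        (∀ x, (hess W x - c • (1 : Matrix (Fin n) (Fin n) ℝ)).PosSemidef) →
        (∀ x, (C • (1 : Matrix (Fin n) (Fin n) ℝ) - hess W x).PosSemidef) →
        (∀ x, ∀ e : Fin n → ℝ, (∑ k, e k ^ 2) = 1 →
          (dirHess V e x * dirHess V e x).trace ≤ B) →
        (∀ x, ∀ e : Fin n → ℝ, (∑ k, e k ^ 2) = 1 →
          (dirHess W e x * dirHess W e x).trace ≤ B) →
        ∀ x, ∀ e : Fin n → ℝ, (∑ k, e k ^ 2) = 1 →
          (dirHess Φ e x * dirHess Φ e x).trace ≤ D * B := by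
  have hC : 0 < C := hc.trans_le hcC
  set Λ : ℝ := C / c + 1
  have hΛ : 0 < Λ := by positivity
  refine ⟨Λ ^ 2 * (2 * Λ ^ 3 / (c / Λ) / (c / Λ) * Λ), by positivity, ?_⟩
  intro n B hB Φ V W μ ν hΦ _ hpos hV hW hμ hν hμ1 hν1 hMA hVc hVC hWc hWC hV3 hW3 x e he
  have hT : MongeAmpere.IsTransport Φ V W c C :=
    { contDiff := hΦ.of_le (by norm_num)
      posDef := hpos
      contDiff_source := hV.of_le (by norm_num)
      contDiff_target := hW.of_le (by norm_num)
      source_le := hVC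
      target_ge := hWc
      lintegral_source := by
        have := hμ1.measure_univ
        rwa [hμ, withDensity_apply _ MeasurableSet.univ, Measure.restrict_univ] at this
      lintegral_target := by
        have := hν1.measure_univ
        rwa [hν, withDensity_apply _ MeasurableSet.univ, Measure.restrict_univ] at this
      monge_ampere := hMA }
  have hle : ∀ y, (Λ • (1 : Matrix (Fin n) (Fin n) ℝ) - hess Φ y).PosSemidef := hT.hess_le hc hC
  have hge : ∀ y, (hess Φ y - Λ⁻¹ • (1 : Matrix (Fin n) (Fin n) ℝ)).PosSemidef :=
    hT.le_hess hc hC hVc hWC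
  have hee : dotProduct e e = 1 := by
    rw [← he]
    simp only [dotProduct, sq]
  have hne : e ≠ 0 := by
    rintro rfl
    simp at hee
  have h1 := MongeAmpere.trace_dirHess_sq_le_cubicNorm (hΦ.of_le (by norm_num)) hpos hΛ (hle x) e
  have h2 := hT.cubicNorm_le hΦ hV hW hc hΛ hB.le hle hge hVc hV3 hW3 x hne
  have h3 := MongeAmpere.dotProduct_mulVec_le (hle x) e
  rw [hee, mul_one] at h3
  calc (dirHess Φ e x * dirHess Φ e x).trace ≤ Λ ^ 2 * MongeAmpere.cubicNorm Φ x e := h1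
    _ ≤ Λ ^ 2 * (2 * Λ ^ 3 * B / (c / Λ) / (c / Λ) * Λ) := by
        gcongr
        exact h2.trans (by gcongr)
    _ = Λ ^ 2 * (2 * Λ ^ 3 / (c / Λ) / (c / Λ) * Λ) * B := by ring
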